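/- Assume Hypotheses 3.1 and 5.1. Fix s ∈ [0,T] and a Borel probability measure ζ on H, and define K₁ := { μ ∈ M_{s,ζ} : ∫_s^T ∫_H (|x|² + |F(t,x)| + |x|²|F(t,x)|) μ_t(dx)dt < ∞ }. Then K₁ contains at most one element. -/

import Mathlib

open MeasureTheory Set Filter Topology
open scoped InnerProductSpace ENNReal NNReal

attribute [local instance] Classical.propDecidable

noncomputable section

variable (H : Type) [NormedAddCommGroup H] [InnerProductSpace ℝ H] [CompleteSpace H]
  [SecondCountableTopology H] [MeasurableSpace H] [BorelSpace H]

/-- All data of the framework: the `C₀`-semigroup `e^{tA}` with its generator `A`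
(a densely defined unbounded operator), the diffusion operator `C` (symmetric, nonnegative)
with a square root `C^{1/2}`, a Hilbert basis of `H`, the time horizon `T > 0`, and the
Borel measurable drift `F` defined on a Borel set `DF ⊆ [0,T] × H`. -/
structure FPData where
  T : ℝ
  hT : 0 < T
  S : ℝ → H →L[ℝ] H
  S_zero : S 0 = 1
  S_add : ∀ s t : ℝ, 0 ≤ s → 0 ≤ t → S (s + t) = (S s).comp (S t)
  S_cont : ∀ x : H, ContinuousOn (fun t => S t x) (Ici (0 : ℝ))
  A : H →ₗ.[ℝ] H
  A_dense : Dense (A.domain : Set H)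
  A_mem_iff : ∀ x : H, x ∈ A.domain ↔
    ∃ y : H, Tendsto (fun t : ℝ => t⁻¹ • (S t x - x)) (𝓝[>] 0) (𝓝 y)
  A_gen : ∀ x : A.domain,
    Tendsto (fun t : ℝ => t⁻¹ • (S t (x : H) - (x : H))) (𝓝[>] 0) (𝓝 (A x))
  C : H →L[ℝ] H
  C_pos : C.IsPositive
  sqrtC : H →L[ℝ] H
  sqrtC_pos : sqrtC.IsPositive
  sqrtC_sq : sqrtC.comp sqrtC = C
  ι : Type
  basis : HilbertBasis ι ℝ H
  F : ℝ × H → H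
  DF : Set (ℝ × H)
  DF_meas : MeasurableSet DF
  F_meas : Measurable F

variable {H}

/-- The spatial gradient `D_x u(t,x)` of a function `u : ℝ × H → ℝ`. -/
def xGrad (u : ℝ × H → ℝ) (p : ℝ × H) : H :=
  gradient (fun z => u (p.1, z)) p.2

/-- The set `Sf` of functions is dense in `L¹([s,T] × H, μ)`. -/
def DenseRangeL1 (μ : Measure (ℝ × H)) (Sf : Set (ℝ × H → ℝ)) : Prop :=
  ∀ f : ℝ × H → ℝ, Integrable f μ → ∀ ε > 0,
    ∃ g ∈ Sf, Integrable g μ ∧ ∫ p, |f p - g p| ∂μ < ε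

namespace FPData

variable (D : FPData H)

/-- `h ∈ C¹([0,T]; D(A*))`, represented by the pair `(h, g)` with `g t = A* (h t)`. -/
def CinDAstar (h g : ℝ → H) : Prop :=
  ContDiffOn ℝ 1 h (Icc 0 D.T) ∧ ContDiffOn ℝ 1 g (Icc 0 D.T) ∧
    ∀ t ∈ Icc 0 D.T, (h t, g t) ∈ D.A.adjoint.graph

/-- Generators of `E_A([0,T] × H)`: real parts of `φ(t) e^{i⟨x, h(t)⟩}`. -/
def EAgen : Set (ℝ × H → ℝ) :=
  {u | ∃ (φ : ℝ → ℝ) (h g : ℝ → H), ContDiffOn ℝ 1 φ (Icc 0 D.T) ∧ φ D.T = 0 ∧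
    D.CinDAstar h g ∧
    (u = (fun p => φ p.1 * Real.cos ⟪p.2, h p.1⟫_ℝ) ∨
     u = (fun p => φ p.1 * Real.sin ⟪p.2, h p.1⟫_ℝ))}

/-- The space of test functions `E_A([0,T] × H) = D(L₀)`: the linear span of the generators. -/
def EA : Set (ℝ × H → ℝ) := ↑(Submodule.span ℝ D.EAgen)

/-- The trace term `Tr[C D²_x u(t,x)] = Σ_i ⟨D²_x u(t,x)(C^{1/2} e_i), C^{1/2} e_i⟩`. -/
def traceCD2 (u : ℝ × H → ℝ) (p : ℝ × H) : ℝ :=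
  ∑' i : D.ι,
    ⟪(fderiv ℝ (gradient fun z => u (p.1, z)) p.2) (D.sqrtC (D.basis i)),
      D.sqrtC (D.basis i)⟫_ℝ

/-- The Ornstein–Uhlenbeck part `V₀u = D_t u + (1/2)Tr[C D²_x u] + ⟨x, A* D_x u⟩`
of the Kolmogorov operator. -/
def Vzero (u : ℝ × H → ℝ) (p : ℝ × H) : ℝ :=
  deriv (fun r => u (r, p.2)) p.1 + (1 / 2) * D.traceCD2 u p +
    (if hk : xGrad u p ∈ D.A.adjoint.domain then ⟪p.2, D.A.adjoint ⟨xGrad u p, hk⟩⟫_ℝ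
     else 0)

/-- The Kolmogorov operator `L₀u = V₀u + ⟨F(t,x), D_x u⟩`. -/
def Lzero (u : ℝ × H → ℝ) (p : ℝ × H) : ℝ :=
  D.Vzero u p + ⟪D.F p, xGrad u p⟫_ℝ

/-- `|F(t,x)|`, with the convention `|F(t,x)| = +∞` outside `D(F)`. -/
def FnormE (p : ℝ × H) : ℝ≥0∞ := if p ∈ D.DF then (‖D.F p‖₊ : ℝ≥0∞) else ⊤

/-- Condition (1.6): `∫ (|⟨y, A*h(t)⟩| + |F(t,y)|) dμ < ∞` for all `h ∈ C¹([0,T]; D(A*))`. -/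
def DriftIntegrable (μ : Measure (ℝ × H)) : Prop :=
  ∀ h g : ℝ → H, D.CinDAstar h g →
    ∫⁻ p, ((‖⟪p.2, g p.1⟫_ℝ‖₊ : ℝ≥0∞) + D.FnormE p) ∂μ < ⊤

/-- `μ(dt,dx) = μ_t(dx) dt` on `[s,T] × H` for a measurable kernel `(μ_t)`. -/
def IsKernel (s : ℝ) (μ : Measure (ℝ × H)) (μt : ℝ → Measure H) : Prop :=
  (∀ B : Set H, MeasurableSet B → Measurable fun t => μt t B) ∧
  ∀ E : Set (ℝ × H), MeasurableSet E → μ E = ∫⁻ t in Icc s D.T, μt t {x | (t, x) ∈ E}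

/-- `μ = μ_t dt` is a solution of the Fokker–Planck equation (1.5) with initial condition
`ζ` at time `s` (membership in `M_{s,ζ}`). -/
def IsFPSol (s : ℝ) (ζ : Measure H) (μ : Measure (ℝ × H)) (μt : ℝ → Measure H) : Prop :=
  (∀ t ∈ Icc s D.T, IsProbabilityMeasure (μt t)) ∧
  D.IsKernel s μ μt ∧ D.DriftIntegrable μ ∧
  ∀ u ∈ D.EA, ∀ᵐ t ∂(volume.restrict (Icc s D.T)),
    ∫ y, u (t, y) ∂(μt t) =
      ∫ y, u (s, y) ∂ζ + ∫ r in Icc s t, (∫ y, D.Lzero u (r, y) ∂(μt r))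

/-- The set `M_{s,ζ}` of solutions of the Fokker–Planck equation. -/
def Mset (s : ℝ) (ζ : Measure H) : Set (Measure (ℝ × H)) :=
  {μ | ∃ μt : ℝ → Measure H, D.IsFPSol s ζ μ μt}

/-- Membership in `M_s^λ` (formula (4.2)): `ν = ν_t dt` is a finite nonnegative measure with
`∫ L₀ u dν ≤ 2λ ∫ u dν` for all nonnegative `u ∈ E_A`. -/
def IsSubInv (lam s : ℝ) (ν : Measure (ℝ × H)) (νt : ℝ → Measure H) : Prop :=
  (∀ t ∈ Icc s D.T, IsFiniteMeasure (νt t)) ∧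
  D.IsKernel s ν νt ∧ D.DriftIntegrable ν ∧
  ∀ u ∈ D.EA, (∀ p : ℝ × H, p.1 ∈ Icc 0 D.T → 0 ≤ u p) →
    ∫ t in Icc s D.T, (∫ y, D.Lzero u (t, y) ∂(νt t)) ≤
      2 * lam * ∫ t in Icc s D.T, (∫ y, u (t, y) ∂(νt t))

/-- The moment condition `∫_s^T ∫_H (|x|⁴ + |F(t,x)|² + |x|⁴|F(t,x)|²) ν_t(dx) dt < ∞`. -/
def moment2 (s : ℝ) (νt : ℝ → Measure H) : Prop :=
  ∫⁻ t in Icc s D.T, (∫⁻ y, (ENNReal.ofReal (‖y‖ ^ 4) + (D.FnormE (t, y)) ^ 2 +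
    ENNReal.ofReal (‖y‖ ^ 4) * (D.FnormE (t, y)) ^ 2) ∂(νt t)) < ⊤

/-- The moment condition `∫_s^T ∫_H (|x|² + |F(t,x)| + |x|²|F(t,x)|) ν_t(dx) dt < ∞`. -/
def moment1 (s : ℝ) (νt : ℝ → Measure H) : Prop :=
  ∫⁻ t in Icc s D.T, (∫⁻ y, (ENNReal.ofReal (‖y‖ ^ 2) + D.FnormE (t, y) +
    ENNReal.ofReal (‖y‖ ^ 2) * D.FnormE (t, y)) ∂(νt t)) < ⊤

/-- Hypothesis 3.1: dissipativity of `A`, trace class `Q_t = ∫_0^t e^{sA} C e^{sA*} ds`,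
and the smoothing condition `e^{tA}(H) ⊆ Q_t^{1/2}(H)` with `Λ_t := (Q_t^{1/2})^{-1} e^{tA}`
satisfying `∫_0^∞ e^{-λt} ‖Λ_t‖ dt < ∞` for `λ` large enough. -/
structure Hyp31 where
  ω : ℝ
  A_diss : ∀ x : D.A.domain, ⟪D.A x, (x : H)⟫_ℝ ≤ ω * ‖(x : H)‖ ^ 2
  Q : ℝ → H →L[ℝ] H
  Q_def : ∀ t : ℝ, 0 < t → ∀ x : H,
    Q t x = ∫ r in (0 : ℝ)..t, D.S r (D.C ((ContinuousLinearMap.adjoint (D.S r)) x))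
  Q_pos : ∀ t : ℝ, 0 < t → (Q t).IsPositive
  Q_traceClass : ∀ t : ℝ, 0 < t → Summable fun i : D.ι => ⟪Q t (D.basis i), D.basis i⟫_ℝ
  sqrtQ : ℝ → H →L[ℝ] H
  sqrtQ_pos : ∀ t : ℝ, 0 < t → (sqrtQ t).IsPositive
  sqrtQ_sq : ∀ t : ℝ, 0 < t → (sqrtQ t).comp (sqrtQ t) = Q t
  range_incl : ∀ t : ℝ, 0 < t → Set.range (D.S t) ⊆ Set.range (sqrtQ t)
  Λ : ℝ → H →L[ℝ] H
  Λ_spec : ∀ t : ℝ, 0 < t → (sqrtQ t).comp (Λ t) = D.S t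
  lam₀ : ℝ
  Λ_int : ∀ lam : ℝ, lam₀ ≤ lam →
    IntegrableOn (fun t => Real.exp (-lam * t) * ‖Λ t‖) (Ioi 0)

/-- Hypothesis 5.1: `F(t,·)` is the minimal section of an `m`-dissipative graph
`F̄(t,·)`, with `F(t,0) = 0`. -/
structure Hyp51 where
  Fbar : ℝ → H → Set H
  dom_meas : ∀ t ∈ Icc 0 D.T, MeasurableSet {x : H | (Fbar t x).Nonempty}
  K : ℝ
  K_pos : 0 < K
  diss : ∀ t ∈ Icc 0 D.T, ∀ x y u v : H, u ∈ Fbar t x → v ∈ Fbar t y →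
    ⟪u - v, x - y⟫_ℝ ≤ K * ‖x - y‖ ^ 2
  mrange : ∀ t ∈ Icc 0 D.T, ∀ lam : ℝ, K < lam → ∀ z : H,
    ∃ x : H, ∃ w ∈ Fbar t x, lam • x - w = z
  dom_eq : ∀ t ∈ Icc 0 D.T, ∀ x : H, (t, x) ∈ D.DF ↔ (Fbar t x).Nonempty
  minimal : ∀ t ∈ Icc 0 D.T, ∀ x : H, (t, x) ∈ D.DF →
    D.F (t, x) ∈ Fbar t x ∧ ∀ w ∈ Fbar t x, ‖D.F (t, x)‖ ≤ ‖w‖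
  zero_mem : ∀ t ∈ Icc 0 D.T, (t, (0 : H)) ∈ D.DF ∧ D.F (t, 0) = 0

/-- Hypothesis 3.3 for a drift `F₀ : [0,T] × H → H`: continuity, continuous space
derivative, and uniform Lipschitz continuity in the space variable. -/
def Hyp33 (F0 : ℝ × H → H) : Prop :=
  ContinuousOn F0 (Icc 0 D.T ×ˢ (univ : Set H)) ∧
  (∀ t ∈ Icc 0 D.T, ∀ x : H, DifferentiableAt ℝ (fun y => F0 (t, y)) x) ∧
  (∀ t ∈ Icc 0 D.T, Continuous fun x : H => fderiv ℝ (fun y => F0 (t, y)) x) ∧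
  ∃ K > 0, ∀ t ∈ Icc 0 D.T, ∀ x y : H, ‖F0 (t, x) - F0 (t, y)‖ ≤ K * ‖x - y‖

/-- The data of the Ornstein–Uhlenbeck semigroup: the Gaussian measures `N_{Q_t}`
(specified through their characteristic functionals). -/
structure OUData (hyp : D.Hyp31) where
  N : ℝ → Measure H
  N_prob : ∀ t : ℝ, 0 ≤ t → IsProbabilityMeasure (N t)
  N_zero : N 0 = Measure.dirac 0
  N_char : ∀ t : ℝ, 0 < t → ∀ h : H,
    ∫ x, Complex.exp ((⟪x, h⟫_ℝ : ℂ) * Complex.I) ∂(N t) =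
      Complex.exp (-((⟪hyp.Q t h, h⟫_ℝ : ℂ)) / 2)

end FPData

namespace FPData.OUData

variable {H : Type} [NormedAddCommGroup H] [InnerProductSpace ℝ H] [CompleteSpace H]
  [SecondCountableTopology H] [MeasurableSpace H] [BorelSpace H]
  {D : FPData H} {hyp : D.Hyp31}

/-- The Ornstein–Uhlenbeck semigroup `R_t φ(x) = ∫_H φ(e^{tA} x + y) N_{Q_t}(dy)`. -/
def Rop (O : D.OUData hyp) (t : ℝ) (φ : H → ℝ) (x : H) : ℝ :=
  ∫ y, φ (D.S t x + y) ∂(O.N t)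

/-- The resolvent `G̃_λ f(x) = ∫_0^∞ e^{-λt} R_t f(x) dt` of the OU semigroup. -/
def Gtilde (O : D.OUData hyp) (lam : ℝ) (f : H → ℝ) (x : H) : ℝ :=
  ∫ t in Ioi (0 : ℝ), Real.exp (-lam * t) * O.Rop t f x

/-- The resolvent `G_λ f(t,x) = ∫_t^T e^{-λ(r-t)} R_{r-t} f(r,·)(x) dr` of the
time-dependent OU operator `V`; by definition `u ∈ D(V)` iff `u = G_λ f` for some `λ` and
some `f ∈ C([0,T]; C_{u,2}(H))`, and then `Vu = λu - f`. -/
def Gop (O : D.OUData hyp) (lam : ℝ) (f : ℝ → H → ℝ) (p : ℝ × H) : ℝ :=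
  ∫ r in p.1..D.T, Real.exp (-lam * (r - p.1)) * O.Rop (r - p.1) (f r) p.2

end FPData.OUData

section Spaces

variable {H : Type} [NormedAddCommGroup H] [InnerProductSpace ℝ H] [CompleteSpace H]

/-- Membership in `C_{u,2}(H)`: `x ↦ φ(x)/(1+|x|²)` is uniformly continuous and bounded. -/
def MemCu2 (φ : H → ℝ) : Prop :=
  UniformContinuous (fun x : H => φ x / (1 + ‖x‖ ^ 2)) ∧
    ∃ M : ℝ, ∀ x : H, |φ x| ≤ M * (1 + ‖x‖ ^ 2)

/-- The norm of `C_{u,2}(H)`: `‖φ‖ = sup_x |φ(x)|/(1+|x|²)`. -/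
def cu2Norm (φ : H → ℝ) : ℝ := ⨆ x : H, |φ x| / (1 + ‖x‖ ^ 2)

/-- The sup norm `‖f‖_∞ = sup_x |f(x)|`. -/
def supNorm (f : H → ℝ) : ℝ := ⨆ x : H, |f x|

/-- Membership in `C¹_u(H)`: bounded and uniformly continuous together with the
(Fréchet) derivative. -/
def MemC1u (φ : H → ℝ) : Prop :=
  UniformContinuous φ ∧ (∃ M : ℝ, ∀ x : H, |φ x| ≤ M) ∧ Differentiable ℝ φ ∧
    UniformContinuous (gradient φ) ∧ ∃ M : ℝ, ∀ x : H, ‖gradient φ x‖ ≤ M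

/-- Membership in `C_u(H,H)`: bounded and uniformly continuous `H → H`. -/
def MemCuHH (Φ : H → H) : Prop := UniformContinuous Φ ∧ ∃ M : ℝ, ∀ x : H, ‖Φ x‖ ≤ M

end Spaces

namespace FPData

variable {H : Type} [NormedAddCommGroup H] [InnerProductSpace ℝ H] [CompleteSpace H]
  [SecondCountableTopology H] [MeasurableSpace H] [BorelSpace H] (D : FPData H)

/-- Membership in `C([0,T]; C_{u,2}(H))`. -/
def MemCT (f : ℝ → H → ℝ) : Prop :=
  (∀ t ∈ Icc 0 D.T, MemCu2 (f t)) ∧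
  ∀ t₀ ∈ Icc 0 D.T, ∀ ε > 0, ∃ δ > 0, ∀ t ∈ Icc 0 D.T, |t - t₀| < δ →
    ∀ x : H, |f t x - f t₀ x| ≤ ε * (1 + ‖x‖ ^ 2)

/-- Membership in `C([0,T]; C¹_u(H))`. -/
def MemCTC1u (f : ℝ → H → ℝ) : Prop :=
  (∀ t ∈ Icc 0 D.T, MemC1u (f t)) ∧
  ∀ t₀ ∈ Icc 0 D.T, ∀ ε > 0, ∃ δ > 0, ∀ t ∈ Icc 0 D.T, |t - t₀| < δ →
    ∀ x : H, |f t x - f t₀ x| + ‖gradient (f t) x - gradient (f t₀) x‖ ≤ ε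

/-- `D_x u ∈ C([0,T]; C_u(H,H))`. -/
def GradInCTCuHH (u : ℝ × H → ℝ) : Prop :=
  (∀ t ∈ Icc 0 D.T, MemCuHH fun x : H => xGrad u (t, x)) ∧
  ∀ t₀ ∈ Icc 0 D.T, ∀ ε > 0, ∃ δ > 0, ∀ t ∈ Icc 0 D.T, |t - t₀| < δ →
    ∀ x : H, ‖xGrad u (t, x) - xGrad u (t₀, x)‖ ≤ ε

end FPData

end

namespace FPData

section Semigroup

variable {H : Type} [NormedAddCommGroup H] [InnerProductSpace ℝ H] [CompleteSpace H]
  [SecondCountableTopology H] [MeasurableSpace H] [BorelSpace H] (D : FPData H)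

/-- The graph of `A*`, described by the duality relation. -/
lemma mem_adjoint_graph {h g : H} :
    (h, g) ∈ D.A.adjoint.graph ↔ ∀ x : D.A.domain, ⟪g, (x : H)⟫_ℝ = ⟪h, D.A x⟫_ℝ := by
  constructor
  · intro hg x
    obtain ⟨y, rfl, rfl⟩ := (LinearPMap.mem_graph_iff _).1 hg
    exact LinearPMap.adjoint_isFormalAdjoint D.A_dense y x
  · intro hx
    refine (LinearPMap.mem_graph_iff _).2
      ⟨⟨h, LinearPMap.mem_adjoint_domain_of_exists h ⟨g, hx⟩⟩, rfl, ?_⟩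
    exact LinearPMap.adjoint_apply_eq D.A_dense _ hx

lemma S_comm {s t : ℝ} (hs : 0 ≤ s) (ht : 0 ≤ t) (x : H) :
    D.S s (D.S t x) = D.S t (D.S s x) := by
  have h1 := D.S_add s t hs ht
  have h2 := D.S_add t s ht hs
  rw [add_comm, h1] at h2
  exact DFunLike.congr_fun h2 x

lemma S_add_apply {s t : ℝ} (hs : 0 ≤ s) (ht : 0 ≤ t) (x : H) :
    D.S (s + t) x = D.S s (D.S t x) := by rw [D.S_add s t hs ht]; rfl

lemma tendsto_S_apply {t : ℝ} (ht : 0 ≤ t) (x : D.A.domain) :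
    Tendsto (fun r : ℝ => r⁻¹ • (D.S r (D.S t x) - D.S t x)) (𝓝[>] 0) (𝓝 (D.S t (D.A x))) := by
  have h := ((D.S t).continuous.tendsto _).comp (D.A_gen x)
  refine h.congr' ?_
  filter_upwards [self_mem_nhdsWithin] with r hr
  simp only [Function.comp, map_smul, map_sub]
  rw [D.S_comm (le_of_lt hr) ht]

lemma S_mem_domain {t : ℝ} (ht : 0 ≤ t) (x : D.A.domain) : D.S t x ∈ D.A.domain :=
  (D.A_mem_iff _).2 ⟨_, D.tendsto_S_apply ht x⟩

lemma A_S {t : ℝ} (ht : 0 ≤ t) (x : D.A.domain) :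
    D.A ⟨D.S t x, D.S_mem_domain ht x⟩ = D.S t (D.A x) :=
  tendsto_nhds_unique (D.A_gen ⟨D.S t x, D.S_mem_domain ht x⟩) (D.tendsto_S_apply ht x)

lemma S_hasDerivWithinAt {t : ℝ} (ht : 0 ≤ t) (x : D.A.domain) :
    HasDerivWithinAt (fun t => D.S t x) (D.S t (D.A x)) (Ioi t) t := by
  rw [hasDerivWithinAt_iff_tendsto_slope' (by simp)]
  have h := D.tendsto_S_apply ht x
  have h2 : Tendsto (fun u : ℝ => u - t) (𝓝[>] t) (𝓝[>] 0) := by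
    refine tendsto_nhdsWithin_iff.2 ⟨?_, ?_⟩
    · have : Tendsto (fun u : ℝ => u - t) (𝓝 t) (𝓝 (t - t)) := by
        exact (continuous_id.sub continuous_const).tendsto t
      rw [sub_self] at this
      exact this.mono_left nhdsWithin_le_nhds
    · filter_upwards [self_mem_nhdsWithin] with u hu
      simpa using hu
  refine (h.comp h2).congr' ?_
  filter_upwards [self_mem_nhdsWithin] with u hu
  have hu' : 0 ≤ u - t := sub_nonneg.2 (le_of_lt hu)
  simp only [Function.comp, slope, vsub_eq_sub]
  rw [← D.S_add_apply hu' ht, sub_add_cancel]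

lemma S_continuousOn_Icc (x : H) (a : ℝ) : ContinuousOn (fun t => D.S t x) (Icc 0 a) :=
  (D.S_cont x).mono fun _ h => h.1

lemma S_intervalIntegrable (x : H) {a : ℝ} (ha : 0 ≤ a) :
    IntervalIntegrable (fun t => D.S t x) volume 0 a :=
  ContinuousOn.intervalIntegrable (by rw [uIcc_of_le ha]; exact D.S_continuousOn_Icc x a)

lemma S_sub_eq_integral {t : ℝ} (ht : 0 ≤ t) (x : D.A.domain) :
    ∫ r in (0:ℝ)..t, D.S r (D.A x) = D.S t x - x := by
  have h := intervalIntegral.integral_eq_sub_of_hasDeriv_right (a := 0) (b := t)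
    (f := fun t => D.S t x) (f' := fun r => D.S r (D.A x))
    (by rw [uIcc_of_le ht]; exact D.S_continuousOn_Icc _ _)
    (fun r hr => D.S_hasDerivWithinAt (by rw [min_eq_left ht] at hr; exact hr.1.le) x)
    (D.S_intervalIntegrable _ ht)
  rw [h, D.S_zero]; rfl

variable {D}

lemma Hyp31.norm_S_le (hyp : D.Hyp31) {t : ℝ} (ht : 0 ≤ t) (x : H) :
    ‖D.S t x‖ ≤ Real.exp (max hyp.ω 0 * t) * ‖x‖ := by
  set w := max hyp.ω 0 with hw
  have key : ∀ x : D.A.domain, ‖D.S t x‖ ≤ Real.exp (w * t) * ‖(x : H)‖ := by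
    intro x
    have hd : ∀ r ∈ Ico 0 t, HasDerivWithinAt
        (fun r => Real.exp (-(2 * w) * r) * ‖D.S r x‖ ^ 2)
        (Real.exp (-(2 * w) * r) * (-(2 * w)) * ‖D.S r x‖ ^ 2 +
          Real.exp (-(2 * w) * r) * (2 * ⟪D.S r x, D.S r (D.A x)⟫_ℝ)) (Ici r) r := by
      intro r hr
      have h1 := ((D.S_hasDerivWithinAt hr.1 x).Ici_of_Ioi).norm_sq
      have h2 : HasDerivAt (fun r => Real.exp (-(2 * w) * r))
          (Real.exp (-(2 * w) * r) * (-(2 * w))) r := by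
        simpa using ((hasDerivAt_id r).const_mul (-(2 * w))).exp
      exact h2.hasDerivWithinAt.mul h1
    have hc : ContinuousOn (fun r => Real.exp (-(2 * w) * r) * ‖D.S r x‖ ^ 2) (Icc 0 t) :=
      (by fun_prop : Continuous fun r : ℝ => Real.exp (-(2 * w) * r)).continuousOn.mul
        ((D.S_continuousOn_Icc (x : H) t).norm.pow 2)
    have := image_le_of_deriv_right_le_deriv_boundary hc hd (B := fun _ => ‖(x : H)‖ ^ 2)
      (B' := fun _ => 0) (by simp [D.S_zero]) continuousOn_const
      (fun r _ => (hasDerivAt_const r _).hasDerivWithinAt) (by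
        intro r hr
        have h1 := hyp.A_diss ⟨D.S r x, D.S_mem_domain hr.1 x⟩
        rw [D.A_S hr.1 x] at h1
        have h2 : hyp.ω * ‖D.S r x‖ ^ 2 ≤ w * ‖D.S r x‖ ^ 2 :=
          mul_le_mul_of_nonneg_right (le_max_left _ _) (sq_nonneg _)
        rw [real_inner_comm] at h1
        have h3 : 0 < Real.exp (-(2 * w) * r) := Real.exp_pos _
        nlinarith) (right_mem_Icc.2 ht)
    have h4 : ‖D.S t x‖ ^ 2 ≤ (Real.exp (w * t) * ‖(x : H)‖) ^ 2 := by
      have h5 : Real.exp (w * t) ^ 2 * Real.exp (-(2 * w) * t) = 1 := by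
        rw [← Real.exp_nat_mul, ← Real.exp_add]; simp; ring
      have h6 := mul_le_mul_of_nonneg_left this (sq_nonneg (Real.exp (w * t)))
      rw [← mul_assoc, h5, one_mul] at h6
      rw [mul_pow]; exact h6
    exact (pow_le_pow_iff_left₀ (norm_nonneg _) (by positivity) two_ne_zero).1 h4
  have hcl : IsClosed {x : H | ‖D.S t x‖ ≤ Real.exp (w * t) * ‖x‖} :=
    isClosed_le (D.S t).continuous.norm (continuous_const.mul continuous_norm)
  exact (D.A_dense.induction (P := fun x => ‖D.S t x‖ ≤ Real.exp (w * t) * ‖x‖)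
    (fun x hx => key ⟨x, hx⟩) hcl) x

/-- The adjoint semigroup. -/
noncomputable def Sadj (D : FPData H) (t : ℝ) : H →L[ℝ] H := ContinuousLinearMap.adjoint (D.S t)

lemma Sadj_inner (t : ℝ) (x y : H) : ⟪D.Sadj t x, y⟫_ℝ = ⟪x, D.S t y⟫_ℝ :=
  ContinuousLinearMap.adjoint_inner_left _ _ _

lemma inner_Sadj (t : ℝ) (x y : H) : ⟪x, D.Sadj t y⟫_ℝ = ⟪D.S t x, y⟫_ℝ :=
  ContinuousLinearMap.adjoint_inner_right _ _ _

lemma Sadj_zero (x : H) : D.Sadj 0 x = x := by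
  refine ext_inner_right ℝ fun y => ?_
  rw [Sadj_inner, D.S_zero]; rfl

lemma Sadj_add {s t : ℝ} (hs : 0 ≤ s) (ht : 0 ≤ t) (x : H) :
    D.Sadj (s + t) x = D.Sadj s (D.Sadj t x) := by
  refine ext_inner_right ℝ fun y => ?_
  rw [Sadj_inner, Sadj_inner, Sadj_inner, add_comm, D.S_add_apply ht hs]

lemma Hyp31.norm_Sadj_le (hyp : D.Hyp31) {t : ℝ} (ht : 0 ≤ t) (x : H) :
    ‖D.Sadj t x‖ ≤ Real.exp (max hyp.ω 0 * t) * ‖x‖ := by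
  have h1 : ‖D.S t‖ ≤ Real.exp (max hyp.ω 0 * t) :=
    ContinuousLinearMap.opNorm_le_bound _ (Real.exp_pos _).le (hyp.norm_S_le ht)
  have h2 : ‖D.Sadj t‖ = ‖D.S t‖ := LinearIsometryEquiv.norm_map _ _
  exact ((D.Sadj t).le_opNorm x).trans (mul_le_mul_of_nonneg_right (h2 ▸ h1) (norm_nonneg _))

lemma Sadj_graph {t : ℝ} (ht : 0 ≤ t) {h g : H} (hg : (h, g) ∈ D.A.adjoint.graph) :
    (D.Sadj t h, D.Sadj t g) ∈ D.A.adjoint.graph := by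
  rw [mem_adjoint_graph] at hg ⊢
  intro x
  rw [Sadj_inner, Sadj_inner, ← D.A_S ht x, ← hg ⟨D.S t x, D.S_mem_domain ht x⟩]

lemma Sadj_sub_inner {t : ℝ} (ht : 0 ≤ t) {h g : H} (hg : (h, g) ∈ D.A.adjoint.graph)
    (x : D.A.domain) :
    ⟪D.Sadj t h - h, (x : H)⟫_ℝ = ∫ r in (0:ℝ)..t, ⟪g, D.S r x⟫_ℝ := by
  rw [inner_sub_left, Sadj_inner, ← inner_sub_right, ← D.S_sub_eq_integral ht x]
  have h1 := (innerSL ℝ h).intervalIntegral_comp_comm (D.S_intervalIntegrable (D.A x) ht)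
  simp only [innerSL_apply_apply] at h1
  rw [← h1]
  refine intervalIntegral.integral_congr fun r hr => ?_
  rw [uIcc_of_le ht] at hr
  rw [← D.A_S hr.1 x, ← D.mem_adjoint_graph.1 hg ⟨D.S r x, D.S_mem_domain hr.1 x⟩]

lemma Hyp31.norm_Sadj_sub_le (hyp : D.Hyp31) {t : ℝ} (ht : 0 ≤ t) {h g : H}
    (hg : (h, g) ∈ D.A.adjoint.graph) :
    ‖D.Sadj t h - h‖ ≤ Real.exp (max hyp.ω 0 * t) * ‖g‖ * t := by
  set w := max hyp.ω 0 with hw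
  have hw0 : 0 ≤ w := le_max_right _ _
  have key : ∀ x : H, ⟪D.Sadj t h - h, x⟫_ℝ ≤ Real.exp (w * t) * ‖g‖ * t * ‖x‖ := by
    have hcl : IsClosed {x : H | ⟪D.Sadj t h - h, x⟫_ℝ ≤ Real.exp (w * t) * ‖g‖ * t * ‖x‖} :=
      isClosed_le (continuous_const.inner continuous_id) (continuous_const.mul continuous_norm)
    refine D.A_dense.induction (fun x hx => ?_) hcl
    rw [Sadj_sub_inner ht hg ⟨x, hx⟩]
    have h1 : ‖∫ r in (0:ℝ)..t, ⟪g, D.S r x⟫_ℝ‖ ≤ (‖g‖ * (Real.exp (w * t) * ‖x‖)) * |t - 0| := by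
      refine intervalIntegral.norm_integral_le_of_norm_le_const fun r hr => ?_
      rw [uIoc_of_le ht] at hr
      refine (norm_inner_le_norm _ _).trans (mul_le_mul_of_nonneg_left ?_ (norm_nonneg _))
      refine (hyp.norm_S_le hr.1.le x).trans (mul_le_mul_of_nonneg_right ?_ (norm_nonneg _))
      exact Real.exp_le_exp.2 (mul_le_mul_of_nonneg_left hr.2 hw0)
    rw [sub_zero, abs_of_nonneg ht] at h1
    calc _ ≤ _ := (le_abs_self _).trans h1
      _ = _ := by ring
  have h2 := key (D.Sadj t h - h)
  rw [real_inner_self_eq_norm_sq, sq] at h2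
  rcases eq_or_lt_of_le (norm_nonneg (D.Sadj t h - h)) with h0 | h0
  · rw [← h0]; positivity
  · exact le_of_mul_le_mul_right h2 h0

/-- `t ↦ S*_{max t 0} h` is continuous for `h ∈ D(A*)`. -/
lemma Hyp31.Sadj_continuous (hyp : D.Hyp31) {h g : H} (hg : (h, g) ∈ D.A.adjoint.graph) :
    Continuous fun t : ℝ => D.Sadj (max t 0) h := by
  set w := max hyp.ω 0 with hw
  have hw0 : 0 ≤ w := le_max_right _ _
  have hb : ∀ a b c : ℝ, 0 ≤ a → a ≤ b → b ≤ c → ‖D.Sadj b h - D.Sadj a h‖ ≤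
      Real.exp (w * c) * (Real.exp (w * c) * ‖g‖) * |b - a| := by
    intro a b c ha hab hbc
    have h1 : D.Sadj b h - D.Sadj a h = D.Sadj a (D.Sadj (b - a) h - h) := by
      rw [map_sub, ← Sadj_add ha (sub_nonneg.2 hab), add_sub_cancel]
    rw [h1]
    refine (hyp.norm_Sadj_le ha _).trans ?_
    rw [mul_assoc, abs_of_nonneg (sub_nonneg.2 hab)]
    refine mul_le_mul (Real.exp_le_exp.2 (mul_le_mul_of_nonneg_left (hab.trans hbc) hw0)) ?_
      (norm_nonneg _) (Real.exp_pos _).le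
    refine (hyp.norm_Sadj_sub_le (sub_nonneg.2 hab) hg).trans ?_
    gcongr
    linarith
  have hcts : ∀ c : ℝ, ContinuousOn (fun t : ℝ => D.Sadj t h) (Icc 0 c) := by
    intro c
    refine LipschitzOnWith.continuousOn
      (K := (Real.exp (w * c) * (Real.exp (w * c) * ‖g‖)).toNNReal) ?_
    refine LipschitzOnWith.of_dist_le_mul fun a ha b hb' => ?_
    rw [Real.coe_toNNReal _ (by positivity), dist_eq_norm, Real.dist_eq]
    rcases le_total a b with hab | hab
    · rw [norm_sub_rev, abs_sub_comm]; exact hb a b c ha.1 hab hb'.2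
    · exact hb b a c hb'.1 hab ha.2
  have hcts2 : ContinuousOn (fun t : ℝ => D.Sadj t h) (Ici 0) := by
    intro t ht
    have h1 := hcts (t + 1) t ⟨ht, by linarith⟩
    refine h1.mono_of_mem_nhdsWithin ?_
    rw [mem_nhdsWithin]
    exact ⟨Iio (t + 1), isOpen_Iio, by simp, fun u hu => ⟨hu.2, (le_of_lt hu.1)⟩⟩
  exact hcts2.comp_continuous (continuous_id.max continuous_const) fun t => mem_Ici.2 (le_max_right _ _)

lemma Hyp31.Sadj_eq_integral (hyp : D.Hyp31) {t : ℝ} (ht : 0 ≤ t) {h g k : H}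
    (hg : (h, g) ∈ D.A.adjoint.graph) (hk : (g, k) ∈ D.A.adjoint.graph) :
    D.Sadj t h = h + ∫ r in (0:ℝ)..t, D.Sadj (max r 0) g := by
  rw [← sub_eq_iff_eq_add']
  have hd : Dense ((D.A.domain : Submodule ℝ H) : Set H) := D.A_dense
  refine hd.eq_of_inner_left (𝕜 := ℝ) fun x hx => ?_
  have hi : IntervalIntegrable (fun r => D.Sadj (max r 0) g) volume 0 t :=
    (hyp.Sadj_continuous hk).intervalIntegrable _ _
  rw [Sadj_sub_inner ht hg ⟨x, hx⟩, real_inner_comm]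
  have h1 := (innerSL ℝ x).intervalIntegral_comp_comm hi
  simp only [innerSL_apply_apply] at h1
  rw [← h1]
  refine intervalIntegral.integral_congr fun r hr => ?_
  rw [uIcc_of_le ht] at hr
  simp only
  rw [max_eq_left hr.1, inner_Sadj, real_inner_comm]

/-- The vectors in `D((A*)³)`. -/
def V (D : FPData H) : Submodule ℝ H where
  carrier := {h | ∃ g k l, (h, g) ∈ D.A.adjoint.graph ∧ (g, k) ∈ D.A.adjoint.graph ∧
    (k, l) ∈ D.A.adjoint.graph}
  zero_mem' := ⟨0, 0, 0, by simp, by simp, by simp⟩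
  add_mem' := by
    rintro a b ⟨g, k, l, h1, h2, h3⟩ ⟨g', k', l', h1', h2', h3'⟩
    exact ⟨g + g', k + k', l + l', Submodule.add_mem _ h1 h1', Submodule.add_mem _ h2 h2',
      Submodule.add_mem _ h3 h3'⟩
  smul_mem' := by
    rintro c a ⟨g, k, l, h1, h2, h3⟩
    exact ⟨c • g, c • k, c • l, Submodule.smul_mem _ c h1, Submodule.smul_mem _ c h2,
      Submodule.smul_mem _ c h3⟩

/-- Time averages `ε⁻¹ ∫₀^ε S_r x dr` of the semigroup. -/
lemma Hyp31.exists_average (hyp : D.Hyp31) {ε : ℝ} (hε : 0 < ε) :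
    ∃ B : H →L[ℝ] H, ∀ x, B x = ε⁻¹ • ∫ r in (0:ℝ)..ε, D.S r x := by
  set w := max hyp.ω 0 with hw
  have hw0 : 0 ≤ w := le_max_right _ _
  let L : H →ₗ[ℝ] H :=
    { toFun := fun x => ε⁻¹ • ∫ r in (0:ℝ)..ε, D.S r x
      map_add' := fun x y => by
        simp only [map_add]
        rw [intervalIntegral.integral_add (D.S_intervalIntegrable _ hε.le)
          (D.S_intervalIntegrable _ hε.le), smul_add]
      map_smul' := fun c x => by
        simp only [map_smul, RingHom.id_apply]
        rw [intervalIntegral.integral_smul, smul_comm] }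
  refine ⟨L.mkContinuous (Real.exp (w * ε)) fun x => ?_, fun x => rfl⟩
  change ‖ε⁻¹ • ∫ r in (0:ℝ)..ε, D.S r x‖ ≤ _
  have h1 : ‖∫ r in (0:ℝ)..ε, D.S r x‖ ≤ (Real.exp (w * ε) * ‖x‖) * |ε - 0| := by
    refine intervalIntegral.norm_integral_le_of_norm_le_const fun r hr => ?_
    rw [uIoc_of_le hε.le] at hr
    refine (hyp.norm_S_le hr.1.le x).trans (mul_le_mul_of_nonneg_right ?_ (norm_nonneg _))
    exact Real.exp_le_exp.2 (mul_le_mul_of_nonneg_left hr.2 hw0)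
  rw [sub_zero, abs_of_pos hε] at h1
  rw [norm_smul, norm_inv, Real.norm_of_nonneg hε.le, inv_mul_le_iff₀ hε]
  linarith

lemma average_tendsto (x : H) {η : ℝ} (hη : 0 < η) :
    ∃ δ > 0, ∀ ε, 0 < ε → ε < δ → ‖(ε⁻¹ • ∫ r in (0:ℝ)..ε, D.S r x) - x‖ ≤ η := by
  have h0 : ContinuousWithinAt (fun t => D.S t x) (Ici 0) 0 := D.S_cont x 0 self_mem_Ici
  obtain ⟨δ, hδ, h1⟩ := Metric.continuousWithinAt_iff.1 h0 η hη
  refine ⟨δ, hδ, fun ε hε hεδ => ?_⟩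
  have h2 : (ε⁻¹ • ∫ r in (0:ℝ)..ε, D.S r x) - x = ε⁻¹ • ∫ r in (0:ℝ)..ε, (D.S r x - x) := by
    rw [intervalIntegral.integral_sub (D.S_intervalIntegrable x hε.le) (by simp), smul_sub]
    simp [smul_smul, hε.ne']
  have h3 : ‖∫ r in (0:ℝ)..ε, (D.S r x - x)‖ ≤ η * |ε - 0| := by
    refine intervalIntegral.norm_integral_le_of_norm_le_const fun r hr => ?_
    rw [uIoc_of_le hε.le] at hr
    have h4 := h1 (mem_Ici.2 hr.1.le) (by
      rw [Real.dist_eq, sub_zero, abs_of_pos hr.1]; linarith [hr.2])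
    simp only [D.S_zero, dist_eq_norm] at h4
    exact h4.le
  rw [sub_zero, abs_of_pos hε] at h3
  rw [h2, norm_smul, norm_inv, Real.norm_of_nonneg hε.le, inv_mul_le_iff₀ hε]
  linarith

lemma Hyp31.dense_V (hyp : D.Hyp31) : Dense (D.V : Set H) := by
  set w := max hyp.ω 0 with hw
  have hw0 : 0 ≤ w := le_max_right _ _
  rw [Submodule.dense_iff_topologicalClosure_eq_top, Submodule.topologicalClosure_eq_top_iff,
    Submodule.eq_bot_iff]
  intro y hy
  rw [Submodule.mem_orthogonal] at hy
  have key : ∀ ε : ℝ, 0 < ε → ∀ B : H →L[ℝ] H, (∀ x, B x = ε⁻¹ • ∫ r in (0:ℝ)..ε, D.S r x) →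
      B (B (B y)) = 0 := by
    intro ε hε B hB
    have hcomm : ∀ x, D.S ε (B x) = B (D.S ε x) := by
      intro x
      rw [hB, hB, map_smul,
        ← (D.S ε).intervalIntegral_comp_comm (D.S_intervalIntegrable _ hε.le)]
      congr 1
      refine intervalIntegral.integral_congr fun r hr => ?_
      rw [uIcc_of_le hε.le] at hr
      exact D.S_comm hε.le hr.1 x
    set B' := ContinuousLinearMap.adjoint B with hB'
    have hBl : ∀ a b, ⟪B' a, b⟫_ℝ = ⟪a, B b⟫_ℝ := fun a b =>
      ContinuousLinearMap.adjoint_inner_left _ _ _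
    have hgr : ∀ a, (B' a, ε⁻¹ • (D.Sadj ε a - a)) ∈ D.A.adjoint.graph := by
      intro a
      rw [mem_adjoint_graph]
      intro x
      rw [hBl, hB, D.S_sub_eq_integral hε.le x, inner_smul_left, inner_smul_right,
        inner_sub_left, inner_sub_right, Sadj_inner]
      simp
    have hcomm' : ∀ a, D.Sadj ε (B' a) = B' (D.Sadj ε a) := by
      intro a
      refine ext_inner_right ℝ fun z => ?_
      rw [Sadj_inner, hBl, hBl, Sadj_inner, hcomm]
    have hcomm2 : ∀ a, ε⁻¹ • (D.Sadj ε (B' a) - B' a) = B' (ε⁻¹ • (D.Sadj ε a - a)) := by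
      intro a
      rw [hcomm', map_smul, map_sub]
    refine ext_inner_left ℝ fun a => ?_
    rw [inner_zero_right, ← hBl, ← hBl, ← hBl]
    refine hy _ ⟨B' (B' (ε⁻¹ • (D.Sadj ε a - a))),
      B' (ε⁻¹ • (D.Sadj ε (ε⁻¹ • (D.Sadj ε a - a)) - ε⁻¹ • (D.Sadj ε a - a))), _, ?_, ?_, hgr _⟩
    · have h1 := hgr (B' (B' a))
      rwa [hcomm2, hcomm2] at h1
    · have h1 := hgr (B' (ε⁻¹ • (D.Sadj ε a - a)))
      rwa [hcomm2] at h1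
  have hb : ∀ ε : ℝ, 0 < ε → ε ≤ 1 → ∀ B : H →L[ℝ] H,
      (∀ x, B x = ε⁻¹ • ∫ r in (0:ℝ)..ε, D.S r x) → ∀ x, ‖B x‖ ≤ Real.exp w * ‖x‖ := by
    intro ε hε hε1 B hB x
    rw [hB]
    have h1 : ‖∫ r in (0:ℝ)..ε, D.S r x‖ ≤ (Real.exp w * ‖x‖) * |ε - 0| := by
      refine intervalIntegral.norm_integral_le_of_norm_le_const fun r hr => ?_
      rw [uIoc_of_le hε.le] at hr
      refine (hyp.norm_S_le hr.1.le x).trans (mul_le_mul_of_nonneg_right ?_ (norm_nonneg _))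
      refine Real.exp_le_exp.2 ?_
      have : r ≤ 1 := hr.2.trans hε1
      nlinarith
    rw [sub_zero, abs_of_pos hε] at h1
    rw [norm_smul, norm_inv, Real.norm_of_nonneg hε.le, inv_mul_le_iff₀ hε]
    linarith
  have hy0 : ∀ η : ℝ, 0 < η → ‖y‖ ≤ η := by
    intro η hη
    set c := Real.exp w * Real.exp w + Real.exp w + 1 with hc
    have hcpos : 0 < c := by positivity
    obtain ⟨δ, hδ, h1⟩ := D.average_tendsto y (div_pos hη hcpos)
    set ε := min (δ / 2) 1 with hε
    have hεpos : 0 < ε := by positivity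
    have hεδ : ε < δ := (min_le_left _ _).trans_lt (by linarith)
    obtain ⟨B, hB⟩ := hyp.exists_average hεpos
    have h2 := h1 ε hεpos hεδ
    rw [← hB] at h2
    have hbB := hb ε hεpos (min_le_right _ _) B hB
    have h3 : y = -(B (B (B y - y)) + B (B y - y) + (B y - y)) := by
      simp only [map_sub, key ε hεpos B hB]; abel
    have h4 : ‖y‖ ≤ ‖B (B (B y - y))‖ + ‖B (B y - y)‖ + ‖B y - y‖ := by
      conv_lhs => rw [h3, norm_neg]
      exact norm_add₃_le
    have h5 := hbB (B y - y)
    have h6 := (hbB (B (B y - y))).trans (mul_le_mul_of_nonneg_left h5 (Real.exp_pos w).le)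
    have h7 : ‖y‖ ≤ c * ‖B y - y‖ := by rw [hc]; nlinarith
    calc ‖y‖ ≤ c * ‖B y - y‖ := h7
      _ ≤ c * (η / c) := mul_le_mul_of_nonneg_left h2 hcpos.le
      _ = η := by field_simp
  exact norm_le_zero_iff.1 (le_of_forall_gt_imp_ge_of_dense fun η hη => hy0 η hη)

end Semigroup

section TestFunctions

variable {H : Type} [NormedAddCommGroup H] [InnerProductSpace ℝ H] [CompleteSpace H]
  [SecondCountableTopology H] [MeasurableSpace H] [BorelSpace H] (D : FPData H)

/-- The extension of `τ ↦ S*_τ h` (with `g = A* h`) to a `C¹` function on the line. -/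
noncomputable def adjExt (h g : H) (τ : ℝ) : H := h + ∫ r in (0:ℝ)..τ, D.Sadj (max r 0) g

/-- The Gaussian factor `exp (-½ ∫₀^τ |C^{1/2} S*_σ h|² dσ)`. -/
noncomputable def gaussFactor (h : H) (τ : ℝ) : ℝ :=
  Real.exp (-(1 / 2) * ∫ r in (0:ℝ)..τ, ‖D.sqrtC (D.Sadj (max r 0) h)‖ ^ 2)

variable {D}

lemma Hyp31.adjExt_hasDerivAt (hyp : D.Hyp31) {g k : H} (hk : (g, k) ∈ D.A.adjoint.graph)
    (h : H) (τ : ℝ) : HasDerivAt (D.adjExt h g) (D.Sadj (max τ 0) g) τ := by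
  have hc := hyp.Sadj_continuous hk
  exact (intervalIntegral.integral_hasDerivAt_right (hc.intervalIntegrable _ _)
    (hc.stronglyMeasurableAtFilter _ _) hc.continuousAt).const_add h

lemma Hyp31.adjExt_contDiff (hyp : D.Hyp31) {g k : H} (hk : (g, k) ∈ D.A.adjoint.graph) (h : H) :
    ContDiff ℝ 1 (D.adjExt h g) := by
  have hd : deriv (D.adjExt h g) = fun τ => D.Sadj (max τ 0) g :=
    funext fun τ => (hyp.adjExt_hasDerivAt hk h τ).deriv
  rw [contDiff_one_iff_deriv, hd]
  exact ⟨fun τ => (hyp.adjExt_hasDerivAt hk h τ).differentiableAt, hyp.Sadj_continuous hk⟩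

lemma Hyp31.adjExt_eq (hyp : D.Hyp31) {h g k : H} (hg : (h, g) ∈ D.A.adjoint.graph)
    (hk : (g, k) ∈ D.A.adjoint.graph) {τ : ℝ} (hτ : 0 ≤ τ) : D.adjExt h g τ = D.Sadj τ h :=
  (hyp.Sadj_eq_integral hτ hg hk).symm

lemma adjExt_neg {h g : H} {τ : ℝ} (hτ : τ ≤ 0) : D.adjExt h g τ = h + τ • g := by
  rw [adjExt]
  have : ∫ r in (0:ℝ)..τ, D.Sadj (max r 0) g = ∫ r in (0:ℝ)..τ, g := by
    refine intervalIntegral.integral_congr fun r hr => ?_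
    rw [uIcc_of_ge hτ] at hr
    simp only [max_eq_right hr.2, Sadj_zero]
  rw [this]; simp

lemma Hyp31.adjExt_graph (hyp : D.Hyp31) {h g k l : H} (hg : (h, g) ∈ D.A.adjoint.graph)
    (hk : (g, k) ∈ D.A.adjoint.graph) (hl : (k, l) ∈ D.A.adjoint.graph) (τ : ℝ) :
    (D.adjExt h g τ, D.adjExt g k τ) ∈ D.A.adjoint.graph := by
  rcases le_total 0 τ with hτ | hτ
  · rw [hyp.adjExt_eq hg hk hτ, hyp.adjExt_eq hk hl hτ]
    exact Sadj_graph hτ hg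
  · rw [adjExt_neg hτ, adjExt_neg hτ]
    exact Submodule.add_mem _ hg (Submodule.smul_mem _ τ hk)

lemma Hyp31.continuous_sqrtC_sq (hyp : D.Hyp31) {h g : H} (hg : (h, g) ∈ D.A.adjoint.graph) :
    Continuous fun r : ℝ => ‖D.sqrtC (D.Sadj (max r 0) h)‖ ^ 2 :=
  (D.sqrtC.continuous.comp (hyp.Sadj_continuous hg)).norm.pow 2

lemma Hyp31.gaussFactor_hasDerivAt (hyp : D.Hyp31) {h g : H} (hg : (h, g) ∈ D.A.adjoint.graph)
    (τ : ℝ) : HasDerivAt (D.gaussFactor h)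
      (D.gaussFactor h τ * (-(1 / 2) * ‖D.sqrtC (D.Sadj (max τ 0) h)‖ ^ 2)) τ := by
  have hc := hyp.continuous_sqrtC_sq hg
  exact ((intervalIntegral.integral_hasDerivAt_right (hc.intervalIntegrable 0 τ)
    (hc.stronglyMeasurableAtFilter _ _) hc.continuousAt).const_mul (-(1 / 2))).exp

lemma Hyp31.gaussFactor_contDiff (hyp : D.Hyp31) {h g : H} (hg : (h, g) ∈ D.A.adjoint.graph) :
    ContDiff ℝ 1 (D.gaussFactor h) := by
  have hd : deriv (D.gaussFactor h) = fun τ =>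
      D.gaussFactor h τ * (-(1 / 2) * ‖D.sqrtC (D.Sadj (max τ 0) h)‖ ^ 2) :=
    funext fun τ => (hyp.gaussFactor_hasDerivAt hg τ).deriv
  have hdiff : Differentiable ℝ (D.gaussFactor h) :=
    fun τ => (hyp.gaussFactor_hasDerivAt hg τ).differentiableAt
  rw [contDiff_one_iff_deriv, hd]
  exact ⟨hdiff, hdiff.continuous.mul (continuous_const.mul (hyp.continuous_sqrtC_sq hg))⟩

lemma gaussFactor_pos (h : H) (τ : ℝ) : 0 < D.gaussFactor h τ := Real.exp_pos _

lemma gaussFactor_zero (h : H) : D.gaussFactor h 0 = 1 := by simp [gaussFactor]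

lemma gaussFactor_le_one (h : H) {τ : ℝ} (hτ : 0 ≤ τ) : D.gaussFactor h τ ≤ 1 := by
  rw [gaussFactor, Real.exp_le_one_iff]
  have : 0 ≤ ∫ r in (0:ℝ)..τ, ‖D.sqrtC (D.Sadj (max r 0) h)‖ ^ 2 :=
    intervalIntegral.integral_nonneg hτ fun r _ => sq_nonneg _
  linarith

lemma hasFDerivAt_cos_inner (c θ : ℝ) (h x : H) :
    HasFDerivAt (fun z : H => c * Real.cos (⟪z, h⟫_ℝ + θ))
      ((-(c * Real.sin (⟪x, h⟫_ℝ + θ))) • innerSL ℝ h) x := by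
  have h1 : HasFDerivAt (fun z : H => ⟪z, h⟫_ℝ + θ) (innerSL ℝ h) x := by
    have h2 : (fun z : H => ⟪z, h⟫_ℝ + θ) = fun z => innerSL ℝ h z + θ := by
      ext z; rw [innerSL_apply_apply, real_inner_comm]
    rw [h2]
    exact (innerSL ℝ h).hasFDerivAt.add_const θ
  have h3 := (h1.cos).const_mul c
  refine h3.congr_fderiv ?_
  rw [smul_smul]
  congr 1
  ring

lemma gradient_cos_inner (c θ : ℝ) (h : H) :
    gradient (fun z : H => c * Real.cos (⟪z, h⟫_ℝ + θ)) =
      fun x => (-(c * Real.sin (⟪x, h⟫_ℝ + θ))) • h := by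
  ext1 x
  refine HasGradientAt.gradient ?_
  rw [hasGradientAt_iff_hasFDerivAt]
  refine (hasFDerivAt_cos_inner c θ h x).congr_fderiv ?_
  ext z
  simp

lemma fderiv_gradient_cos_inner (c θ : ℝ) (h x a : H) :
    fderiv ℝ (gradient (fun z : H => c * Real.cos (⟪z, h⟫_ℝ + θ))) x a =
      (-(c * Real.cos (⟪x, h⟫_ℝ + θ)) * ⟪h, a⟫_ℝ) • h := by
  rw [gradient_cos_inner]
  have h1 : HasFDerivAt (fun x : H => -(c * Real.sin (⟪x, h⟫_ℝ + θ)))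
      ((-(c * Real.cos (⟪x, h⟫_ℝ + θ))) • innerSL ℝ h) x := by
    have h2 := hasFDerivAt_cos_inner (-c) (θ - Real.pi / 2) h x
    have e1 : ∀ y : ℝ, Real.cos (y + (θ - Real.pi / 2)) = Real.sin (y + θ) := by
      intro y; rw [← add_sub_assoc, Real.cos_sub_pi_div_two]
    have e2 : ∀ y : ℝ, Real.sin (y + (θ - Real.pi / 2)) = -Real.cos (y + θ) := by
      intro y; rw [← add_sub_assoc, Real.sin_sub_pi_div_two]
    simp only [e1, e2] at h2
    convert h2 using 1
    · ext; ring
    · congr 1; ring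
  rw [(h1.smul_const h).fderiv]
  simp

lemma traceCD2_cos (φ : ℝ → ℝ) (η : ℝ → H) (θ : ℝ) (p : ℝ × H) :
    D.traceCD2 (fun p => φ p.1 * Real.cos (⟪p.2, η p.1⟫_ℝ + θ)) p =
      -(φ p.1 * Real.cos (⟪p.2, η p.1⟫_ℝ + θ)) * ‖D.sqrtC (η p.1)‖ ^ 2 := by
  rw [traceCD2]
  simp only [fderiv_gradient_cos_inner, inner_smul_left, conj_trivial]
  have hs : ∀ i, ⟪η p.1, D.sqrtC (D.basis i)⟫_ℝ = ⟪D.sqrtC (η p.1), D.basis i⟫_ℝ := fun i =>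
    (D.sqrtC_pos.isSymmetric _ _).symm
  simp only [hs]
  have h1 := D.basis.tsum_inner_mul_inner (D.sqrtC (η p.1)) (D.sqrtC (η p.1))
  rw [real_inner_self_eq_norm_sq] at h1
  rw [← h1, ← tsum_mul_left]
  refine tsum_congr fun i => ?_
  rw [real_inner_comm (D.sqrtC (η p.1)) (D.basis i)]
  ring

lemma Lzero_cos {φ : ℝ → ℝ} {η : ℝ → H} {θ φ' : ℝ} {η' g : H} {t : ℝ} (x : H)
    (hφ : HasDerivAt φ φ' t) (hη : HasDerivAt η η' t) (hg : (η t, g) ∈ D.A.adjoint.graph) :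
    D.Lzero (fun p => φ p.1 * Real.cos (⟪p.2, η p.1⟫_ℝ + θ)) (t, x) =
      (φ' - 1 / 2 * ‖D.sqrtC (η t)‖ ^ 2 * φ t) * Real.cos (⟪x, η t⟫_ℝ + θ)
        - φ t * Real.sin (⟪x, η t⟫_ℝ + θ) * (⟪x, η' + g⟫_ℝ + ⟪D.F (t, x), η t⟫_ℝ) := by
  set u : ℝ × H → ℝ := fun p => φ p.1 * Real.cos (⟪p.2, η p.1⟫_ℝ + θ) with hu
  have hx : xGrad u (t, x) = (-(φ t * Real.sin (⟪x, η t⟫_ℝ + θ))) • η t := by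
    have := congrFun (gradient_cos_inner (φ t) θ (η t)) x
    exact this
  have hd : deriv (fun r => u (r, x)) t = φ' * Real.cos (⟪x, η t⟫_ℝ + θ) +
      φ t * (-Real.sin (⟪x, η t⟫_ℝ + θ) * ⟪x, η'⟫_ℝ) := by
    have h1 : HasDerivAt (fun r => ⟪x, η r⟫_ℝ + θ) ⟪x, η'⟫_ℝ t := by
      have := ((innerSL ℝ x).hasFDerivAt.comp_hasDerivAt t hη).add_const θ
      simpa using this
    exact (hφ.mul h1.cos).deriv
  have hgr : (xGrad u (t, x), (-(φ t * Real.sin (⟪x, η t⟫_ℝ + θ))) • g) ∈ D.A.adjoint.graph := by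
    rw [hx]; exact Submodule.smul_mem _ (-(φ t * Real.sin (⟪x, η t⟫_ℝ + θ))) hg
  obtain ⟨y, hy1, hy2⟩ := (LinearPMap.mem_graph_iff _).1 hgr
  simp only at hy1 hy2
  have hmem : xGrad u (t, x) ∈ D.A.adjoint.domain := hy1 ▸ y.2
  have hyeq : (⟨xGrad u (t, x), hmem⟩ : D.A.adjoint.domain) = y := Subtype.ext hy1.symm
  rw [Lzero, Vzero, dif_pos hmem, hyeq, hy2, hx]
  simp only [hd]
  rw [hu, traceCD2_cos]
  simp only [inner_smul_right, inner_add_right]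
  ring

lemma cos_mem_EA {φ : ℝ → ℝ} {η g : ℝ → H} (θ : ℝ) (hφ : ContDiff ℝ 1 φ) (hT : φ D.T = 0)
    (hη : ContDiff ℝ 1 η) (hg : ContDiff ℝ 1 g) (hgr : ∀ t, (η t, g t) ∈ D.A.adjoint.graph) :
    (fun p : ℝ × H => φ p.1 * Real.cos (⟪p.2, η p.1⟫_ℝ + θ)) ∈ D.EA := by
  have hC : D.CinDAstar η g := ⟨hη.contDiffOn, hg.contDiffOn, fun t _ => hgr t⟩
  have h1 : (fun p : ℝ × H => φ p.1 * Real.cos ⟪p.2, η p.1⟫_ℝ) ∈ D.EAgen :=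
    ⟨φ, η, g, hφ.contDiffOn, hT, hC, Or.inl rfl⟩
  have h2 : (fun p : ℝ × H => φ p.1 * Real.sin ⟪p.2, η p.1⟫_ℝ) ∈ D.EAgen :=
    ⟨φ, η, g, hφ.contDiffOn, hT, hC, Or.inr rfl⟩
  have h3 : (fun p : ℝ × H => φ p.1 * Real.cos (⟪p.2, η p.1⟫_ℝ + θ)) =
      Real.cos θ • (fun p : ℝ × H => φ p.1 * Real.cos ⟪p.2, η p.1⟫_ℝ) -
      Real.sin θ • (fun p : ℝ × H => φ p.1 * Real.sin ⟪p.2, η p.1⟫_ℝ) := by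
    ext p
    simp only [Pi.sub_apply, Pi.smul_apply, smul_eq_mul, Real.cos_add]
    ring
  rw [h3]
  exact Submodule.sub_mem _ (Submodule.smul_mem _ _ (Submodule.subset_span h1))
    (Submodule.smul_mem _ _ (Submodule.subset_span h2))

/-- A `C¹` cutoff, equal to `1` before time `r` and vanishing at time `T`. -/
noncomputable def timeCutoff (T r t : ℝ) : ℝ := 1 - (max (t - r) 0 / (T - r)) ^ 2

lemma timeCutoff_of_le {T r t : ℝ} (h : t ≤ r) : timeCutoff T r t = 1 := by
  simp [timeCutoff, max_eq_right (sub_nonpos.2 h)]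

lemma timeCutoff_end {T r : ℝ} (h : r < T) : timeCutoff T r T = 0 := by
  have : T - r ≠ 0 := (sub_pos.2 h).ne'
  simp [timeCutoff, max_eq_left (sub_pos.2 h).le, this]

lemma timeCutoff_contDiff (T r : ℝ) : ContDiff ℝ 1 (timeCutoff T r) := by
  have h0 : ∀ y : ℝ, HasDerivAt (fun y : ℝ => (max y 0) ^ 2) (2 * max y 0) y := by
    intro y
    rcases lt_trichotomy y 0 with hy | rfl | hy
    · have : (fun y : ℝ => (max y 0) ^ 2) =ᶠ[𝓝 y] fun _ => 0 := by
        filter_upwards [Iio_mem_nhds hy] with z hz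
        rw [max_eq_right (le_of_lt hz)]; norm_num
      rw [max_eq_right hy.le, mul_zero]
      exact (hasDerivAt_const y (0:ℝ)).congr_of_eventuallyEq this
    · rw [hasDerivAt_iff_isLittleO]
      simp only [max_self, mul_zero, smul_zero, sub_zero, ne_eq, OfNat.ofNat_ne_zero,
        not_false_eq_true, zero_pow]
      refine Asymptotics.IsBigO.trans_isLittleO (g := fun y : ℝ => y ^ 2) ?_ ?_
      · refine Asymptotics.IsBigO.of_bound 1 (Eventually.of_forall fun y => ?_)
        rw [one_mul, norm_pow, norm_pow]
        gcongr
        simp only [Real.norm_eq_abs]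
        rcases le_total y 0 with h | h
        · simp [max_eq_right h]
        · rw [max_eq_left h]
      · simpa using Asymptotics.isLittleO_pow_id (𝕜 := ℝ) (n := 2) (by norm_num)
    · have : (fun y : ℝ => (max y 0) ^ 2) =ᶠ[𝓝 y] fun y => y ^ 2 := by
        filter_upwards [Ioi_mem_nhds hy] with z hz
        rw [max_eq_left (le_of_lt hz)]
      rw [max_eq_left hy.le]
      have h2 := (hasDerivAt_pow 2 y)
      simp only [Nat.cast_ofNat, Nat.add_one_sub_one, pow_one] at h2
      exact h2.congr_of_eventuallyEq this
  have h1 : ContDiff ℝ 1 (fun y : ℝ => (max y 0) ^ 2) := by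
    rw [contDiff_one_iff_deriv]
    refine ⟨fun y => (h0 y).differentiableAt, ?_⟩
    rw [funext fun y => (h0 y).deriv]
    fun_prop
  have h2 : timeCutoff T r = fun t => 1 - ((max (t - r) 0) ^ 2) * ((T - r) ^ 2)⁻¹ := by
    ext t; rw [timeCutoff, div_pow, div_eq_mul_inv]
  rw [h2]
  exact contDiff_const.sub ((h1.comp (contDiff_id.sub contDiff_const)).mul contDiff_const)

end TestFunctions

section Duhamel

open ProbabilityTheory

variable {H : Type} [NormedAddCommGroup H] [InnerProductSpace ℝ H] [CompleteSpace H]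
  [SecondCountableTopology H] [MeasurableSpace H] [BorelSpace H] {D : FPData H}
  {s : ℝ} {ζ : Measure H} {μ : Measure (ℝ × H)} {μt : ℝ → Measure H}

lemma IsFPSol.exists_kernel (sol : D.IsFPSol s ζ μ μt) :
    ∃ κ : Kernel ℝ H, IsFiniteKernel κ ∧ (∀ t ∈ Icc s D.T, κ t = μt t) ∧
      μ = (volume.restrict (Icc s D.T)) ⊗ₘ κ := by
  have hm : Measurable fun t : ℝ => if t ∈ Icc s D.T then μt t else 0 := by
    refine Measurable.ite measurableSet_Icc ?_ measurable_const
    exact Measure.measurable_of_measurable_coe _ fun B hB => sol.2.1.1 B hB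
  let κ : Kernel ℝ H := ⟨fun t => if t ∈ Icc s D.T then μt t else 0, hm⟩
  have hκ : ∀ t ∈ Icc s D.T, κ t = μt t := fun t ht => if_pos ht
  have hfin : IsFiniteKernel κ := by
    refine ⟨⟨1, ENNReal.one_lt_top, fun t => ?_⟩⟩
    by_cases ht : t ∈ Icc s D.T
    · rw [hκ t ht]
      have := sol.1 t ht
      exact prob_le_one
    · have : κ t = 0 := if_neg ht
      simp [this]
  refine ⟨κ, hfin, hκ, Measure.ext fun E hE => ?_⟩
  rw [sol.2.1.2 E hE, Measure.compProd_apply hE]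
  refine setLIntegral_congr_fun measurableSet_Icc fun t ht => ?_
  simp only [hκ t ht]
  rfl

lemma IsFPSol.isFiniteMeasure (sol : D.IsFPSol s ζ μ μt) : IsFiniteMeasure μ := by
  obtain ⟨κ, hfin, -, rfl⟩ := sol.exists_kernel
  infer_instance

lemma IsFPSol.ae_mem (sol : D.IsFPSol s ζ μ μt) : ∀ᵐ p ∂μ, p.1 ∈ Icc s D.T := by
  have hE : MeasurableSet {p : ℝ × H | ¬ p.1 ∈ Icc s D.T} :=
    (measurable_fst measurableSet_Icc).compl
  rw [ae_iff, sol.2.1.2 _ hE, setLIntegral_congr_fun (g := fun _ => 0) measurableSet_Icc]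
  · simp
  · intro t ht
    simp [ht.1, not_lt.2 ht.2]

lemma IsFPSol.integral_eq (sol : D.IsFPSol s ζ μ μt) {f : ℝ × H → ℝ} (hf : Integrable f μ) :
    ∫ p, f p ∂μ = ∫ t in Icc s D.T, ∫ y, f (t, y) ∂(μt t) := by
  obtain ⟨κ, hfin, hκ, hμ⟩ := sol.exists_kernel
  rw [hμ] at hf ⊢
  rw [Measure.integral_compProd hf]
  refine setIntegral_congr_fun measurableSet_Icc fun t ht => ?_
  simp only [hκ t ht]

lemma IsFPSol.integral_indicator_eq (sol : D.IsFPSol s ζ μ μt) {f : ℝ × H → ℝ} {t : ℝ}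
    (ht : t ≤ D.T) (hf : Integrable ({p : ℝ × H | p.1 < t}.indicator f) μ) :
    ∫ p, {p : ℝ × H | p.1 < t}.indicator f p ∂μ = ∫ r in Icc s t, ∫ y, f (r, y) ∂(μt r) := by
  rw [sol.integral_eq hf, integral_Icc_eq_integral_Ico (y := t)]
  have h1 : ∀ r y, {p : ℝ × H | p.1 < t}.indicator f (r, y) =
      (Iio t).indicator (fun r => f (r, y)) r := fun r y => rfl
  have h2 : ∀ r, ∫ y, {p : ℝ × H | p.1 < t}.indicator f (r, y) ∂(μt r) =
      (Iio t).indicator (fun r => ∫ y, f (r, y) ∂(μt r)) r := by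
    intro r
    simp only [h1]
    by_cases hr : r ∈ Iio t
    · simp [indicator_of_mem hr]
    · simp [indicator_of_notMem hr]
  simp only [h2]
  rw [setIntegral_indicator measurableSet_Iio]
  congr 2
  ext r
  simp only [mem_inter_iff, mem_Icc, mem_Iio, mem_Ico]
  constructor
  · rintro ⟨⟨h, -⟩, h'⟩; exact ⟨h, h'⟩
  · rintro ⟨h, h'⟩; exact ⟨⟨h, h'.le.trans ht⟩, h'⟩

lemma IsFPSol.lintegral_FnormE (sol : D.IsFPSol s ζ μ μt) : ∫⁻ p, D.FnormE p ∂μ < ⊤ := by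
  have h := sol.2.2.1 (fun _ => 0) (fun _ => 0)
    ⟨contDiffOn_const, contDiffOn_const, fun t _ => Submodule.zero_mem _⟩
  simpa using h

lemma FnormE_measurable : Measurable D.FnormE :=
  Measurable.ite D.DF_meas (by have := D.F_meas; fun_prop) measurable_const

lemma le_FnormE (p : ℝ × H) : (‖D.F p‖₊ : ℝ≥0∞) ≤ D.FnormE p := by
  rw [FnormE]; split_ifs <;> simp

lemma IsFPSol.integrable_F (sol : D.IsFPSol s ζ μ μt) : Integrable D.F μ := by
  refine ⟨D.F_meas.aestronglyMeasurable, ?_⟩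
  exact (lintegral_mono fun p => le_FnormE p).trans_lt sol.lintegral_FnormE

lemma IsFPSol.ae_mem_DF (sol : D.IsFPSol s ζ μ μt) : ∀ᵐ p ∂μ, p ∈ D.DF := by
  filter_upwards [ae_lt_top FnormE_measurable sol.lintegral_FnormE.ne] with p hp
  by_contra hn
  simp [FnormE, hn] at hp

/-- The Duhamel integrand `λ R_τ c + ⟨F, D R_τ c⟩` for `c(x) = cos (⟨x,h⟩ + θ)`. -/
noncomputable def duhamel (D : FPData H) (lam : ℝ) (h : H) (θ τ : ℝ) (p : ℝ × H) : ℝ :=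
  D.gaussFactor h τ * (lam * Real.cos (⟪p.2, D.Sadj (max τ 0) h⟫_ℝ + θ) -
    Real.sin (⟪p.2, D.Sadj (max τ 0) h⟫_ℝ + θ) * ⟪D.F p, D.Sadj (max τ 0) h⟫_ℝ)

lemma Hyp31.abs_duhamel_le (hyp : D.Hyp31) {lam : ℝ} (hlam : 0 ≤ lam) (h : H) (θ : ℝ) {τ a : ℝ}
    (hτ : 0 ≤ τ) (hτa : τ ≤ a) (p : ℝ × H) : |D.duhamel lam h θ τ p| ≤
      lam + ‖D.F p‖ * (Real.exp (max hyp.ω 0 * a) * ‖h‖) := by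
  have hw0 : 0 ≤ max hyp.ω 0 := le_max_right _ _
  rw [duhamel, abs_mul, abs_of_pos (gaussFactor_pos h τ)]
  refine (mul_le_of_le_one_left (abs_nonneg _) (gaussFactor_le_one h hτ)).trans ?_
  refine (abs_sub _ _).trans (add_le_add ?_ ?_)
  · rw [abs_mul, abs_of_nonneg hlam]
    exact mul_le_of_le_one_right hlam (Real.abs_cos_le_one _)
  · rw [abs_mul]
    refine (mul_le_of_le_one_left (abs_nonneg _) (Real.abs_sin_le_one _)).trans ?_
    refine (abs_real_inner_le_norm _ _).trans (mul_le_mul_of_nonneg_left ?_ (norm_nonneg _))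
    rw [max_eq_left hτ]
    refine (hyp.norm_Sadj_le hτ h).trans (mul_le_mul_of_nonneg_right ?_ (norm_nonneg _))
    exact Real.exp_le_exp.2 (mul_le_mul_of_nonneg_left hτa hw0)

lemma Hyp31.measurable_duhamel (hyp : D.Hyp31) (lam θ : ℝ) {h : H} (hh : h ∈ D.V) :
    Measurable fun q : ℝ × (ℝ × H) => D.duhamel lam h θ q.1 q.2 := by
  obtain ⟨g, k, l, hg, hk, hl⟩ := hh
  have h1 : Measurable (D.gaussFactor h) := (hyp.gaussFactor_contDiff hg).continuous.measurable
  have h2 : Measurable fun τ : ℝ => D.Sadj (max τ 0) h := (hyp.Sadj_continuous hg).measurable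
  have h3 : Measurable fun q : ℝ × (ℝ × H) => D.Sadj (max q.1 0) h := h2.comp measurable_fst
  have h4 : Measurable fun q : ℝ × (ℝ × H) => ⟪q.2.2, D.Sadj (max q.1 0) h⟫_ℝ :=
    (measurable_snd.comp measurable_snd).inner h3
  have h5 : Measurable fun q : ℝ × (ℝ × H) => ⟪D.F q.2, D.Sadj (max q.1 0) h⟫_ℝ :=
    (D.F_meas.comp measurable_snd).inner h3
  exact (h1.comp measurable_fst).mul (((h4.add_const θ).cos.const_mul lam).sub
    ((h4.add_const θ).sin.mul h5))

lemma Hyp31.continuous_duhamel (hyp : D.Hyp31) (lam θ : ℝ) {h : H} (hh : h ∈ D.V) (p : ℝ × H) :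
    Continuous fun τ : ℝ => D.duhamel lam h θ τ p := by
  obtain ⟨g, k, l, hg, hk, hl⟩ := hh
  have h1 : Continuous (D.gaussFactor h) := (hyp.gaussFactor_contDiff hg).continuous
  have h2 : Continuous fun τ : ℝ => D.Sadj (max τ 0) h := (hyp.Sadj_continuous hg)
  unfold duhamel
  fun_prop

lemma IsFPSol.equation_cos (sol : D.IsFPSol s ζ μ μt) (hyp : D.Hyp31) {lam : ℝ} (hlam : 0 ≤ lam)
    {h : H} (hh : h ∈ D.V) (θ : ℝ) {r : ℝ} (hr : r < D.T) :
    ∀ᵐ t ∂(volume.restrict (Icc s D.T)), t < r →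
      Real.exp (lam * t) * D.gaussFactor h (r - t) *
        ∫ y, Real.cos (⟪y, D.Sadj (max (r - t) 0) h⟫_ℝ + θ) ∂(μt t) =
      Real.exp (lam * s) * D.gaussFactor h (r - s) *
        ∫ y, Real.cos (⟪y, D.Sadj (max (r - s) 0) h⟫_ℝ + θ) ∂ζ +
      ∫ p, {p : ℝ × H | p.1 < t}.indicator
        (fun p => Real.exp (lam * p.1) * D.duhamel lam h θ (r - p.1) p) p ∂μ := by
  obtain ⟨g, k, l, hg, hk, hl⟩ := id hh
  have hfin := sol.isFiniteMeasure
  set φ : ℝ → ℝ := fun t => timeCutoff D.T r t * (Real.exp (lam * t) * D.gaussFactor h (r - t))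
    with hφ
  set η : ℝ → H := fun t => D.adjExt h g (r - t) with hη
  have hsub : ContDiff ℝ 1 fun t : ℝ => r - t := contDiff_const.sub contDiff_id
  have hφC : ContDiff ℝ 1 φ := (timeCutoff_contDiff D.T r).mul
    ((Real.contDiff_exp.comp (contDiff_const.mul contDiff_id)).mul
      ((hyp.gaussFactor_contDiff hg).comp hsub))
  have hu : (fun p : ℝ × H => φ p.1 * Real.cos (⟪p.2, η p.1⟫_ℝ + θ)) ∈ D.EA :=
    cos_mem_EA (g := fun t => D.adjExt g k (r - t)) θ hφC (by simp [hφ, timeCutoff_end hr])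
      ((hyp.adjExt_contDiff hk h).comp hsub) ((hyp.adjExt_contDiff hl g).comp hsub)
      fun t => hyp.adjExt_graph hg hk hl _
  have hφv : ∀ t, t ≤ r → φ t = Real.exp (lam * t) * D.gaussFactor h (r - t) := by
    intro t ht; simp [hφ, timeCutoff_of_le ht]
  have hηv : ∀ t, t ≤ r → η t = D.Sadj (max (r - t) 0) h := by
    intro t ht
    have : 0 ≤ r - t := sub_nonneg.2 ht
    simp only [hη]
    rw [max_eq_left this, hyp.adjExt_eq hg hk this]
  have hL : ∀ q, q < r → ∀ y, D.Lzero (fun p => φ p.1 * Real.cos (⟪p.2, η p.1⟫_ℝ + θ)) (q, y) =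
      Real.exp (lam * q) * D.duhamel lam h θ (r - q) (q, y) := by
    intro q hq y
    have hpos : 0 ≤ r - q := sub_nonneg.2 hq.le
    have d1 : HasDerivAt (fun t : ℝ => r - t) (-1) q := by
      simpa using (hasDerivAt_id q).const_sub r
    have d2 : HasDerivAt (fun t : ℝ => Real.exp (lam * t)) (Real.exp (lam * q) * lam) q := by
      simpa using ((hasDerivAt_id q).const_mul lam).exp
    have d3 := d2.mul ((hyp.gaussFactor_hasDerivAt hg (r - q)).comp q d1)
    have d4 : HasDerivAt φ _ q := d3.congr_of_eventuallyEq (by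
      filter_upwards [Iio_mem_nhds hq] with t ht
      exact hφv t (le_of_lt ht))
    have d5 : HasDerivAt η (-D.Sadj (max (r - q) 0) g) q := by
      have := (hyp.adjExt_hasDerivAt hk h (r - q)).scomp q d1
      simp only [neg_smul, one_smul] at this
      exact this
    have hgr : (η q, D.Sadj (max (r - q) 0) g) ∈ D.A.adjoint.graph := by
      rw [hηv q hq.le]
      exact Sadj_graph (le_max_right _ _) hg
    rw [Lzero_cos y d4 d5 hgr, hφv q hq.le, hηv q hq.le, neg_add_cancel, inner_zero_right, duhamel]
    simp only [Function.comp]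
    ring
  filter_upwards [sol.2.2.2 _ hu, ae_restrict_mem measurableSet_Icc] with t ht htm htr
  have hsr : s ≤ r := htm.1.trans htr.le
  simp only [hφv t htr.le, hηv t htr.le, hφv s hsr, hηv s hsr, integral_const_mul] at ht
  rw [ht]
  congr 1
  rw [sol.integral_indicator_eq htm.2]
  · refine setIntegral_congr_ae measurableSet_Icc ?_
    have : ∀ᵐ q ∂(volume : Measure ℝ), q ≠ t := by simp [ae_iff, measure_singleton]
    filter_upwards [this] with q hq hqm
    have hqr : q < r := hqm.2.trans_lt htr
    simp only [hL q hqr]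
  · have hb : Integrable (fun p => Real.exp (lam * D.T) *
        (lam + ‖D.F p‖ * (Real.exp (max hyp.ω 0 * (r - s)) * ‖h‖))) μ :=
      ((integrable_const _).add (sol.integrable_F.norm.mul_const _)).const_mul _
    refine hb.mono' ?_ ?_
    · have h1 := (hyp.measurable_duhamel lam θ hh).comp
        (f := fun p : ℝ × H => (r - p.1, p)) (by fun_prop)
      have h2 : Measurable fun p : ℝ × H =>
          Real.exp (lam * p.1) * D.duhamel lam h θ (r - p.1) p :=
        (by fun_prop : Measurable fun p : ℝ × H => Real.exp (lam * p.1)).mul h1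
      exact (h2.indicator (measurable_fst measurableSet_Iio)).aestronglyMeasurable
    · filter_upwards [sol.ae_mem] with p hp
      by_cases hpt : p.1 < t
      · rw [indicator_of_mem (by exact hpt), norm_mul, Real.norm_eq_abs, Real.norm_eq_abs,
          abs_of_pos (Real.exp_pos _)]
        refine mul_le_mul (Real.exp_le_exp.2 (mul_le_mul_of_nonneg_left hp.2 hlam)) ?_
          (abs_nonneg _) (Real.exp_pos _).le
        exact hyp.abs_duhamel_le hlam h θ (sub_nonneg.2 (hpt.trans htr).le)
          (sub_le_sub_left hp.1 r) p
      · rw [indicator_of_notMem (by exact hpt), norm_zero]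
        positivity

end Duhamel

section DuhamelFormula

open ProbabilityTheory

variable {H : Type} [NormedAddCommGroup H] [InnerProductSpace ℝ H] [CompleteSpace H]
  [SecondCountableTopology H] [MeasurableSpace H] [BorelSpace H] {D : FPData H}
  {s : ℝ} {ζ : Measure H} {μ : Measure (ℝ × H)} {μt : ℝ → Measure H}

lemma Hyp31.continuous_integral_cos (hyp : D.Hyp31) {h : H} (hh : h ∈ D.V) (θ : ℝ)
    (ν : Measure H) [IsFiniteMeasure ν] :
    Continuous fun τ : ℝ => ∫ y, Real.cos (⟪y, D.Sadj (max τ 0) h⟫_ℝ + θ) ∂ν := by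
  obtain ⟨g, k, l, hg, hk, hl⟩ := hh
  have h2 : Continuous fun τ : ℝ => D.Sadj (max τ 0) h := (hyp.Sadj_continuous hg)
  refine continuous_of_dominated (bound := fun _ => 1) (fun τ => ?_) (fun τ => ?_)
    (integrable_const _) ?_
  · exact (by fun_prop : Continuous fun y => Real.cos (⟪y, D.Sadj (max τ 0) h⟫_ℝ + θ)).aestronglyMeasurable
  · exact Eventually.of_forall fun y => Real.abs_cos_le_one _
  · exact Eventually.of_forall fun y => by fun_prop

lemma IsFPSol.duhamel_ae (sol : D.IsFPSol s ζ μ μt) [IsProbabilityMeasure ζ] (hyp : D.Hyp31)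
    {lam : ℝ} (hlam : 0 ≤ lam) {h : H} (hh : h ∈ D.V) (θ : ℝ) :
    ∀ᵐ t ∂(volume.restrict (Icc s D.T)),
      Real.exp (lam * t) * ∫ y, Real.cos (⟪y, h⟫_ℝ + θ) ∂(μt t) =
      Real.exp (lam * s) * D.gaussFactor h (t - s) *
        ∫ y, Real.cos (⟪y, D.Sadj (max (t - s) 0) h⟫_ℝ + θ) ∂ζ +
      ∫ p, {p : ℝ × H | p.1 < t}.indicator
        (fun p => Real.exp (lam * p.1) * D.duhamel lam h θ (t - p.1) p) p ∂μ := by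
  have hfin := sol.isFiniteMeasure
  have hall := ae_all_iff.2 fun r : ℚ => show ∀ᵐ t ∂(volume.restrict (Icc s D.T)), _ from
    Classical.byCases (p := (r : ℝ) < D.T)
      (fun hr => (sol.equation_cos hyp hlam hh θ hr).mono fun t ht (_ : (r : ℝ) < D.T) => ht)
      (fun hr => Eventually.of_forall fun t ht => absurd ht hr)
  have hT : ∀ᵐ t ∂(volume.restrict (Icc s D.T)), t ≠ D.T :=
    ae_restrict_of_ae (by simp [ae_iff, measure_singleton])
  filter_upwards [hall, hT, ae_restrict_mem measurableSet_Icc] with t ht htT htm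
  have htT' : t < D.T := lt_of_le_of_ne htm.2 htT
  have hprob := sol.1 t htm
  obtain ⟨u, -, hu, hut⟩ := (Rat.denseRange_cast (𝕜 := ℝ)).exists_seq_strictAnti_tendsto Rat.cast_mono t
  have hc1 : Continuous (D.gaussFactor h) := by
    obtain ⟨g, k, l, hg, hk, hl⟩ := id hh
    exact (hyp.gaussFactor_contDiff hg).continuous
  have hut2 : Tendsto (fun n => u n - t) atTop (𝓝 0) := by
    simpa using hut.sub_const t
  have hut3 : Tendsto (fun n => u n - s) atTop (𝓝 (t - s)) := hut.sub_const s
  have T1 : Tendsto (fun n => Real.exp (lam * t) * D.gaussFactor h (u n - t) *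
        ∫ y, Real.cos (⟪y, D.Sadj (max (u n - t) 0) h⟫_ℝ + θ) ∂(μt t)) atTop
      (𝓝 (Real.exp (lam * t) * ∫ y, Real.cos (⟪y, h⟫_ℝ + θ) ∂(μt t))) := by
    have h1 := (hc1.tendsto 0).comp hut2
    have h2 := ((hyp.continuous_integral_cos hh θ (μt t)).tendsto 0).comp hut2
    simp only [max_self, Sadj_zero, gaussFactor_zero] at h1 h2
    simpa using (h1.const_mul (Real.exp (lam * t))).mul h2
  have T2 : Tendsto (fun n => Real.exp (lam * s) * D.gaussFactor h (u n - s) *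
        ∫ y, Real.cos (⟪y, D.Sadj (max (u n - s) 0) h⟫_ℝ + θ) ∂ζ) atTop
      (𝓝 (Real.exp (lam * s) * D.gaussFactor h (t - s) *
        ∫ y, Real.cos (⟪y, D.Sadj (max (t - s) 0) h⟫_ℝ + θ) ∂ζ)) :=
    (((hc1.tendsto _).comp hut3).const_mul _).mul
      (((hyp.continuous_integral_cos hh θ ζ).tendsto _).comp hut3)
  have hev : ∀ᶠ n in atTop, u n < D.T := hut.eventually (Iio_mem_nhds htT')
  have T3 : Tendsto (fun n => ∫ p, {p : ℝ × H | p.1 < t}.indicator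
        (fun p => Real.exp (lam * p.1) * D.duhamel lam h θ (u n - p.1) p) p ∂μ) atTop
      (𝓝 (∫ p, {p : ℝ × H | p.1 < t}.indicator
        (fun p => Real.exp (lam * p.1) * D.duhamel lam h θ (t - p.1) p) p ∂μ)) := by
    refine tendsto_integral_filter_of_dominated_convergence
      (fun p => Real.exp (lam * D.T) *
        (lam + ‖D.F p‖ * (Real.exp (max hyp.ω 0 * (D.T - s)) * ‖h‖))) ?_ ?_ ?_ ?_
    · refine Eventually.of_forall fun n => ?_
      have h1 := (hyp.measurable_duhamel lam θ hh).comp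
        (f := fun p : ℝ × H => (u n - p.1, p)) (by fun_prop)
      have h2 : Measurable fun p : ℝ × H =>
          Real.exp (lam * p.1) * D.duhamel lam h θ (u n - p.1) p :=
        (by fun_prop : Measurable fun p : ℝ × H => Real.exp (lam * p.1)).mul h1
      exact (h2.indicator (measurable_fst measurableSet_Iio)).aestronglyMeasurable
    · filter_upwards [hev] with n hn
      filter_upwards [sol.ae_mem] with p hp
      by_cases hpt : p.1 < t
      · rw [indicator_of_mem (by exact hpt), norm_mul, Real.norm_eq_abs, Real.norm_eq_abs,
          abs_of_pos (Real.exp_pos _)]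
        refine mul_le_mul (Real.exp_le_exp.2 (mul_le_mul_of_nonneg_left hp.2 hlam)) ?_
          (abs_nonneg _) (Real.exp_pos _).le
        exact hyp.abs_duhamel_le hlam h θ (sub_nonneg.2 (hpt.trans (show t < (u n : ℝ) from hu n)).le)
          (sub_le_sub hn.le hp.1) p
      · rw [indicator_of_notMem (by exact hpt), norm_zero]
        positivity
    · exact ((integrable_const _).add (sol.integrable_F.norm.mul_const _)).const_mul _
    · refine Eventually.of_forall fun p => ?_
      by_cases hpt : p.1 < t
      · simp only [indicator_of_mem (show p ∈ {p : ℝ × H | p.1 < t} from hpt)]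
        exact (((hyp.continuous_duhamel lam θ hh p).tendsto _).comp
          (hut.sub_const p.1)).const_mul _
      · simp only [indicator_of_notMem (show p ∉ {p : ℝ × H | p.1 < t} from hpt)]
        exact tendsto_const_nhds
  refine tendsto_nhds_unique_of_eventuallyEq T1 (T2.add T3) ?_
  filter_upwards [hev] with n hn
  exact ht (u n) hn (hu n)

/-- The contribution of the initial condition in the Duhamel formula. -/
noncomputable def initialTerm (D : FPData H) (s : ℝ) (ζ : Measure H) (lam : ℝ) (ψ : ℝ → ℝ)
    (h : H) (θ : ℝ) : ℝ :=
  ∫ t in Icc s D.T, (ψ t * Real.exp (-(lam * t))) *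
    (Real.exp (lam * s) * D.gaussFactor h (t - s) *
      ∫ y, Real.cos (⟪y, D.Sadj (max (t - s) 0) h⟫_ℝ + θ) ∂ζ)

lemma IsFPSol.duhamel_formula (sol : D.IsFPSol s ζ μ μt) [IsProbabilityMeasure ζ] (hyp : D.Hyp31)
    {lam : ℝ} (hlam : 0 ≤ lam) {h : H} (hh : h ∈ D.V) (θ : ℝ) {ψ : ℝ → ℝ} (hψ : Measurable ψ)
    {c : ℝ} (hc : ∀ t, |ψ t| ≤ c) (hsupp : ∀ t, t ∉ Icc s D.T → ψ t = 0) :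
    IntegrableOn (fun τ => Real.exp (-(lam * τ)) *
      ∫ p, ψ (p.1 + τ) * D.duhamel lam h θ τ p ∂μ) (Ioi 0) ∧
    ∫ p, ψ p.1 * Real.cos (⟪p.2, h⟫_ℝ + θ) ∂μ = D.initialTerm s ζ lam ψ h θ +
      ∫ τ in Ioi (0:ℝ), Real.exp (-(lam * τ)) *
        ∫ p, ψ (p.1 + τ) * D.duhamel lam h θ τ p ∂μ := by
  have hfin := sol.isFiniteMeasure
  have hc0 : 0 ≤ c := (abs_nonneg _).trans (hc 0)
  set f : (ℝ × H) × ℝ → ℝ := fun q => (ψ q.2 * Real.exp (-(lam * q.2))) *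
    {p : ℝ × H | p.1 < q.2}.indicator
      (fun p => Real.exp (lam * p.1) * D.duhamel lam h θ (q.2 - p.1) p) q.1 with hf
  have hfm : Measurable f := by
    have h1 := (hyp.measurable_duhamel lam θ hh).comp
      (f := fun q : (ℝ × H) × ℝ => (q.2 - q.1.1, q.1)) (by fun_prop)
    have h2 : Measurable fun q : (ℝ × H) × ℝ =>
        Real.exp (lam * q.1.1) * D.duhamel lam h θ (q.2 - q.1.1) q.1 :=
      (by fun_prop : Measurable fun q : (ℝ × H) × ℝ => Real.exp (lam * q.1.1)).mul h1
    have h3 : Measurable ({q : (ℝ × H) × ℝ | q.1.1 < q.2}.indicator fun q =>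
        Real.exp (lam * q.1.1) * D.duhamel lam h θ (q.2 - q.1.1) q.1) :=
      h2.indicator (measurableSet_lt (by fun_prop) (by fun_prop))
    exact (by fun_prop : Measurable fun q : (ℝ × H) × ℝ =>
      ψ q.2 * Real.exp (-(lam * q.2))).mul h3
  have hae : ∀ᵐ q ∂(μ.prod (volume : Measure ℝ)), q.1.1 ∈ Icc s D.T :=
    Measure.quasiMeasurePreserving_fst.ae sol.ae_mem
  have hfi : Integrable f (μ.prod volume) := by
    have hb1 : Integrable (fun p => lam + ‖D.F p‖ *
        (Real.exp (max hyp.ω 0 * (D.T - s)) * ‖h‖)) μ :=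
      (integrable_const _).add (sol.integrable_F.norm.mul_const _)
    have hb2 : Integrable ((Icc s D.T).indicator fun _ : ℝ => c) volume :=
      (integrable_indicator_iff measurableSet_Icc).2 (by simp [IntegrableOn])
    refine (hb1.mul_prod hb2).mono' hfm.aestronglyMeasurable ?_
    filter_upwards [hae] with q hq
    simp only [hf, norm_mul, Real.norm_eq_abs, abs_of_pos (Real.exp_pos _)]
    by_cases hq2 : q.2 ∈ Icc s D.T
    · rw [indicator_of_mem hq2]
      by_cases hpt : q.1.1 < q.2
      · rw [indicator_of_mem (by exact hpt), abs_mul, abs_of_pos (Real.exp_pos _)]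
        have h1 := hyp.abs_duhamel_le hlam h θ (sub_nonneg.2 hpt.le)
          (sub_le_sub hq2.2 hq.1) q.1
        have h2 : Real.exp (-(lam * q.2)) * Real.exp (lam * q.1.1) ≤ 1 := by
          rw [← Real.exp_add, Real.exp_le_one_iff]; nlinarith
        calc _ = |ψ q.2| * ((Real.exp (-(lam * q.2)) * Real.exp (lam * q.1.1)) *
              |D.duhamel lam h θ (q.2 - q.1.1) q.1|) := by ring
          _ ≤ c * (1 * (lam + ‖D.F q.1‖ * (Real.exp (max hyp.ω 0 * (D.T - s)) * ‖h‖))) := by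
              gcongr
              exact hc _
          _ = _ := by ring
      · rw [indicator_of_notMem (by exact hpt), abs_zero, mul_zero]
        positivity
    · rw [hsupp _ hq2, indicator_of_notMem hq2]; simp
  have hshear : MeasurePreserving (fun q : (ℝ × H) × ℝ => (q.1, q.1.1 + q.2))
      (μ.prod volume) (μ.prod volume) :=
    (MeasurePreserving.id μ).skew_product (g := fun (p : ℝ × H) (τ : ℝ) => p.1 + τ)
      (by unfold Function.uncurry; fun_prop)
      (Eventually.of_forall fun p => (measurePreserving_add_left volume p.1).map_eq)
  set f' : (ℝ × H) × ℝ → ℝ := fun q => (Ioi (0:ℝ)).indicator (fun τ => Real.exp (-(lam * τ)) *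
    (ψ (q.1.1 + τ) * D.duhamel lam h θ τ q.1)) q.2 with hf'
  have hff' : ∀ q : (ℝ × H) × ℝ, f (q.1, q.1.1 + q.2) = f' q := by
    intro q
    simp only [hf, hf']
    by_cases hq : 0 < q.2
    · rw [indicator_of_mem (by simpa using hq), indicator_of_mem (by exact hq), add_sub_cancel_left,
        mul_add, neg_add, Real.exp_add]
      have : Real.exp (-(lam * q.1.1)) * Real.exp (lam * q.1.1) = 1 := by
        rw [← Real.exp_add]; simp
      linear_combination (ψ (q.1.1 + q.2) * Real.exp (-(lam * q.2)) *
        D.duhamel lam h θ q.2 q.1) * this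
    · rw [indicator_of_notMem (by simpa using hq), indicator_of_notMem (by exact hq), mul_zero]
  have hfi' : Integrable f' (μ.prod volume) := by
    have := (hshear.integrable_comp hfm.aestronglyMeasurable).2 hfi
    exact this.congr (Eventually.of_forall hff')
  have heq : ∫ q, f q ∂(μ.prod volume) = ∫ q, f' q ∂(μ.prod volume) := by
    have h1 : ∫ q, f q ∂(μ.prod volume) = ∫ q, f (q.1, q.1.1 + q.2) ∂(μ.prod volume) := by
      conv_lhs => rw [← hshear.map_eq]
      exact integral_map hshear.measurable.aemeasurable hfm.aestronglyMeasurable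
    rw [h1]
    exact integral_congr_ae (Eventually.of_forall hff')
  have hin : ∀ τ, ∫ p, f' (p, τ) ∂μ = (Ioi (0:ℝ)).indicator (fun τ => Real.exp (-(lam * τ)) *
      ∫ p, ψ (p.1 + τ) * D.duhamel lam h θ τ p ∂μ) τ := by
    intro τ
    simp only [hf']
    by_cases hτ : τ ∈ Ioi (0:ℝ)
    · simp only [indicator_of_mem hτ, integral_const_mul]
    · simp only [indicator_of_notMem hτ, integral_zero]
  have hI := hfi'.integral_prod_right
  simp only [hin] at hI
  refine ⟨(integrable_indicator_iff measurableSet_Ioi).1 hI, ?_⟩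
  have hR : ∫ τ in Ioi (0:ℝ), Real.exp (-(lam * τ)) *
        ∫ p, ψ (p.1 + τ) * D.duhamel lam h θ τ p ∂μ = ∫ t, ∫ p, f (p, t) ∂μ := by
    rw [← integral_prod_symm f hfi, heq, integral_prod_symm f' hfi', ← integral_indicator measurableSet_Ioi]
    simp only [hin]
  have hLi := hfi.integral_prod_right
  have hcosi : Integrable (fun p : ℝ × H => ψ p.1 * Real.cos (⟪p.2, h⟫_ℝ + θ)) μ := by
    refine (integrable_const c).mono' ?_ (Eventually.of_forall fun p => ?_)
    · exact ((hψ.comp measurable_fst).mul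
        ((measurable_snd.inner measurable_const).add_const θ).cos).aestronglyMeasurable
    · rw [norm_mul]
      exact (mul_le_of_le_one_right (norm_nonneg _) (Real.abs_cos_le_one _)).trans (hc _)
  rw [hR, sol.integral_eq hcosi, initialTerm]
  have hset : ∫ t, ∫ p, f (p, t) ∂μ = ∫ t in Icc s D.T, ∫ p, f (p, t) ∂μ := by
    rw [setIntegral_eq_integral_of_forall_compl_eq_zero]
    intro t ht
    simp [hf, hsupp t ht]
  rw [hset, ← integral_add _ hLi.integrableOn]
  · refine setIntegral_congr_ae measurableSet_Icc ?_
    have h1 := (ae_restrict_iff' measurableSet_Icc).1 (sol.duhamel_ae hyp hlam hh θ)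
    filter_upwards [h1] with t ht htm
    simp only [hf, integral_const_mul]
    rw [← mul_add, ← ht htm, mul_assoc, ← mul_assoc (Real.exp _), ← Real.exp_add]
    simp
  · have hc1 : Continuous (D.gaussFactor h) := by
      obtain ⟨g, k, l, hg, hk, hl⟩ := id hh
      exact (hyp.gaussFactor_contDiff hg).continuous
    have hc2 := hyp.continuous_integral_cos hh θ ζ
    have hc3 : Continuous fun t => Real.exp (-(lam * t)) *
      (Real.exp (lam * s) * D.gaussFactor h (t - s) *
      ∫ y, Real.cos (⟪y, D.Sadj (max (t - s) 0) h⟫_ℝ + θ) ∂ζ) := by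
      have := hc2.comp (continuous_id.sub (continuous_const (y := s)))
      have h3 := hc1.comp (continuous_id.sub (continuous_const (y := s)))
      exact (by fun_prop : Continuous fun t => Real.exp (-(lam * t))).mul
        ((continuous_const.mul h3).mul this)
    simp only [mul_assoc (ψ _)]
    exact (hc3.integrableOn_Icc).bdd_mul hψ.aestronglyMeasurable
      (Eventually.of_forall fun t => hc t)

end DuhamelFormula

end FPData

section SmoothClass

variable {H : Type} [NormedAddCommGroup H] [InnerProductSpace ℝ H]

/-- Functions on `H` bounded by `ρ`, `ρ`-Lipschitz, with second differences controlled
by `ρ M`. -/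
structure SecondDiffClass (ρ M : ℝ) (w : H → ℝ) : Prop where
  bound : ∀ x, |w x| ≤ ρ
  lip : ∀ x y, |w x - w y| ≤ ρ * ‖x - y‖
  second : ∀ x a b, |w (x + a + b) - w (x + a) - w (x + b) + w x| ≤ ρ * M * ‖a‖ * ‖b‖

namespace SecondDiffClass

variable {ρ ρ' M M' : ℝ} {w : H → ℝ}

lemma nonneg (hw : SecondDiffClass ρ M w) : 0 ≤ ρ := (abs_nonneg _).trans (hw.bound 0)

lemma mono (hw : SecondDiffClass ρ M w) (h1 : ρ ≤ ρ') (h2 : ρ * M ≤ ρ' * M') :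
    SecondDiffClass ρ' M' w where
  bound x := (hw.bound x).trans h1
  lip x y := (hw.lip x y).trans (by gcongr)
  second x a b := (hw.second x a b).trans (by gcongr)

lemma comp_map (hw : SecondDiffClass ρ M w) (hM : 0 ≤ M) {J : H → H} {c N : ℝ} (hc : 0 ≤ c)
    (h1 : ∀ x y, ‖J x - J y‖ ≤ c * ‖x - y‖)
    (h2 : ∀ x a b, ‖J (x + a + b) - J (x + a) - J (x + b) + J x‖ ≤ N * ‖a‖ * ‖b‖)
    (hρ : ρ ≤ ρ') (hcρ : ρ * c ≤ ρ') (hN : ρ * M * c ^ 2 + ρ * N ≤ ρ' * M') :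
    SecondDiffClass ρ' M' fun x => w (J x) where
  bound x := (hw.bound _).trans hρ
  lip x y := by
    have h0 := hw.nonneg
    calc _ ≤ ρ * ‖J x - J y‖ := hw.lip _ _
      _ ≤ ρ * (c * ‖x - y‖) := by gcongr; exact h1 x y
      _ = (ρ * c) * ‖x - y‖ := by ring
      _ ≤ _ := by gcongr
  second x a b := by
    have h0 := hw.nonneg
    set u := J (x + a) - J x
    set v := J (x + b) - J x
    have hu : ‖u‖ ≤ c * ‖a‖ := by simpa using h1 (x + a) x
    have hv : ‖v‖ ≤ c * ‖b‖ := by simpa using h1 (x + b) x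
    have e1 := hw.second (J x) u v
    have e2 := hw.lip (J (x + a + b)) (J x + u + v)
    have e3 : J (x + a + b) - (J x + u + v) = J (x + a + b) - J (x + a) - J (x + b) + J x := by
      simp only [u, v]; abel
    have e4 : J x + u = J (x + a) := by simp [u]
    have e5 : J x + v = J (x + b) := by simp [v]
    rw [e3] at e2
    rw [e5, e4] at e1
    rw [e4] at e2
    have e6 : ρ * ‖J (x + a + b) - J (x + a) - J (x + b) + J x‖ ≤ ρ * (N * ‖a‖ * ‖b‖) := by
      gcongr; exact h2 x a b
    have e7 : ρ * M * ‖u‖ * ‖v‖ ≤ ρ * M * (c * ‖a‖) * (c * ‖b‖) := by gcongr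
    have e8 : (ρ * M * c ^ 2 + ρ * N) * (‖a‖ * ‖b‖) ≤ (ρ' * M') * (‖a‖ * ‖b‖) := by gcongr
    rw [abs_le] at e1 e2 ⊢
    constructor <;> nlinarith [e1.1, e1.2, e2.1, e2.2]

lemma comp_clm (hw : SecondDiffClass ρ M w) (hM : 0 ≤ M) (P : H →L[ℝ] H)
    (hP : ∀ x, ‖P x‖ ≤ ‖x‖) (z : H) : SecondDiffClass ρ M fun x => w (P x + z) := by
  refine hw.comp_map (J := fun x => P x + z) (c := 1) (N := 0) hM zero_le_one (fun x y => ?_)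
    (fun x a b => ?_) le_rfl (by simp) (by simp)
  · simpa [← map_sub] using hP (x - y)
  · have : P (x + a + b) + z - (P (x + a) + z) - (P (x + b) + z) + (P x + z) = 0 := by
      simp only [map_add]; abel
    rw [this]; simp

lemma continuous (hw : SecondDiffClass ρ M w) : Continuous w :=
  (LipschitzWith.of_dist_le_mul (K := ⟨ρ, hw.nonneg⟩) fun x y => by
    rw [Real.dist_eq, dist_eq_norm]; exact hw.lip x y).continuous

lemma integral {Ω : Type*} [MeasurableSpace Ω] {P : Measure Ω} [IsProbabilityMeasure P]
    {v : Ω → H → ℝ} (hv : ∀ σ, SecondDiffClass ρ M (v σ))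
    (hm : ∀ x, AEStronglyMeasurable (fun σ => v σ x) P) :
    SecondDiffClass ρ M fun x => ∫ σ, v σ x ∂P := by
  have hi : ∀ x, Integrable (fun σ => v σ x) P := fun x =>
    (integrable_const ρ).mono' (hm x) (Eventually.of_forall fun σ => (hv σ).bound x)
  have key : ∀ (f : Ω → ℝ) (c : ℝ), (∀ σ, |f σ| ≤ c) → |∫ σ, f σ ∂P| ≤ c := fun f c h => by
    simpa using norm_integral_le_of_norm_le_const (μ := P) (Eventually.of_forall fun σ => (Real.norm_eq_abs _).trans_le (h σ))
  refine ⟨fun x => key _ _ fun σ => (hv σ).bound x, fun x y => ?_, fun x a b => ?_⟩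
  · rw [← integral_sub (hi x) (hi y)]
    exact key _ _ fun σ => (hv σ).lip x y
  · have e : ∫ σ, (v σ (x + a + b) - v σ (x + a) - v σ (x + b) + v σ x) ∂P =
        ∫ σ, v σ (x + a + b) ∂P - ∫ σ, v σ (x + a) ∂P - ∫ σ, v σ (x + b) ∂P +
          ∫ σ, v σ x ∂P := by
      rw [integral_add (f := fun σ => v σ (x + a + b) - v σ (x + a) - v σ (x + b))
          (((hi _).sub (hi _)).sub (hi _)) (hi _),
        integral_sub (f := fun σ => v σ (x + a + b) - v σ (x + a)) ((hi _).sub (hi _)) (hi _),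
        integral_sub (hi _) (hi _)]
    rw [← e]
    exact key _ _ fun σ => (hv σ).second x a b

end SecondDiffClass

end SmoothClass

section TrigSpan

variable {H : Type} [NormedAddCommGroup H] [InnerProductSpace ℝ H]

/-- The span of the functions `α(t) cos(⟨x,h⟩ + θ)` with `α` bounded measurable and `h ∈ V`. -/
def trigSpan (V : Submodule ℝ H) (X : Type) [MeasurableSpace X] : Submodule ℝ (X × H → ℝ) :=
  Submodule.span ℝ {f | ∃ α : X → ℝ, Measurable α ∧ (∃ c, ∀ t, |α t| ≤ c) ∧
    ∃ h ∈ V, ∃ θ : ℝ, f = fun p => α p.1 * Real.cos (⟪p.2, h⟫_ℝ + θ)}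

namespace trigSpan

variable {V : Submodule ℝ H} {X : Type} [MeasurableSpace X]

lemma cos_mem {α : X → ℝ} (hα : Measurable α) {c : ℝ} (hc : ∀ t, |α t| ≤ c) {h : H} (hh : h ∈ V)
    (θ : ℝ) : (fun p : X × H => α p.1 * Real.cos (⟪p.2, h⟫_ℝ + θ)) ∈ trigSpan V X :=
  Submodule.subset_span ⟨α, hα, ⟨c, hc⟩, h, hh, θ, rfl⟩

lemma zero_fun_mem : (fun _ => 0 : X × H → ℝ) ∈ trigSpan V X := (trigSpan V X).zero_mem

lemma fst_mem {α : X → ℝ} (hα : Measurable α) {c : ℝ} (hc : ∀ t, |α t| ≤ c) :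
    (fun p : X × H => α p.1) ∈ trigSpan V X := by
  simpa using cos_mem hα hc V.zero_mem 0

lemma mul_mem {f g : X × H → ℝ} (hf : f ∈ trigSpan V X) (hg : g ∈ trigSpan V X) :
    (fun p => f p * g p) ∈ trigSpan V X := by
  induction hf using Submodule.span_induction with
  | mem f hf =>
    obtain ⟨α, hα, ⟨c, hc⟩, h, hh, θ, rfl⟩ := hf
    induction hg using Submodule.span_induction with
    | mem g hg =>
      obtain ⟨β, hβ, ⟨d, hd⟩, k, hk, η, rfl⟩ := hg
      have hm : Measurable fun t => (1 / 2) * (α t * β t) := (hα.mul hβ).const_mul _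
      have hb : ∀ t, |(1 / 2) * (α t * β t)| ≤ (1 / 2) * (c * d) := fun t => by
        rw [abs_mul, abs_mul, abs_of_pos (by norm_num : (0:ℝ) < 1 / 2)]
        have := (abs_nonneg _).trans (hc t)
        gcongr
        exacts [hc t, hd t]
      convert (trigSpan V X).add_mem (cos_mem hm hb (V.add_mem hh hk) (θ + η))
        (cos_mem hm hb (V.sub_mem hh hk) (θ - η)) using 1
      funext p
      simp only [Pi.add_apply, inner_add_right, inner_sub_right]
      rw [show ⟪p.2, h⟫_ℝ + ⟪p.2, k⟫_ℝ + (θ + η) = (⟪p.2, h⟫_ℝ + θ) + (⟪p.2, k⟫_ℝ + η) by ring,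
        show ⟪p.2, h⟫_ℝ - ⟪p.2, k⟫_ℝ + (θ - η) = (⟪p.2, h⟫_ℝ + θ) - (⟪p.2, k⟫_ℝ + η) by ring,
        Real.cos_add (⟪p.2, h⟫_ℝ + θ), Real.cos_sub]
      ring
    | zero => simp [zero_fun_mem]
    | add g1 g2 _ _ h1 h2 =>
      convert (trigSpan V X).add_mem h1 h2 using 1
      funext p; simp [mul_add]
    | smul a g _ h1 =>
      convert (trigSpan V X).smul_mem a h1 using 1
      funext p; simp [mul_left_comm]
  | zero => simp [zero_fun_mem]
  | add f1 f2 _ _ h1 h2 =>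
    convert (trigSpan V X).add_mem h1 h2 using 1
    funext p; simp [add_mul]
  | smul a f _ h1 =>
    convert (trigSpan V X).smul_mem a h1 using 1
    funext p; simp [mul_assoc]

lemma one_mem : (fun _ => 1 : X × H → ℝ) ∈ trigSpan V X :=
  fst_mem (α := fun _ => 1) measurable_const (c := 1) (by simp)

lemma prod_mem {κ : Type} (J : Finset κ) {f : κ → X × H → ℝ} (hf : ∀ i, f i ∈ trigSpan V X) :
    (fun p => ∏ i ∈ J, f i p) ∈ trigSpan V X := by
  induction J using Finset.induction_on with
  | empty => simpa using one_mem
  | insert i J hi ih =>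
    simp only [Finset.prod_insert hi]
    exact mul_mem (hf i) ih

lemma pow_mem {f : X × H → ℝ} (hf : f ∈ trigSpan V X) (m : ℕ) :
    (fun p => f p ^ m) ∈ trigSpan V X := by
  simpa using prod_mem (Finset.range m) (f := fun _ => f) fun _ => hf

lemma bounded {f : X × H → ℝ} (hf : f ∈ trigSpan V X) : ∃ c, ∀ p, |f p| ≤ c := by
  induction hf using Submodule.span_induction with
  | mem f hf =>
    obtain ⟨α, hα, ⟨c, hc⟩, h, hh, θ, rfl⟩ := hf
    refine ⟨c, fun p => ?_⟩
    rw [abs_mul]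
    exact (mul_le_of_le_one_right (abs_nonneg _) (Real.abs_cos_le_one _)).trans (hc _)
  | zero => exact ⟨0, by simp⟩
  | add f1 f2 _ _ h1 h2 =>
    obtain ⟨c, hc⟩ := h1
    obtain ⟨d, hd⟩ := h2
    exact ⟨c + d, fun p => (abs_add_le _ _).trans (add_le_add (hc p) (hd p))⟩
  | smul a f _ h1 =>
    obtain ⟨c, hc⟩ := h1
    exact ⟨|a| * c, fun p => by simpa [abs_mul] using mul_le_mul_of_nonneg_left (hc p) (abs_nonneg a)⟩

lemma measurable [MeasurableSpace H] [BorelSpace H] [SecondCountableTopology H]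
    {f : X × H → ℝ} (hf : f ∈ trigSpan V X) : Measurable f := by
  induction hf using Submodule.span_induction with
  | mem f hf =>
    obtain ⟨α, hα, ⟨c, hc⟩, h, hh, θ, rfl⟩ := hf
    exact (hα.comp measurable_fst).mul ((measurable_snd.inner measurable_const).add_const θ).cos
  | zero => exact measurable_const
  | add f1 f2 _ _ h1 h2 => exact h1.add h2
  | smul a f _ h1 => exact h1.const_smul a

lemma exists_sum {f : X × H → ℝ} (hf : f ∈ trigSpan V X) :
    ∃ (n : ℕ) (α : Fin n → X → ℝ) (h : Fin n → H) (θ : Fin n → ℝ),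
      (∀ j, Measurable (α j)) ∧ (∀ j, ∃ c, ∀ t, |α j t| ≤ c) ∧ (∀ j, h j ∈ V) ∧
      ∀ p, f p = ∑ j, α j p.1 * Real.cos (⟪p.2, h j⟫_ℝ + θ j) := by
  obtain ⟨n, a, g, hg⟩ := Submodule.mem_span_set'.1 hf
  choose α hα hc h hh θ hθ using fun j => (g j).2
  refine ⟨n, fun j t => a j * α j t, h, θ, fun j => (hα j).const_mul _, fun j => ?_, hh,
    fun p => ?_⟩
  · obtain ⟨c, hc⟩ := hc j
    refine ⟨|a j| * c, fun t => ?_⟩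
    rw [abs_mul]
    exact mul_le_mul_of_nonneg_left (hc t) (abs_nonneg _)
  · rw [← hg, Finset.sum_apply]
    refine Finset.sum_congr rfl fun j _ => ?_
    rw [Pi.smul_apply, hθ j, smul_eq_mul, mul_assoc]

lemma integral_mem {Y : Type} [MeasurableSpace Y] {P : Measure Y} [IsFiniteMeasure P]
    {Φ : X × Y → ℝ} (hΦ : Measurable Φ) {b : ℝ} (hb : ∀ q, |Φ q| ≤ b) {f : (X × Y) × H → ℝ}
    (hf : f ∈ trigSpan V (X × Y)) :
    (∀ p : X × H, Integrable (fun y => Φ (p.1, y) * f ((p.1, y), p.2)) P) ∧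
    (fun p : X × H => ∫ y, Φ (p.1, y) * f ((p.1, y), p.2) ∂P) ∈ trigSpan V X := by
  induction hf using Submodule.span_induction with
  | mem f hf =>
    obtain ⟨α, hα, ⟨c, hc⟩, h, hh, θ, rfl⟩ := hf
    have hm : Measurable fun q : X × Y => Φ q * α q := hΦ.mul hα
    have hbd : ∀ q, |Φ q * α q| ≤ b * c := fun q => by
      rw [abs_mul]
      have := (abs_nonneg _).trans (hb q)
      gcongr
      exacts [hb q, hc q]
    refine ⟨fun p => ?_, ?_⟩
    · simp only [← mul_assoc]
      refine Integrable.mul_const ?_ _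
      exact (integrable_const (b * c)).mono'
        (hm.comp measurable_prodMk_left).aestronglyMeasurable
        (Eventually.of_forall fun y => hbd _)
    · simp only [← mul_assoc, integral_mul_const]
      refine cos_mem (α := fun t => ∫ y, Φ (t, y) * α (t, y) ∂P)
        (StronglyMeasurable.integral_prod_right hm.stronglyMeasurable).measurable
        (c := b * c * P.real univ) (fun t => ?_) hh θ
      exact norm_integral_le_of_norm_le_const (μ := P)
        (Eventually.of_forall fun y => (Real.norm_eq_abs _).trans_le (hbd (t, y)))
  | zero => exact ⟨by simp, by simp [zero_fun_mem]⟩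
  | add f1 f2 _ _ h1 h2 =>
    refine ⟨fun p => ?_, ?_⟩
    · simp only [Pi.add_apply, mul_add]
      exact (h1.1 p).add (h2.1 p)
    · convert (trigSpan V X).add_mem h1.2 h2.2 using 1
      funext p
      simp only [Pi.add_apply, mul_add]
      exact integral_add (h1.1 p) (h2.1 p)
  | smul a f _ h1 =>
    refine ⟨fun p => ?_, ?_⟩
    · simpa [mul_left_comm] using (h1.1 p).const_mul a
    · convert (trigSpan V X).smul_mem a h1.2 using 1
      funext p
      simp [mul_left_comm, integral_const_mul]

end trigSpan

end TrigSpan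

section TrigApprox

variable {H : Type} [NormedAddCommGroup H] [InnerProductSpace ℝ H] [MeasurableSpace H]
  [BorelSpace H] [SecondCountableTopology H]

/-- `|∫ f dν₁ - ∫ f dν₂| ≤ ρ B` for all trigonometric sums `f` in the class `(ρ, M)`. -/
def TrigBound (V : Submodule ℝ H) (ν₁ ν₂ : Measure (ℝ × H)) (M B : ℝ) : Prop :=
  ∀ (ρ : ℝ) (f : ℝ × H → ℝ), f ∈ trigSpan V ℝ →
    (∀ t, SecondDiffClass ρ M fun x => f (t, x)) → |∫ p, f p ∂ν₁ - ∫ p, f p ∂ν₂| ≤ ρ * B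

lemma tendsto_integral_sub_of_bounded {ν₁ ν₂ : Measure (ℝ × H)} [IsFiniteMeasure ν₁]
    [IsFiniteMeasure ν₂] {F : ℕ → ℝ × H → ℝ} {f : ℝ × H → ℝ} (hm : ∀ n, Measurable (F n))
    {c : ℝ} (hc : ∀ᶠ n in atTop, ∀ p, |F n p| ≤ c)
    (hlim : ∀ p, Tendsto (fun n => F n p) atTop (𝓝 (f p))) :
    Tendsto (fun n => |∫ p, F n p ∂ν₁ - ∫ p, F n p ∂ν₂|) atTop
      (𝓝 |∫ p, f p ∂ν₁ - ∫ p, f p ∂ν₂|) := by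
  have key : ∀ (ν : Measure (ℝ × H)) [IsFiniteMeasure ν],
      Tendsto (fun n => ∫ p, F n p ∂ν) atTop (𝓝 (∫ p, f p ∂ν)) := fun ν _ =>
    tendsto_integral_filter_of_dominated_convergence (fun _ => c)
      (Eventually.of_forall fun n => (hm n).aestronglyMeasurable)
      (hc.mono fun n hn => Eventually.of_forall fun p => hn p) (integrable_const _)
      (Eventually.of_forall hlim)
  exact ((key ν₁).sub (key ν₂)).abs

variable {ι : Type} [Fintype ι]

lemma angle_abs_cos_le_one (x : Real.Angle) : |x.cos| ≤ 1 := by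
  induction x using Real.Angle.induction_on with
  | _ x => exact Real.abs_cos_le_one x

/-- The kernel `∏ (1 + cos τ_i)` on the torus. -/
noncomputable def torusKernel (τ : ι → AddCircle (2 * Real.pi)) : ℝ :=
  ∏ i, (1 + Real.Angle.cos (τ i))

lemma continuous_torusKernel : Continuous (torusKernel (ι := ι)) := by
  unfold torusKernel
  have : ∀ i : ι, Continuous fun τ : ι → AddCircle (2 * Real.pi) => Real.Angle.cos (τ i) :=
    fun i => Real.Angle.continuous_cos.comp (continuous_apply i)
  fun_prop

lemma torusKernel_nonneg (τ : ι → AddCircle (2 * Real.pi)) : 0 ≤ torusKernel τ :=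
  Finset.prod_nonneg fun i _ => by linarith [angle_abs_cos_le_one (τ i), neg_abs_le (Real.Angle.cos (τ i))]

lemma torusKernel_zero_pos : 0 < torusKernel (0 : ι → AddCircle (2 * Real.pi)) := by
  refine Finset.prod_pos fun i _ => ?_
  change 0 < 1 + Real.Angle.cos 0
  simp

lemma torusKernel_lt {τ : ι → AddCircle (2 * Real.pi)} (hτ : τ ≠ 0) :
    torusKernel τ < torusKernel (0 : ι → AddCircle (2 * Real.pi)) := by
  obtain ⟨i, hi⟩ := Function.ne_iff.1 hτ
  have h0 : ∀ j : ι, 1 + Real.Angle.cos ((0 : ι → AddCircle (2 * Real.pi)) j) = 2 := fun j => by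
    change 1 + Real.Angle.cos 0 = 2
    norm_num
  have hle : ∀ x : Real.Angle, Real.Angle.cos x ≤ 1 := fun x =>
    (le_abs_self _).trans (angle_abs_cos_le_one x)
  have hlt : Real.Angle.cos (τ i) < 1 := by
    refine lt_of_le_of_ne (hle _) fun h => hi ?_
    induction hx : (τ i : Real.Angle) using Real.Angle.induction_on with
    | _ x =>
      rw [hx, Real.Angle.cos_coe] at h
      obtain ⟨n, hn⟩ := (Real.cos_eq_one_iff x).1 h
      change (x : Real.Angle) = 0
      rw [← hn]
      simp
  unfold torusKernel
  simp only [h0]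
  rw [← Finset.mul_prod_erase _ _ (Finset.mem_univ i), ← Finset.mul_prod_erase _ _ (Finset.mem_univ i)]
  have h1 : ∏ j ∈ Finset.univ.erase i, (1 + Real.Angle.cos (τ j)) ≤
      ∏ j ∈ (Finset.univ.erase i : Finset ι), (2 : ℝ) :=
    Finset.prod_le_prod (fun j _ => by
      linarith [angle_abs_cos_le_one (τ j), neg_abs_le (Real.Angle.cos (τ j))])
      (fun j _ => by linarith [hle (τ j)])
  have h2 : (0:ℝ) < ∏ j ∈ (Finset.univ.erase i : Finset ι), (2 : ℝ) :=
    Finset.prod_pos fun _ _ => by norm_num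
  have h3 : 0 ≤ 1 + Real.Angle.cos (τ i) := by
    linarith [angle_abs_cos_le_one (τ i), neg_abs_le (Real.Angle.cos (τ i))]
  nlinarith

/-- `x ↦ ∑ N sin(⟨x,e_i⟩/N) e_i`. -/
noncomputable def sinMap (e : ι → H) (N : ℝ) (x : H) : H :=
  ∑ i, (N * Real.sin (⟪x, e i⟫_ℝ / N)) • e i

variable {e : ι → H}

lemma continuous_sinMap (N : ℝ) : Continuous (sinMap e N) := by
  unfold sinMap; fun_prop

lemma norm_sum_smul_le (he : Orthonormal ℝ e) (v : ι → ℝ) (b : H) {c : ℝ} (hc : 0 ≤ c)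
    (hv : ∀ i, |v i| ≤ c * |⟪b, e i⟫_ℝ|) : ‖∑ i, v i • e i‖ ≤ c * ‖b‖ := by
  refine abs_le_of_sq_le_sq' ?_ (by positivity) |>.2
  have h1 : ‖∑ i, v i • e i‖ ^ 2 = ∑ i, (v i) ^ 2 := by
    rw [← real_inner_self_eq_norm_sq, he.inner_sum]
    simp [sq]
  rw [h1, mul_pow]
  calc ∑ i, (v i) ^ 2 ≤ ∑ i, c ^ 2 * ‖⟪e i, b⟫_ℝ‖ ^ 2 := by
        refine Finset.sum_le_sum fun i _ => ?_
        have := hv i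
        rw [real_inner_comm, ← mul_pow, ← sq_abs (v i), Real.norm_eq_abs]
        gcongr
    _ = c ^ 2 * ∑ i, ‖⟪e i, b⟫_ℝ‖ ^ 2 := by rw [Finset.mul_sum]
    _ ≤ _ := by
        gcongr
        exact he.sum_inner_products_le b

lemma abs_sin_sub_sin_le (x y : ℝ) : |Real.sin x - Real.sin y| ≤ |x - y| := by
  have h : LipschitzWith 1 Real.sin := lipschitzWith_of_nnnorm_deriv_le Real.differentiable_sin
    fun x => by
      rw [Real.deriv_sin, ← NNReal.coe_le_coe]
      simpa using Real.abs_cos_le_one x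
  simpa [Real.dist_eq] using h.dist_le_mul x y

lemma abs_cos_sub_cos_le (x y : ℝ) : |Real.cos x - Real.cos y| ≤ |x - y| := by
  have := abs_sin_sub_sin_le (x + Real.pi / 2) (y + Real.pi / 2)
  simpa [Real.sin_add_pi_div_two] using this

lemma sinMap_lip (he : Orthonormal ℝ e) {N : ℝ} (hN : 0 < N) (x y : H) :
    ‖sinMap e N x - sinMap e N y‖ ≤ 1 * ‖x - y‖ := by
  unfold sinMap
  rw [← Finset.sum_sub_distrib]
  simp only [← sub_smul]
  refine norm_sum_smul_le he _ _ zero_le_one fun i => ?_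
  rw [← mul_sub, abs_mul, abs_of_pos hN, inner_sub_left, one_mul]
  calc _ ≤ N * |⟪x, e i⟫_ℝ / N - ⟪y, e i⟫_ℝ / N| :=
        mul_le_mul_of_nonneg_left (abs_sin_sub_sin_le _ _) hN.le
    _ = _ := by rw [← sub_div, abs_div, abs_of_pos hN]; field_simp

lemma abs_sin_second_le (x a b : ℝ) :
    |Real.sin (x + a + b) - Real.sin (x + a) - Real.sin (x + b) + Real.sin x| ≤ |a| * |b| := by
  have e1 : Real.sin (x + a + b) - Real.sin (x + a) - Real.sin (x + b) + Real.sin x =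
      2 * Real.sin (b / 2) * (Real.cos (x + a + b / 2) - Real.cos (x + b / 2)) := by
    have h1 := Real.sin_sub_sin (x + a + b) (x + a)
    have h2 := Real.sin_sub_sin (x + b) x
    rw [show (x + a + b - (x + a)) / 2 = b / 2 by ring,
      show (x + a + b + (x + a)) / 2 = x + a + b / 2 by ring] at h1
    rw [show (x + b - x) / 2 = b / 2 by ring, show (x + b + x) / 2 = x + b / 2 by ring] at h2
    linear_combination h1 - h2
  rw [e1, abs_mul, abs_mul, abs_two]
  have h1 : |Real.sin (b / 2)| ≤ |b| / 2 := by
    have := abs_sin_sub_sin_le (b / 2) 0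
    simpa [abs_div] using this
  have h2 := abs_cos_sub_cos_le (x + a + b / 2) (x + b / 2)
  rw [show x + a + b / 2 - (x + b / 2) = a by ring] at h2
  nlinarith [abs_nonneg a, abs_nonneg b, abs_nonneg (Real.sin (b / 2)),
    abs_nonneg (Real.cos (x + a + b / 2) - Real.cos (x + b / 2))]

lemma sinMap_second (he : Orthonormal ℝ e) {N : ℝ} (hN : 0 < N) (x a b : H) :
    ‖sinMap e N (x + a + b) - sinMap e N (x + a) - sinMap e N (x + b) + sinMap e N x‖ ≤
      1 / N * ‖a‖ * ‖b‖ := by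
  unfold sinMap
  rw [← Finset.sum_sub_distrib, ← Finset.sum_sub_distrib, ← Finset.sum_add_distrib]
  simp only [← sub_smul, ← add_smul]
  refine norm_sum_smul_le he _ b (by positivity) fun i => ?_
  have h1 := abs_sin_second_le (⟪x, e i⟫_ℝ / N) (⟪a, e i⟫_ℝ / N) (⟪b, e i⟫_ℝ / N)
  simp only [inner_add_left, add_div, ← mul_sub, ← mul_add, abs_mul, abs_of_pos hN]
  have h2 : |⟪a, e i⟫_ℝ| ≤ ‖a‖ := by
    simpa [he.1 i] using abs_real_inner_le_norm a (e i)
  calc _ ≤ N * (|⟪a, e i⟫_ℝ / N| * |⟪b, e i⟫_ℝ / N|) := by gcongr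
    _ = 1 / N * |⟪a, e i⟫_ℝ| * |⟪b, e i⟫_ℝ| := by
      rw [abs_div, abs_div, abs_of_pos hN]; field_simp
    _ ≤ _ := by gcongr

end TrigApprox

section TrigApproxLimit

variable {H : Type} [NormedAddCommGroup H] [InnerProductSpace ℝ H] [MeasurableSpace H]
  [BorelSpace H] [SecondCountableTopology H]

variable {ι : Type} [Fintype ι] {e : ι → H} {V : Submodule ℝ H} {ρ M B : ℝ}

lemma torusKernel_sub_mem (he : ∀ i, e i ∈ V) (N : ℝ) :
    (fun p : (ℝ × (ι → AddCircle (2 * Real.pi))) × H =>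
      torusKernel (p.1.2 - fun i => ((⟪p.2, e i⟫_ℝ / N : ℝ) : AddCircle (2 * Real.pi)))) ∈
      trigSpan V (ℝ × (ι → AddCircle (2 * Real.pi))) := by
  unfold torusKernel
  refine trigSpan.prod_mem Finset.univ fun i => ?_
  have hc : Measurable fun t : ℝ × (ι → AddCircle (2 * Real.pi)) => Real.Angle.cos (t.2 i) :=
    (Real.Angle.continuous_cos.comp ((continuous_apply i).comp continuous_snd)).measurable
  have hs : Measurable fun t : ℝ × (ι → AddCircle (2 * Real.pi)) => Real.Angle.sin (t.2 i) :=
    (Real.Angle.continuous_sin.comp ((continuous_apply i).comp continuous_snd)).measurable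
  have hs1 : ∀ x : Real.Angle, |x.sin| ≤ 1 := fun x => by
    induction x using Real.Angle.induction_on with
    | _ x => exact Real.abs_sin_le_one x
  have hm : (1 / N) • e i ∈ V := V.smul_mem _ (he i)
  convert (trigSpan V (ℝ × (ι → AddCircle (2 * Real.pi)))).add_mem trigSpan.one_mem
    ((trigSpan V (ℝ × (ι → AddCircle (2 * Real.pi)))).add_mem
      (trigSpan.cos_mem hc (fun t => angle_abs_cos_le_one _) hm 0)
      (trigSpan.cos_mem hs (fun t => hs1 _) hm (-(Real.pi / 2)))) using 1
  funext p
  simp only [Pi.add_apply, inner_smul_right]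
  rw [show 1 / N * ⟪p.2, e i⟫_ℝ = ⟪p.2, e i⟫_ℝ / N by ring, add_zero, ← sub_eq_add_neg,
    Real.cos_sub_pi_div_two]
  congr 1
  have : ∀ (a : Real.Angle) (x : ℝ), Real.Angle.cos (a - x) = a.cos * Real.cos x + a.sin * Real.sin x := by
    intro a x
    induction a using Real.Angle.induction_on with
    | _ a => rw [← Real.Angle.coe_sub, Real.Angle.cos_coe, Real.cos_sub]; rfl
  exact this _ _

lemma TrigBound.comp_sinMap {ν₁ ν₂ : Measure (ℝ × H)} [IsFiniteMeasure ν₁]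
    [IsFiniteMeasure ν₂] (hV : TrigBound V ν₁ ν₂ M B) (hM : 0 < M) (he : Orthonormal ℝ e)
    (heV : ∀ i, e i ∈ V) {N : ℝ} (hN : 0 < N) {g : ℝ × H → ℝ} (hg : Measurable g)
    (hgc : ∀ t, SecondDiffClass ρ M fun x => g (t, x)) :
    |∫ p, g (p.1, sinMap e N p.2) ∂ν₁ - ∫ p, g (p.1, sinMap e N p.2) ∂ν₂| ≤
      (ρ * (1 + 1 / (N * M))) * B := by
  have : Fact (0 < 2 * Real.pi) := ⟨Real.two_pi_pos⟩
  have hρ : 0 ≤ ρ := (hgc 0).nonneg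
  set ρ' := ρ * (1 + 1 / (N * M)) with hρ'
  let 𝕋 := ι → AddCircle (2 * Real.pi)
  let u : H → 𝕋 := fun x i => ((⟪x, e i⟫_ℝ / N : ℝ) : AddCircle (2 * Real.pi))
  let σ : 𝕋 → H := fun τ => ∑ i, (N * Real.Angle.sin (τ i)) • e i
  have hσ : Continuous σ := by
    have : ∀ i : ι, Continuous fun τ : 𝕋 => Real.Angle.sin (τ i) :=
      fun i => Real.Angle.continuous_sin.comp (continuous_apply i)
    fun_prop
  let Φ : ℝ × 𝕋 → ℝ := fun q => g (q.1, σ q.2)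
  have hΦ : Measurable Φ := hg.comp (measurable_fst.prodMk (hσ.measurable.comp measurable_snd))
  have hΦc : ∀ t, Continuous fun τ => Φ (t, τ) := fun t => (hgc t).continuous.comp hσ
  have hΦb : ∀ q, |Φ q| ≤ ρ := fun q => (hgc q.1).bound _
  have hk := continuous_torusKernel (ι := ι)
  have hkm : ∀ m : ℕ, Integrable (fun τ : 𝕋 => torusKernel τ ^ m) volume := fun m =>
    (hk.pow m).integrable_of_hasCompactSupport (HasCompactSupport.of_compactSpace _)
  have hcpos : ∀ m : ℕ, 0 < ∫ τ : 𝕋, torusKernel τ ^ m := fun m =>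
    (hk.pow m).integral_pos_of_hasCompactSupport_nonneg_nonzero
      (HasCompactSupport.of_compactSpace _) (fun τ => pow_nonneg (torusKernel_nonneg τ) m)
      (x := 0) (pow_pos torusKernel_zero_pos m).ne'
  let G : ℕ → ℝ × H → ℝ := fun m p =>
    (∫ τ : 𝕋, torusKernel τ ^ m)⁻¹ • ∫ τ : 𝕋, torusKernel τ ^ m • Φ (p.1, τ + u p.2)
  have hGmem : ∀ m, G m ∈ trigSpan V ℝ := by
    intro m
    have h1 := (trigSpan.integral_mem (P := (volume : Measure 𝕋)) hΦ hΦb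
      (trigSpan.pow_mem (torusKernel_sub_mem heV N) m)).2
    convert (trigSpan V ℝ).smul_mem (∫ τ : 𝕋, torusKernel τ ^ m)⁻¹ h1 using 1
    funext p
    simp only [G, Pi.smul_apply, smul_eq_mul]
    congr 1
    rw [← integral_sub_right_eq_self (μ := (volume : Measure 𝕋)) _ (u p.2)]
    refine integral_congr_ae (Eventually.of_forall fun τ => ?_)
    simp only [u, sub_add_cancel]
    rw [mul_comm]
  have hGcls : ∀ m t, SecondDiffClass ρ' M fun x => G m (t, x) := by
    intro m t
    let P : Measure 𝕋 := volume.withDensity fun τ =>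
      ENNReal.ofReal ((∫ τ : 𝕋, torusKernel τ ^ m)⁻¹ * torusKernel τ ^ m)
    have hdens : ∀ τ : 𝕋, 0 ≤ (∫ τ : 𝕋, torusKernel τ ^ m)⁻¹ * torusKernel τ ^ m := fun τ =>
      mul_nonneg (inv_nonneg.2 (hcpos m).le) (pow_nonneg (torusKernel_nonneg τ) m)
    have hdm : Measurable fun τ : 𝕋 => (∫ τ : 𝕋, torusKernel τ ^ m)⁻¹ * torusKernel τ ^ m :=
      ((hk.pow m).measurable.const_mul _)
    have : IsProbabilityMeasure P := ⟨by
      rw [withDensity_apply _ MeasurableSet.univ, Measure.restrict_univ,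
        ← ofReal_integral_eq_lintegral_ofReal ((hkm m).const_mul _)
          (Eventually.of_forall hdens), integral_const_mul, inv_mul_cancel₀ (hcpos m).ne',
        ENNReal.ofReal_one]⟩
    have hint : ∀ x, G m (t, x) = ∫ τ, Φ (t, τ + u x) ∂P := by
      intro x
      rw [integral_withDensity_eq_integral_toReal_smul hdm.ennreal_ofReal
        (Eventually.of_forall fun τ => ENNReal.ofReal_lt_top)]
      simp only [G, ENNReal.toReal_ofReal (hdens _), smul_eq_mul, mul_assoc, integral_const_mul]
    simp only [hint]
    refine SecondDiffClass.integral (fun τ => ?_) fun x =>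
      ((hΦc t).comp (continuous_id.add continuous_const)).aestronglyMeasurable
    have hr : ∀ i, ∃ r : ℝ, (r : AddCircle (2 * Real.pi)) = τ i := fun i =>
      QuotientAddGroup.mk_surjective _
    choose r hr using hr
    have hsin : ∀ x, Φ (t, τ + u x) = g (t, sinMap e N (x + ∑ j, (N * r j) • e j)) := by
      intro x
      simp only [Φ, σ, sinMap]
      congr 2
      refine Finset.sum_congr rfl fun i _ => ?_
      congr 2
      have h1 : ⟪∑ j, (N * r j) • e j, e i⟫_ℝ = N * r i := by
        rw [sum_inner, Finset.sum_eq_single i]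
        · simp [inner_smul_left, he.1 i]
        · intro j _ hj
          simp [inner_smul_left, he.2 hj]
        · simp
      rw [inner_add_left, h1, add_div, mul_div_cancel_left₀ _ hN.ne', add_comm]
      rw [Pi.add_apply, ← hr i]
      rfl
    simp only [hsin]
    have h2 : SecondDiffClass ρ' M fun x => g (t, sinMap e N x) := by
      have hNM : 0 < 1 / (N * M) := by positivity
      refine (hgc t).comp_map hM.le (c := 1) (N := 1 / N) zero_le_one (sinMap_lip he hN)
        (sinMap_second he hN) ?_ ?_ ?_
      · rw [hρ']; nlinarith
      · rw [hρ']; nlinarith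
      · rw [hρ']; apply le_of_eq; field_simp
    exact h2.comp_clm hM.le (ContinuousLinearMap.id ℝ H) (fun x => le_rfl) _
  have hlim : ∀ p, Tendsto (fun m => G m p) atTop (𝓝 (g (p.1, sinMap e N p.2))) := by
    intro p
    have hcont : Continuous fun τ : 𝕋 => Φ (p.1, τ + u p.2) :=
      (hΦc p.1).comp (continuous_id.add continuous_const)
    have h := tendsto_setIntegral_pow_smul_of_unique_maximum_of_isCompact_of_continuousOn
      (μ := (volume : Measure 𝕋)) (s := univ) (x₀ := (0 : 𝕋)) (c := torusKernel)
      isCompact_univ hk.continuousOn (fun y _ hy => torusKernel_lt hy)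
      (fun y _ => torusKernel_nonneg y) torusKernel_zero_pos (by simp) hcont.continuousOn
    simp only [Measure.restrict_univ, zero_add] at h
    have h0 : Φ (p.1, u p.2) = g (p.1, sinMap e N p.2) := rfl
    rw [h0] at h
    exact h
  refine le_of_tendsto (tendsto_integral_sub_of_bounded (fun m => trigSpan.measurable (hGmem m))
    (c := ρ') (Eventually.of_forall fun m p => (hGcls m p.1).bound p.2) hlim) ?_
  exact Eventually.of_forall fun m => hV ρ' _ (hGmem m) (hGcls m)

end TrigApproxLimit

section ProjectionApprox

variable {H : Type} [NormedAddCommGroup H] [InnerProductSpace ℝ H] [CompleteSpace H]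
  [SecondCountableTopology H]

lemma exists_tendsto_starProjection {V : Submodule ℝ H} (hV : Dense (V : Set H)) :
    ∃ U : ℕ → Submodule ℝ H, (∀ n, U n ≤ V) ∧ ∃ _ : ∀ n, FiniteDimensional ℝ (U n),
      ∀ x, Tendsto (fun n => (U n).starProjection x) atTop (𝓝 x) := by
  let v : ℕ → V := TopologicalSpace.denseSeq V
  let U : ℕ → Submodule ℝ H := fun n => Submodule.span ℝ ((fun i => (v i : H)) '' Iio n)
  have hfin : ∀ n, FiniteDimensional ℝ (U n) := fun n =>
    FiniteDimensional.span_of_finite ℝ ((finite_Iio n).image _)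
  refine ⟨U, fun n => ?_, hfin, fun x => ?_⟩
  · refine Submodule.span_le.2 ?_
    rintro _ ⟨i, -, rfl⟩
    exact (v i).2
  · have hmono : Monotone U := fun m n hmn =>
      Submodule.span_mono (image_mono (Iio_subset_Iio hmn))
    refine Submodule.starProjection_tendsto_self U hmono x ?_
    rw [top_le_iff, ← Submodule.dense_iff_topologicalClosure_eq_top, dense_iff_closure_eq,
      ← univ_subset_iff, ← hV.closure_eq]
    refine closure_minimal ?_ isClosed_closure
    have h1 : (V : Set H) ⊆ closure (range fun i => (v i : H)) := by
      intro y hy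
      have h2 : (⟨y, hy⟩ : V) ∈ closure (range v) := TopologicalSpace.denseRange_denseSeq V _
      have h3 := image_closure_subset_closure_image (continuous_subtype_val (p := fun x => x ∈ V))
        (mem_image_of_mem _ h2)
      rwa [← range_comp] at h3
    refine h1.trans (closure_mono ?_)
    rintro _ ⟨i, rfl⟩
    exact Submodule.mem_iSup_of_mem (i + 1)
      (Submodule.subset_span ⟨i, by simp, rfl⟩)

variable [MeasurableSpace H] [BorelSpace H] {V : Submodule ℝ H} {ρ M B : ℝ}

lemma tendsto_mul_sin_div (y : ℝ) :
    Tendsto (fun n : ℕ => ((n : ℝ) + 1) * Real.sin (y / ((n : ℝ) + 1))) atTop (𝓝 y) := by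
  have h0 : Tendsto (fun n : ℕ => y / ((n : ℝ) + 1)) atTop (𝓝 0) :=
    tendsto_const_nhds.div_atTop (tendsto_natCast_atTop_atTop.atTop_add tendsto_const_nhds)
  have h1 := ((Real.continuous_sinc.tendsto 0).comp h0).const_mul y
  simp only [Real.sinc_zero, mul_one] at h1
  refine h1.congr fun n => ?_
  by_cases hy : y = 0
  · simp [hy]
  · have hn : (n : ℝ) + 1 ≠ 0 := by positivity
    have := Real.sinc_of_ne_zero (div_ne_zero hy hn)
    simp only [Function.comp, this]
    field_simp

theorem TrigBound.bound {ν₁ ν₂ : Measure (ℝ × H)} [IsFiniteMeasure ν₁]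
    [IsFiniteMeasure ν₂] (hb : TrigBound V ν₁ ν₂ M B) (hV : Dense (V : Set H)) (hM : 0 < M)
    {g : ℝ × H → ℝ} (hg : Measurable g) (hgc : ∀ t, SecondDiffClass ρ M fun x => g (t, x)) :
    |∫ p, g p ∂ν₁ - ∫ p, g p ∂ν₂| ≤ ρ * B := by
  obtain ⟨U, hUV, hfin, hU⟩ := exists_tendsto_starProjection hV
  have hρ : 0 ≤ ρ := (hgc 0).nonneg
  refine le_of_tendsto (tendsto_integral_sub_of_bounded (ν₁ := ν₁) (ν₂ := ν₂)
    (F := fun n p => g (p.1, (U n).starProjection p.2)) (c := ρ) (fun n => ?_)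
    (Eventually.of_forall fun n p => (hgc _).bound _) fun p => ?_) (Eventually.of_forall fun n => ?_)
  · exact hg.comp (measurable_fst.prodMk
      ((U n).starProjection.continuous.measurable.comp measurable_snd))
  · exact ((hgc p.1).continuous.tendsto _).comp (hU p.2)
  · let b := stdOrthonormalBasis ℝ (U n)
    let e : Fin (Module.finrank ℝ (U n)) → H := fun i => (b i : H)
    have he : Orthonormal ℝ e := b.orthonormal.comp_linearIsometry (U n).subtypeₗᵢ
    have hproj : ∀ x, (U n).starProjection x = ∑ i, ⟪x, e i⟫_ℝ • e i := by
      intro x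
      have h1 := b.sum_repr ((U n).orthogonalProjectionOnto x)
      rw [Submodule.starProjection_apply, ← h1]
      simp only [Submodule.coe_sum, Submodule.coe_smul, b.repr_apply_apply]
      refine Finset.sum_congr rfl fun i _ => ?_
      congr 1
      rw [Submodule.coe_inner, real_inner_comm, ← Submodule.coe_inner]
      exact Submodule.inner_orthogonalProjectionOnto_eq_of_mem_right (b i) x
    have hlim : ∀ x, Tendsto (fun k : ℕ => sinMap e ((k : ℝ) + 1) x) atTop
        (𝓝 ((U n).starProjection x)) := by
      intro x
      rw [hproj]
      exact tendsto_finsetSum _ fun i _ => (tendsto_mul_sin_div _).smul_const _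
    have hl2 : Tendsto (fun k : ℕ => (ρ * (1 + 1 / (((k : ℝ) + 1) * M))) * B) atTop
        (𝓝 (ρ * B)) := by
      have h0 : Tendsto (fun k : ℕ => 1 / (((k : ℝ) + 1) * M)) atTop (𝓝 0) :=
        tendsto_const_nhds.div_atTop
          ((tendsto_natCast_atTop_atTop.atTop_add tendsto_const_nhds).atTop_mul_const hM)
      simpa using ((h0.const_add 1).const_mul ρ).mul_const B
    refine le_of_tendsto_of_tendsto (tendsto_integral_sub_of_bounded (ν₁ := ν₁) (ν₂ := ν₂)
      (F := fun k p => g (p.1, sinMap e ((k : ℝ) + 1) p.2)) (c := ρ) (fun k => ?_)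
      (Eventually.of_forall fun k p => (hgc _).bound _) fun p => ?_) hl2
      (Eventually.of_forall fun k => ?_)
    · exact hg.comp (measurable_fst.prodMk ((continuous_sinMap _).measurable.comp measurable_snd))
    · exact ((hgc p.1).continuous.tendsto _).comp (hlim p.2)
    · exact hb.comp_sinMap hM he (fun i => hUV n (b i).2) (by positivity) hg hgc

end ProjectionApprox

namespace FPData

section GaussianSmoothing

open ProbabilityTheory

variable {H : Type} [NormedAddCommGroup H] [InnerProductSpace ℝ H] [CompleteSpace H]
  [SecondCountableTopology H] [MeasurableSpace H] [BorelSpace H] {D : FPData H}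

lemma Hyp31.continuousOn_S_comp (hyp : D.Hyp31) {t : ℝ} {y : ℝ → H} (hy : Continuous y) :
    ContinuousOn (fun r => D.S r (y r)) (Icc 0 t) := by
  intro r₀ hr₀
  have h1 : Tendsto (fun r => D.S r (y r₀)) (𝓝[Icc 0 t] r₀) (𝓝 (D.S r₀ (y r₀))) :=
    ((D.S_cont (y r₀)).mono Icc_subset_Ici_self) r₀ hr₀
  have h2 : Tendsto (fun r => D.S r (y r - y r₀)) (𝓝[Icc 0 t] r₀) (𝓝 0) := by
    have h3 : Tendsto (fun r => Real.exp (max hyp.ω 0 * r) * ‖y r - y r₀‖)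
        (𝓝[Icc 0 t] r₀) (𝓝 0) := by
      have : Continuous fun r => Real.exp (max hyp.ω 0 * r) * ‖y r - y r₀‖ := by fun_prop
      simpa using (this.tendsto r₀).mono_left nhdsWithin_le_nhds
    refine squeeze_zero_norm' ?_ h3
    filter_upwards [self_mem_nhdsWithin] with r hr
    exact hyp.norm_S_le hr.1 _
  have h4 := h2.add h1
  rw [zero_add] at h4
  refine h4.congr fun r => ?_
  rw [← map_add, sub_add_cancel]

lemma Hyp31.norm_sqrtQ_sq (hyp : D.Hyp31) {t : ℝ} (ht : 0 < t) {h : H} (hh : h ∈ D.V) :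
    ‖hyp.sqrtQ t h‖ ^ 2 = ∫ r in (0:ℝ)..t, ‖D.sqrtC (D.Sadj (max r 0) h)‖ ^ 2 := by
  obtain ⟨g, k, l, hg, -, -⟩ := hh
  have h1 : ‖hyp.sqrtQ t h‖ ^ 2 = ⟪h, hyp.Q t h⟫_ℝ := by
    rw [← hyp.sqrtQ_sq t ht, ← real_inner_self_eq_norm_sq, ContinuousLinearMap.comp_apply]
    exact (hyp.sqrtQ_pos t ht).isSymmetric _ _
  have hcont : ContinuousOn (fun r => D.S r (D.C (D.Sadj r h))) (Icc 0 t) :=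
    (hyp.continuousOn_S_comp (D.C.continuous.comp (hyp.Sadj_continuous hg))).congr fun r hr => by
      simp only [Function.comp, max_eq_left hr.1]
  have hint : IntervalIntegrable (fun r => D.S r (D.C (D.Sadj r h))) volume 0 t :=
    (by rwa [uIcc_of_le ht.le] : ContinuousOn _ (uIcc 0 t)).intervalIntegrable
  have h2 : hyp.Q t h = ∫ r in (0:ℝ)..t, D.S r (D.C (D.Sadj r h)) := hyp.Q_def t ht h
  have h3 := (innerSL ℝ h).intervalIntegral_comp_comm hint
  rw [h1, h2, ← innerSL_apply_apply ℝ, ← h3]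
  refine intervalIntegral.integral_congr fun r hr => ?_
  rw [uIcc_of_le ht.le] at hr
  simp only [innerSL_apply_apply, max_eq_left hr.1]
  rw [← Sadj_inner, ← D.sqrtC_sq, ContinuousLinearMap.comp_apply, ← real_inner_self_eq_norm_sq]
  exact (D.sqrtC_pos.isSymmetric _ _).symm

lemma Hyp31.exists_gaussian (hyp : D.Hyp31) {t : ℝ} (ht : 0 < t) {n : ℕ} {h : Fin n → H}
    (hh : ∀ j, h j ∈ D.V) : ∃ γ : Measure H, IsProbabilityMeasure γ ∧
      ∀ j θ, ∫ z, Real.cos (⟪z, h j⟫_ℝ + θ) ∂γ = D.gaussFactor (h j) t * Real.cos θ := by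
  let E : Submodule ℝ H := Submodule.span ℝ (range fun j => hyp.sqrtQ t (h j))
  have : FiniteDimensional ℝ E := FiniteDimensional.span_of_finite ℝ (finite_range _)
  have hm : Measurable fun e : E => hyp.sqrtQ t (e : H) :=
    ((hyp.sqrtQ t).continuous.comp continuous_subtype_val).measurable
  refine ⟨(stdGaussian E).map fun e : E => hyp.sqrtQ t (e : H),
    Measure.isProbabilityMeasure_map hm.aemeasurable, fun j θ => ?_⟩
  let u : E := ⟨hyp.sqrtQ t (h j), Submodule.subset_span ⟨j, rfl⟩⟩
  have hc : Continuous fun z : H => Real.cos (⟪z, h j⟫_ℝ + θ) := by fun_prop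
  rw [integral_map hm.aemeasurable hc.aestronglyMeasurable]
  have hin : ∀ e : E, ⟪hyp.sqrtQ t (e : H), h j⟫_ℝ = ⟪e, u⟫_ℝ := fun e =>
    (hyp.sqrtQ_pos t ht).isSymmetric _ _
  simp only [hin]
  have hre : ∀ e : E, Real.cos (⟪e, u⟫_ℝ + θ) =
      (Complex.exp (⟪e, u⟫_ℝ * Complex.I) * Complex.exp (θ * Complex.I)).re := fun e => by
    rw [← Complex.exp_add, ← add_mul, ← Complex.ofReal_add, Complex.exp_ofReal_mul_I_re]
  have hi : Integrable (fun e : E => Complex.exp (⟪e, u⟫_ℝ * Complex.I) *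
      Complex.exp (θ * Complex.I)) (stdGaussian E) := by
    refine (integrable_const (1:ℝ)).mono' (by fun_prop) (Eventually.of_forall fun e => ?_)
    rw [norm_mul, Complex.norm_exp_ofReal_mul_I, Complex.norm_exp_ofReal_mul_I, one_mul]
  simp only [hre]
  have h1 := integral_re hi
  simp only [RCLike.re_to_complex] at h1
  rw [h1, integral_mul_const, ← charFun_apply, charFun_stdGaussian]
  have hu : ‖u‖ ^ 2 = ∫ r in (0:ℝ)..t, ‖D.sqrtC (D.Sadj (max r 0) (h j))‖ ^ 2 :=
    hyp.norm_sqrtQ_sq ht (hh j)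
  have h2 : (-(‖u‖:ℂ) ^ 2 / 2) = ((-(1 / 2) * ‖u‖ ^ 2 : ℝ) : ℂ) := by push_cast; ring
  rw [h2, ← Complex.ofReal_exp, Complex.re_ofReal_mul, Complex.exp_ofReal_mul_I_re, hu]
  rfl

lemma Hyp31.secondDiffClass_smoothing (hyp : D.Hyp31) {t : ℝ} (ht : 0 < t) {n : ℕ} {h : Fin n → H}
    (hh : ∀ j, h j ∈ D.V) {a θ : Fin n → ℝ} {ρ M : ℝ} (hM : 0 ≤ M)
    (hf : SecondDiffClass ρ M fun x => ∑ j, a j * Real.cos (⟪x, h j⟫_ℝ + θ j)) :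
    SecondDiffClass (ρ * Real.exp (2 * max hyp.ω 0 * t)) M fun x =>
      ∑ j, a j * (D.gaussFactor (h j) t * Real.cos (⟪x, D.Sadj t (h j)⟫_ℝ + θ j)) := by
  obtain ⟨γ, hγ, hγc⟩ := hyp.exists_gaussian ht hh
  have hw : 0 ≤ max hyp.ω 0 := le_max_right _ _
  have hρ := hf.nonneg
  have hcos : ∀ (x : H) j, Continuous fun z : H => Real.cos (⟪D.S t x + z, h j⟫_ℝ + θ j) :=
    fun x j => by fun_prop
  have h1 : ∀ x, ∑ j, a j * (D.gaussFactor (h j) t * Real.cos (⟪x, D.Sadj t (h j)⟫_ℝ + θ j)) =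
      ∫ z, ∑ j, a j * Real.cos (⟪D.S t x + z, h j⟫_ℝ + θ j) ∂γ := by
    intro x
    rw [integral_finsetSum]
    · refine Finset.sum_congr rfl fun j _ => ?_
      rw [integral_const_mul, inner_Sadj, ← hγc j]
      congr 2
      funext z
      rw [inner_add_left]
      congr 1
      ring
    · intro j _
      refine Integrable.const_mul ?_ _
      exact (integrable_const (1:ℝ)).mono' (hcos x j).aestronglyMeasurable
        (Eventually.of_forall fun z => Real.abs_cos_le_one _)
  simp only [h1]
  have he1 : 1 ≤ Real.exp (max hyp.ω 0 * t) := Real.one_le_exp (by positivity)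
  have he2 : Real.exp (2 * max hyp.ω 0 * t) = Real.exp (max hyp.ω 0 * t) ^ 2 := by
    rw [← Real.exp_nat_mul]; congr 1; push_cast; ring
  refine SecondDiffClass.integral (fun z => ?_) fun x =>
    (continuous_finsetSum _ fun j _ => continuous_const.mul (hcos x j)).aestronglyMeasurable
  refine hf.comp_map (J := fun x => D.S t x + z) (c := Real.exp (max hyp.ω 0 * t)) (N := 0) hM
    (Real.exp_pos _).le (fun x y => ?_) (fun x a b => ?_) ?_ ?_ ?_
  · simpa [← map_sub] using hyp.norm_S_le ht.le (x - y)
  · have : D.S t (x + a + b) + z - (D.S t (x + a) + z) - (D.S t (x + b) + z) + (D.S t x + z)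
        = 0 := by
      simp only [map_add]; abel
    rw [this]; simp
  · rw [he2]; exact le_mul_of_one_le_right hρ (one_le_pow₀ he1)
  · rw [he2]; gcongr; exact le_self_pow₀ he1 two_ne_zero
  · rw [he2]; apply le_of_eq; ring

end GaussianSmoothing

end FPData

section Yosida

variable {H : Type} [NormedAddCommGroup H] [InnerProductSpace ℝ H]

/-- `Γ` is (the graph of) an `m`-dissipative operator up to the shift `K`, with `0 ∈ Γ 0`. -/
structure MDissipative (K : ℝ) (Γ : H → Set H) : Prop where
  pos : 0 < K
  diss : ∀ x y u v : H, u ∈ Γ x → v ∈ Γ y → ⟪u - v, x - y⟫_ℝ ≤ K * ‖x - y‖ ^ 2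
  mrange : ∀ lam : ℝ, K < lam → ∀ z : H, ∃ x : H, ∃ w ∈ Γ x, lam • x - w = z
  zero_mem : (0 : H) ∈ Γ 0

namespace MDissipative

variable {K : ℝ} {Γ : H → Set H}

lemma exists_yosida (hΓ : MDissipative K Γ) {α : ℝ} (hα : 0 < α) (hαK : α * K ≤ 1 / 4) (x : H) :
    ∃ w, w ∈ Γ (x + α • w) := by
  have hlt : K < α⁻¹ := by
    rw [lt_inv_comm₀ hΓ.pos hα, ← one_div, lt_div_iff₀ hΓ.pos]; linarith
  obtain ⟨z, w, hw, h⟩ := hΓ.mrange α⁻¹ hlt (α⁻¹ • x)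
  refine ⟨w, ?_⟩
  have : x + α • w = z := by
    have h2 : α⁻¹ • z = α⁻¹ • x + w := by rw [← h]; abel
    have h3 := congrArg (fun y => α • y) h2
    simpa [smul_smul, hα.ne', smul_add] using h3.symm
  rwa [this]

/-- The Yosida approximation `x ↦ w` with `w ∈ Γ (x + α w)`. -/
noncomputable def yosida (Γ : H → Set H) (α : ℝ) (x : H) : H :=
  if h : ∃ w, w ∈ Γ (x + α • w) then h.choose else 0

lemma yosida_mem (hΓ : MDissipative K Γ) {α : ℝ} (hα : 0 < α) (hαK : α * K ≤ 1 / 4) (x : H) :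
    yosida Γ α x ∈ Γ (x + α • yosida Γ α x) := by
  have h := hΓ.exists_yosida hα hαK x
  rw [yosida, dif_pos h]
  exact h.choose_spec

lemma yosida_key (hΓ : MDissipative K Γ) {α : ℝ} (hα : 0 < α) (hαK : α * K ≤ 1 / 4) (x y : H) :
    (1 - 2 * (α * K)) * ⟪yosida Γ α x - yosida Γ α y, x - y⟫_ℝ +
      α * (1 - α * K) * ‖yosida Γ α x - yosida Γ α y‖ ^ 2 ≤ K * ‖x - y‖ ^ 2 := by
  have h := hΓ.diss _ _ _ _ (hΓ.yosida_mem hα hαK x) (hΓ.yosida_mem hα hαK y)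
  set d := yosida Γ α x - yosida Γ α y with hd
  have e1 : x + α • yosida Γ α x - (y + α • yosida Γ α y) = (x - y) + α • d := by
    rw [hd, smul_sub]; abel
  rw [e1, norm_add_sq_real, inner_add_right, inner_smul_right, inner_smul_right,
    real_inner_self_eq_norm_sq, norm_smul, Real.norm_of_nonneg hα.le, real_inner_comm d] at h
  nlinarith

lemma yosida_diss (hΓ : MDissipative K Γ) {α : ℝ} (hα : 0 < α) (hαK : α * K ≤ 1 / 4) (x y : H) :
    ⟪yosida Γ α x - yosida Γ α y, x - y⟫_ℝ ≤ 2 * K * ‖x - y‖ ^ 2 := by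
  have h := hΓ.yosida_key hα hαK x y
  have hK := hΓ.pos
  have h1 : 0 ≤ α * (1 - α * K) * ‖yosida Γ α x - yosida Γ α y‖ ^ 2 := by
    have : 0 ≤ 1 - α * K := by linarith
    positivity
  have h2 : 0 ≤ K * ‖x - y‖ ^ 2 := by positivity
  have h3 : 0 < α * K := by positivity
  by_contra! hc
  nlinarith

lemma yosida_lip (hΓ : MDissipative K Γ) {α : ℝ} (hα : 0 < α) (hαK : α * K ≤ 1 / 4) (x y : H) :
    ‖yosida Γ α x - yosida Γ α y‖ ≤ 2 / α * ‖x - y‖ := by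
  have h := hΓ.yosida_key hα hαK x y
  set d := yosida Γ α x - yosida Γ α y
  have hK := hΓ.pos
  have h1 : -(‖d‖ * ‖x - y‖) ≤ ⟪d, x - y⟫_ℝ := (abs_le.1 (abs_real_inner_le_norm _ _)).1
  have h3 : 0 < α * K := by positivity
  set s := α * ‖d‖ with hs
  set r := ‖x - y‖
  have hs0 : 0 ≤ s := by positivity
  have hr0 : 0 ≤ r := norm_nonneg _
  have h4 : (1 - 2 * (α * K)) * (-(s * r)) + (1 - α * K) * s ^ 2 ≤ (α * K) * r ^ 2 := by
    have h5 : (1 - 2 * (α * K)) * (-(‖d‖ * r)) ≤ (1 - 2 * (α * K)) * ⟪d, x - y⟫_ℝ :=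
      mul_le_mul_of_nonneg_left h1 (by linarith)
    have h6 := mul_le_mul_of_nonneg_left (a := α) (add_le_add_left h5 (α * (1 - α * K) * ‖d‖ ^ 2)) hα.le
    have h7 := mul_le_mul_of_nonneg_left h hα.le
    have h8 := h6.trans h7
    rw [hs]
    nlinarith
  have h5 : s ≤ 2 * r := by
    by_contra! hc
    nlinarith [mul_nonneg hs0 hr0, mul_nonneg hr0 hr0, mul_nonneg hs0 hs0,
      mul_nonneg h3.le (mul_nonneg hs0 hr0), mul_nonneg h3.le (mul_nonneg hs0 hs0),
      mul_nonneg h3.le (mul_nonneg hr0 hr0)]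
  rw [div_mul_eq_mul_div, le_div_iff₀ hα]
  linarith

lemma yosida_inner (hΓ : MDissipative K Γ) {α : ℝ} (hα : 0 < α) (hαK : α * K ≤ 1 / 4) {x v : H}
    (hv : v ∈ Γ x) : (1 - α * K) * ‖yosida Γ α x‖ ^ 2 ≤ ⟪v, yosida Γ α x⟫_ℝ := by
  have h := hΓ.diss _ _ _ _ (hΓ.yosida_mem hα hαK x) hv
  rw [add_sub_cancel_left, inner_smul_right, inner_sub_left, real_inner_self_eq_norm_sq,
    norm_smul, Real.norm_of_nonneg hα.le] at h
  have h2 : α * ((1 - α * K) * ‖yosida Γ α x‖ ^ 2) ≤ α * ⟪v, yosida Γ α x⟫_ℝ := by nlinarith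
  exact le_of_mul_le_mul_left h2 hα

lemma norm_yosida_le (hΓ : MDissipative K Γ) {α : ℝ} (hα : 0 < α) (hαK : α * K ≤ 1 / 4) {x v : H}
    (hv : v ∈ Γ x) : ‖yosida Γ α x‖ ≤ 4 / 3 * ‖v‖ := by
  have h := hΓ.yosida_inner hα hαK hv
  have h1 := real_inner_le_norm v (yosida Γ α x)
  by_contra! hc
  have h2 : 0 < ‖yosida Γ α x‖ := lt_of_le_of_lt (by positivity) hc
  nlinarith [norm_nonneg v]

lemma yosida_zero (hΓ : MDissipative K Γ) {α : ℝ} (hα : 0 < α) (hαK : α * K ≤ 1 / 4) :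
    yosida Γ α 0 = 0 := by
  have := hΓ.norm_yosida_le hα hαK hΓ.zero_mem
  simpa using this

lemma norm_yosida_sub_sq_le (hΓ : MDissipative K Γ) {α β : ℝ} (hα : 0 < α) (hαK : α * K ≤ 1 / 4)
    (hβ : 0 < β) (hβK : β * K ≤ 1 / 4) {x v : H} (hv : v ∈ Γ x) :
    ‖yosida Γ α x - yosida Γ β x‖ ^ 2 ≤
      |‖yosida Γ α x‖ ^ 2 - ‖yosida Γ β x‖ ^ 2| + 2 * K * (α + β) * (4 / 3 * ‖v‖) ^ 2 := by
  have h := hΓ.diss _ _ _ _ (hΓ.yosida_mem hα hαK x) (hΓ.yosida_mem hβ hβK x)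
  have ha := hΓ.norm_yosida_le hα hαK hv
  have hb := hΓ.norm_yosida_le hβ hβK hv
  set a := yosida Γ α x
  set b := yosida Γ β x
  set C := 4 / 3 * ‖v‖
  have hK := hΓ.pos
  have e1 : x + α • a - (x + β • b) = α • a - β • b := by abel
  have e2 : ‖α • a - β • b‖ ≤ (α + β) * C := by
    calc _ ≤ ‖α • a‖ + ‖β • b‖ := norm_sub_le _ _
      _ = α * ‖a‖ + β * ‖b‖ := by
        rw [norm_smul, norm_smul, Real.norm_of_nonneg hα.le, Real.norm_of_nonneg hβ.le]
      _ ≤ α * C + β * C := by gcongr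
      _ = _ := by ring
  have e3 : ⟪a - b, α • a - β • b⟫_ℝ =
      (α + β) / 2 * ‖a - b‖ ^ 2 + (α - β) / 2 * (‖a‖ ^ 2 - ‖b‖ ^ 2) := by
    rw [norm_sub_sq_real, inner_sub_left, inner_sub_right, inner_sub_right, inner_smul_right,
      inner_smul_right, inner_smul_right, inner_smul_right, real_inner_self_eq_norm_sq,
      real_inner_self_eq_norm_sq, real_inner_comm a b]
    ring
  rw [e1, e3] at h
  have e4 : K * ‖α • a - β • b‖ ^ 2 ≤ K * ((α + β) * C) ^ 2 := by gcongr
  have e5 : -((α + β) * |‖a‖ ^ 2 - ‖b‖ ^ 2|) ≤ (α - β) * (‖a‖ ^ 2 - ‖b‖ ^ 2) := by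
    have h1 : |α - β| ≤ α + β := by rw [abs_le]; constructor <;> linarith
    have h2 := neg_abs_le ((α - β) * (‖a‖ ^ 2 - ‖b‖ ^ 2))
    rw [abs_mul] at h2
    have h3 := mul_le_mul_of_nonneg_right h1 (abs_nonneg (‖a‖ ^ 2 - ‖b‖ ^ 2))
    linarith
  have e6 : (α + β) * ‖a - b‖ ^ 2 ≤
      (α + β) * (|‖a‖ ^ 2 - ‖b‖ ^ 2| + 2 * K * (α + β) * C ^ 2) := by nlinarith
  exact le_of_mul_le_mul_left e6 (by positivity)

lemma mem_of_tendsto (hΓ : MDissipative K Γ) {y w : ℕ → H} {x v : H} (hy : Tendsto y atTop (𝓝 x))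
    (hw : Tendsto w atTop (𝓝 v)) (h : ∀ᶠ n in atTop, w n ∈ Γ (y n)) : v ∈ Γ x := by
  obtain ⟨x', w', hw', hx'⟩ := hΓ.mrange (K + 1) (by linarith) ((K + 1) • x - v)
  have h1 : ⟪v - w', x - x'⟫_ℝ ≤ K * ‖x - x'‖ ^ 2 :=
    le_of_tendsto_of_tendsto ((hw.sub_const w').inner (hy.sub_const x'))
      (((hy.sub_const x').norm.pow 2).const_mul K)
      (h.mono fun n hn => hΓ.diss _ _ _ _ hn hw')
  have h2 : v - w' = (K + 1) • (x - x') := by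
    rw [smul_sub]
    have := congrArg (fun z => v + z) hx'
    simp only [add_sub_cancel] at this
    rw [← this]; abel
  rw [h2, inner_smul_left, real_inner_self_eq_norm_sq] at h1
  have h3 : ‖x - x'‖ ^ 2 ≤ 0 := by simp at h1; linarith
  have h4 : x - x' = 0 := by
    have := pow_eq_zero_iff (two_ne_zero) |>.1 (le_antisymm h3 (sq_nonneg _))
    simpa using this
  rw [h4, smul_zero] at h2
  rw [sub_eq_zero.1 h2, sub_eq_zero.1 h4]
  exact hw'

lemma tendsto_yosida [CompleteSpace H] (hΓ : MDissipative K Γ) {α : ℕ → ℝ} (hα : ∀ n, 0 < α n)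
    (hαK : ∀ n, α n * K ≤ 1 / 4) (hlim : Tendsto α atTop (𝓝 0)) {x v : H} (hv : v ∈ Γ x)
    (hmin : ∀ w ∈ Γ x, ‖v‖ ≤ ‖w‖) : Tendsto (fun n => yosida Γ (α n) x) atTop (𝓝 v) := by
  refine tendsto_of_subseq_tendsto fun ns hns => ?_
  have hbd : ∀ n, ‖yosida Γ (α (ns n)) x‖ ^ 2 ∈ Icc (0:ℝ) ((4 / 3 * ‖v‖) ^ 2) := fun n =>
    ⟨by positivity, by
      have := hΓ.norm_yosida_le (hα (ns n)) (hαK _) hv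
      gcongr⟩
  obtain ⟨c, -, ms, hms, hc⟩ := isCompact_Icc.tendsto_subseq hbd
  refine ⟨ms, ?_⟩
  have hα' : Tendsto (fun n => α (ns (ms n))) atTop (𝓝 0) :=
    hlim.comp (hns.comp hms.tendsto_atTop)
  have hcau : CauchySeq fun n => yosida Γ (α (ns (ms n))) x := by
    rw [cauchySeq_iff_tendsto_dist_atTop_0]
    have h1 : Tendsto (fun p : ℕ × ℕ =>
        |‖yosida Γ (α (ns (ms p.1))) x‖ ^ 2 - ‖yosida Γ (α (ns (ms p.2))) x‖ ^ 2| +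
        2 * K * (α (ns (ms p.1)) + α (ns (ms p.2))) * (4 / 3 * ‖v‖) ^ 2) atTop (𝓝 0) := by
      rw [← prod_atTop_atTop_eq]
      have t1 : Tendsto (Prod.fst : ℕ × ℕ → ℕ) (atTop ×ˢ atTop) atTop := tendsto_fst
      have t2 : Tendsto (Prod.snd : ℕ × ℕ → ℕ) (atTop ×ˢ atTop) atTop := tendsto_snd
      have h2 := ((hc.comp t1).sub (hc.comp t2)).abs
      have h3 := (((hα'.comp t1).add (hα'.comp t2)).const_mul (2 * K)).mul_const
        ((4 / 3 * ‖v‖) ^ 2)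
      simpa using h2.add h3
    have h2 := h1.sqrt
    rw [Real.sqrt_zero] at h2
    refine squeeze_zero (fun _ => dist_nonneg) (fun p => ?_) h2
    rw [dist_eq_norm]
    exact Real.le_sqrt_of_sq_le (hΓ.norm_yosida_sub_sq_le (hα _) (hαK _) (hα _) (hαK _) hv)
  obtain ⟨w, hw⟩ := cauchySeq_tendsto_of_complete hcau
  have hwmem : w ∈ Γ x := by
    refine hΓ.mem_of_tendsto (y := fun n => x + α (ns (ms n)) • yosida Γ (α (ns (ms n))) x) ?_ hw
      (Eventually.of_forall fun n => hΓ.yosida_mem (hα _) (hαK _) x)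
    simpa using (hα'.smul hw).const_add x
  have h1 : ‖w‖ ^ 2 ≤ ⟪v, w⟫_ℝ := by
    refine le_of_tendsto_of_tendsto (f := fun n => (1 - α (ns (ms n)) * K) *
      ‖yosida Γ (α (ns (ms n))) x‖ ^ 2) ?_ (tendsto_const_nhds.inner hw)
      (Eventually.of_forall fun n => hΓ.yosida_inner (hα _) (hαK _) hv)
    simpa using ((hα'.mul_const K).const_sub 1).mul (hw.norm.pow 2)
  have h2 := hmin w hwmem
  have h3 : ‖w - v‖ ^ 2 ≤ 0 := by
    rw [norm_sub_sq_real, real_inner_comm]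
    nlinarith [norm_nonneg v]
  have h4 : w = v := by
    have := pow_eq_zero_iff (two_ne_zero) |>.1 (le_antisymm h3 (sq_nonneg _))
    exact sub_eq_zero.1 (by simpa using this)
  rwa [h4] at hw

end MDissipative

end Yosida

section Mollify

/-- Dissipative Lipschitz fields with second differences bounded by `N‖a‖‖b‖`. -/
structure DriftClass {H : Type} [NormedAddCommGroup H] [InnerProductSpace ℝ H]
    (κ L N : ℝ) (G : H → H) : Prop where
  diss : ∀ x y, ⟪G x - G y, x - y⟫_ℝ ≤ κ * ‖x - y‖ ^ 2
  lip : ∀ x y, ‖G x - G y‖ ≤ L * ‖x - y‖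
  second : ∀ x a b, ‖G (x + a + b) - G (x + a) - G (x + b) + G x‖ ≤ N * ‖a‖ * ‖b‖
  zero : ‖G 0‖ ≤ 1

theorem exists_driftClass_near {E : Type} [NormedAddCommGroup E] [InnerProductSpace ℝ E]
    [FiniteDimensional ℝ E] [MeasurableSpace E] [BorelSpace E] {κ L ε : ℝ} {Z : E → E}
    (hdiss : ∀ x y, ⟪Z x - Z y, x - y⟫_ℝ ≤ κ * ‖x - y‖ ^ 2)
    (hlip : ∀ x y, ‖Z x - Z y‖ ≤ L * ‖x - y‖) (hzero : Z 0 = 0) (hL : 0 ≤ L)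
    (hε : 0 < ε) (hLε : L * ε ≤ 1) :
    ∃ g : E → E, ∃ N : ℝ, DriftClass κ L N g ∧ ∀ x, ‖g x - Z x‖ ≤ L * ε := by
  let f : ContDiffBump (0 : E) := ⟨ε / 2, ε, by positivity, by linarith⟩
  let φ : E → ℝ := f.normed volume
  have hφc : Continuous φ := f.continuous_normed
  have hφs : HasCompactSupport φ := f.hasCompactSupport_normed
  have hφ0 : ∀ z, 0 ≤ φ z := fun z => f.nonneg_normed z
  have hφi : Integrable φ := hφc.integrable_of_hasCompactSupport hφs
  have hφ1 : ∫ z, φ z = 1 := f.integral_normed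
  have hφz : ∀ z, ε ≤ ‖z‖ → φ z = 0 := by
    intro z hz
    by_contra h
    have h1 : z ∈ Function.support (f.normed volume) := h
    rw [f.support_normed_eq, mem_ball_zero_iff] at h1
    exact absurd h1 (not_lt.2 hz)
  obtain ⟨C, hC⟩ := (f.contDiff_normed (μ := volume) (n := 1)).lipschitzWith_of_hasCompactSupport
    f.hasCompactSupport_normed one_ne_zero
  have hC' : ∀ x y, |φ x - φ y| ≤ C * ‖x - y‖ := fun x y => by
    have := hC.dist_le_mul x y
    rwa [Real.dist_eq, dist_eq_norm] at this
  have hZc : Continuous Z := (LipschitzWith.of_dist_le_mul (K := ⟨L, hL⟩)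
    fun x y => by rw [dist_eq_norm, dist_eq_norm]; exact hlip x y).continuous
  have hint : ∀ W : E → E, Continuous W → Integrable fun z => φ z • W z := fun W hW =>
    (hφc.smul hW).integrable_of_hasCompactSupport hφs.smul_right
  have hconv : ∀ u : E, Integrable fun z => φ z • Z (u - z) := fun u => hint _ (by fun_prop)
  have hsub : ∀ x y : E, (∫ z, φ z • Z (x - z)) - ∫ z, φ z • Z (y - z) =
      ∫ z, φ z • (Z (x - z) - Z (y - z)) := fun x y => by
    rw [← integral_sub (hconv x) (hconv y)]
    simp only [smul_sub]
  have hmean : ∀ (W : E → E) (c : ℝ), (∀ z, φ z * ‖W z‖ ≤ c * φ z) → ‖∫ z, φ z • W z‖ ≤ c := by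
    intro W c hW
    refine (norm_integral_le_of_norm_le (hφi.const_mul c) (Eventually.of_forall fun z => ?_)).trans ?_
    · rw [norm_smul, Real.norm_of_nonneg (hφ0 z)]; exact hW z
    · rw [integral_const_mul, hφ1, mul_one]
  have hnear : ∀ x, ‖(∫ z, φ z • Z (x - z)) - Z x‖ ≤ L * ε := by
    intro x
    have : Z x = ∫ z, φ z • Z x := by rw [integral_smul_const, hφ1, one_smul]
    rw [this, ← integral_sub (hconv x) (hint _ continuous_const)]
    simp only [← smul_sub]
    refine hmean _ _ fun z => ?_
    by_cases hz : ε ≤ ‖z‖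
    · simp [hφz z hz]
    · rw [mul_comm]
      refine mul_le_mul_of_nonneg_right ((hlip _ _).trans ?_) (hφ0 z)
      rw [sub_sub_cancel_left, norm_neg]
      exact mul_le_mul_of_nonneg_left (not_le.1 hz).le hL
  refine ⟨fun x => ∫ z, φ z • Z (x - z),
    L * (C * (2 * (volume (Metric.ball (0 : E) ε)).toReal)), ⟨fun x y => ?_, fun x y => ?_,
      fun x a b => ?_, ?_⟩, hnear⟩
  · have hi : Integrable fun z => φ z • (Z (x - z) - Z (y - z)) := hint _ (by fun_prop)
    rw [hsub, real_inner_comm, ← integral_inner hi]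
    refine (integral_mono (hi.const_inner _) (hφi.const_mul (κ * ‖x - y‖ ^ 2)) fun z => ?_).trans_eq
      (by rw [integral_const_mul, hφ1, mul_one])
    simp only [inner_smul_right]
    rw [mul_comm, real_inner_comm]
    have := hdiss (x - z) (y - z)
    rw [sub_sub_sub_cancel_right] at this
    exact mul_le_mul_of_nonneg_right this (hφ0 z)
  · rw [hsub]
    refine hmean _ _ fun z => ?_
    rw [mul_comm]
    refine mul_le_mul_of_nonneg_right ((hlip _ _).trans_eq ?_) (hφ0 z)
    rw [sub_sub_sub_cancel_right]
  · have e1 : ∀ u, (∫ z, φ z • Z (u + a - z)) - ∫ z, φ z • Z (u - z) =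
        ∫ w, φ (u - w) • (Z (w + a) - Z w) := by
      intro u
      rw [hsub, ← integral_sub_left_eq_self _ volume u]
      refine integral_congr_ae (Eventually.of_forall fun w => ?_)
      simp only [sub_sub_cancel]
      rw [show u + a - (u - w) = w + a by abel]
    have hi : ∀ u, Integrable fun w => φ (u - w) • (Z (w + a) - Z w) := by
      intro u
      have := (hint (fun z => Z (u - z + a) - Z (u - z)) (by fun_prop)).comp_sub_left u
      simpa only [sub_sub_cancel] using this
    have e2 : (∫ z, φ z • Z (x + a + b - z)) - (∫ z, φ z • Z (x + a - z)) -
        (∫ z, φ z • Z (x + b - z)) + ∫ z, φ z • Z (x - z) =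
        ∫ w, (φ (x + b - w) - φ (x - w)) • (Z (w + a) - Z w) := by
      simp only [sub_smul]
      rw [integral_sub (hi _) (hi _), ← e1, ← e1, add_right_comm x a b]
      abel
    rw [e2]
    let I : E → ℝ := (Metric.ball (0 : E) ε).indicator fun _ => 1
    have hI : Integrable I := (integrableOn_const
      (measure_ball_lt_top).ne).integrable_indicator measurableSet_ball
    have hI1 : ∫ w, I w = (volume (Metric.ball (0 : E) ε)).toReal := by
      rw [integral_indicator measurableSet_ball, setIntegral_const]
      simp [Measure.real]
    have hIz : ∀ z, I z = 0 → φ z = 0 := by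
      intro z hz
      refine hφz z ?_
      by_contra h
      have : z ∈ Metric.ball (0 : E) ε := by rw [mem_ball_zero_iff]; exact not_le.1 h
      simp [I, indicator_of_mem this] at hz
    have hI0 : ∀ z, 0 ≤ I z := fun z => indicator_nonneg (fun _ _ => zero_le_one) z
    have hIone : ∀ z, I z ≠ 0 → I z = 1 := fun z hz => by
      by_cases h : z ∈ Metric.ball (0 : E) ε
      · simp [I, indicator_of_mem h]
      · simp [I, indicator_of_notMem h] at hz
    have hpt : ∀ w, |φ (x + b - w) - φ (x - w)| ≤
        C * ‖b‖ * (I (x + b - w) + I (x - w)) := by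
      intro w
      have h1 := hC' (x + b - w) (x - w)
      rw [show x + b - w - (x - w) = b by abel] at h1
      have h2 : (0:ℝ) ≤ C * ‖b‖ := by positivity
      by_cases ha : I (x + b - w) = 0
      · by_cases hb : I (x - w) = 0
        · rw [hIz _ ha, hIz _ hb, ha, hb]; simp
        · rw [hIone _ hb]
          nlinarith [hI0 (x + b - w)]
      · rw [hIone _ ha]
        nlinarith [hI0 (x - w)]
    have hi2 : Integrable fun w => I (x + b - w) + I (x - w) :=
      (hI.comp_sub_left _).add (hI.comp_sub_left _)
    refine (norm_integral_le_of_norm_le (hi2.const_mul (L * ‖a‖ * (C * ‖b‖)))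
      (Eventually.of_forall fun w => ?_)).trans_eq ?_
    · rw [norm_smul, Real.norm_eq_abs]
      have h1 := hlip (w + a) w
      rw [add_sub_cancel_left] at h1
      calc _ ≤ (C * ‖b‖ * (I (x + b - w) + I (x - w))) * (L * ‖a‖) :=
            mul_le_mul (hpt w) h1 (norm_nonneg _) (by
              have := hI0 (x + b - w); have := hI0 (x - w); positivity)
        _ = _ := by ring
    · rw [integral_const_mul, integral_add (hI.comp_sub_left _) (hI.comp_sub_left _),
        integral_sub_left_eq_self, integral_sub_left_eq_self, hI1]
      ring
  · have := hnear 0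
    rw [hzero, sub_zero] at this
    exact this.trans hLε


variable {H : Type} [NormedAddCommGroup H] [InnerProductSpace ℝ H]

lemma DriftClass.mono {κ L N L' N' : ℝ} {G : H → H} (hG : DriftClass κ L N G) (h1 : L ≤ L')
    (h2 : N ≤ N') : DriftClass κ L' N' G where
  diss := hG.diss
  lip x y := (hG.lip x y).trans (mul_le_mul_of_nonneg_right h1 (norm_nonneg _))
  second x a b := (hG.second x a b).trans (by gcongr)
  zero := hG.zero

theorem exists_driftClass_near_starProjection [MeasurableSpace H] [BorelSpace H]
    {κ L ε : ℝ} {Y : H → H} (U : Submodule ℝ H) [FiniteDimensional ℝ U]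
    (hdiss : ∀ x y, ⟪Y x - Y y, x - y⟫_ℝ ≤ κ * ‖x - y‖ ^ 2)
    (hlip : ∀ x y, ‖Y x - Y y‖ ≤ L * ‖x - y‖) (hzero : Y 0 = 0) (hκ : 0 ≤ κ) (hL : 0 ≤ L)
    (hε : 0 < ε) (hLε : L * ε ≤ 1) :
    ∃ G : H → H, ∃ N : ℝ, DriftClass κ L N G ∧
      ∀ x, ‖G x - U.starProjection (Y (U.starProjection x))‖ ≤ L * ε := by
  set π := U.orthogonalProjectionOnto with hπ
  have hπ1 : ∀ x, ‖π x‖ ≤ ‖x‖ := fun x => U.norm_orthogonalProjectionOnto_apply_le x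
  obtain ⟨g, N, hg, hnear⟩ := exists_driftClass_near (E := U) (κ := κ) (L := L) (ε := ε)
    (Z := fun u => π (Y u))
    (fun x y => by
      rw [← map_sub, hπ, U.inner_orthogonalProjectionOnto_eq_of_mem_right]
      exact hdiss x y)
    (fun x y => by
      rw [← map_sub]
      exact (hπ1 _).trans (hlip x y))
    (by simp [hzero]) hL hε hLε
  refine ⟨fun x => (g (π x) : H), |N|, ⟨fun x y => ?_, fun x y => ?_, fun x a b => ?_, ?_⟩,
    fun x => ?_⟩
  · rw [← Submodule.coe_sub, ← U.inner_orthogonalProjectionOnto_eq_of_mem_left, map_sub]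
    refine (hg.diss _ _).trans ?_
    rw [← map_sub]
    have := hπ1 (x - y)
    gcongr
  · rw [← Submodule.coe_sub]
    refine (hg.lip _ _).trans ?_
    rw [← map_sub]
    have := hπ1 (x - y)
    gcongr
  · have := hg.second (π x) (π a) (π b)
    simp only [map_add]
    rw [← Submodule.coe_sub, ← Submodule.coe_sub, ← Submodule.coe_add]
    refine this.trans ?_
    have h1 := hπ1 a
    have h2 := hπ1 b
    have h3 := le_abs_self N
    gcongr
  · rw [map_zero]
    exact hg.zero
  · rw [Submodule.starProjection_apply, Submodule.starProjection_apply, ← Submodule.coe_sub]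
    exact hnear _

end Mollify

section DriftApprox

variable {H : Type} [NormedAddCommGroup H] [InnerProductSpace ℝ H] [CompleteSpace H]
  [SecondCountableTopology H] [MeasurableSpace H] [BorelSpace H]

lemma continuous_of_lip {L : ℝ} {Y : H → H} (hL : 0 ≤ L)
    (hlip : ∀ x y, ‖Y x - Y y‖ ≤ L * ‖x - y‖) : Continuous Y :=
  (LipschitzWith.of_dist_le_mul (K := ⟨L, hL⟩)
    fun x y => by rw [dist_eq_norm, dist_eq_norm]; exact hlip x y).continuous

theorem MDissipative.exists_driftClass_integral_lt {K : ℝ} {Γ : H → Set H}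
    (hΓ : MDissipative K Γ) {m : Measure H} [IsFiniteMeasure m] {F₀ : H → H}
    (hF : ∀ᵐ x ∂m, F₀ x ∈ Γ x ∧ ∀ w ∈ Γ x, ‖F₀ x‖ ≤ ‖w‖) (hFi : Integrable F₀ m)
    (hi : Integrable (fun x : H => x) m) {ε : ℝ} (hε : 0 < ε) :
    ∃ L N : ℕ, ∃ G : H → H, DriftClass (2 * K) L N G ∧ Integrable G m ∧
      ∫ x, ‖F₀ x - G x‖ ∂m < ε := by
  have hK := hΓ.pos
  let α : ℕ → ℝ := fun n => 1 / (4 * K * ((n : ℝ) + 1))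
  have hα : ∀ n, 0 < α n := fun n => by positivity
  have hαK : ∀ n, α n * K ≤ 1 / 4 := fun n => by
    have : α n * K = 1 / 4 * (1 / ((n : ℝ) + 1)) := by simp only [α]; field_simp
    rw [this]
    have : 1 / ((n : ℝ) + 1) ≤ 1 := by
      rw [div_le_one (by positivity)]; linarith [(Nat.cast_nonneg n : (0:ℝ) ≤ n)]
    linarith
  have hlim : Tendsto α atTop (𝓝 0) :=
    tendsto_const_nhds.div_atTop
      ((tendsto_natCast_atTop_atTop.atTop_add tendsto_const_nhds).const_mul_atTop (by positivity))
  have hYc : ∀ n, Continuous (yosida Γ (α n)) := fun n =>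
    continuous_of_lip (by have := hα n; positivity) (hΓ.yosida_lip (hα n) (hαK n))
  have h1 : Tendsto (fun n => ∫ x, ‖F₀ x - yosida Γ (α n) x‖ ∂m) atTop (𝓝 (∫ _, (0:ℝ) ∂m)) := by
    refine tendsto_integral_of_dominated_convergence (fun x => 7 / 3 * ‖F₀ x‖) (fun n => ?_)
      (hFi.norm.const_mul _) (fun n => ?_) ?_
    · exact (hFi.aestronglyMeasurable.sub (hYc n).aestronglyMeasurable).norm
    · filter_upwards [hF] with x hx
      rw [norm_norm]
      have := hΓ.norm_yosida_le (hα n) (hαK n) hx.1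
      linarith [norm_sub_le (F₀ x) (yosida Γ (α n) x)]
    · filter_upwards [hF] with x hx
      simpa using ((hΓ.tendsto_yosida hα hαK hlim hx.1 hx.2).const_sub (F₀ x)).norm
  rw [integral_zero] at h1
  obtain ⟨n, hn⟩ := (h1.eventually_lt_const (show 0 < ε / 3 by positivity)).exists
  set Y := yosida Γ (α n) with hY
  obtain ⟨L₀, hL₀⟩ := exists_nat_ge (2 / α n)
  have hL₀0 : (0:ℝ) ≤ L₀ := Nat.cast_nonneg _
  have hlip : ∀ x y, ‖Y x - Y y‖ ≤ L₀ * ‖x - y‖ := fun x y =>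
    (hΓ.yosida_lip (hα n) (hαK n) x y).trans (by gcongr)
  have hY0 : Y 0 = 0 := hΓ.yosida_zero (hα n) (hαK n)
  have hYn : ∀ x, ‖Y x‖ ≤ L₀ * ‖x‖ := fun x => by simpa [hY0] using hlip x 0
  have hYi : Integrable Y m := (hi.norm.const_mul (L₀ : ℝ)).mono' (hYc n).aestronglyMeasurable
    (Eventually.of_forall hYn)
  obtain ⟨U, -, hfin, hU⟩ := exists_tendsto_starProjection (H := H) (V := ⊤)
    (by simp)
  have hPn : ∀ k x, ‖(U k).starProjection x‖ ≤ ‖x‖ := fun k x => by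
    rw [Submodule.starProjection_apply]
    exact (U k).norm_orthogonalProjectionOnto_apply_le x
  have hPYc : ∀ k, Continuous fun x => (U k).starProjection (Y ((U k).starProjection x)) :=
    fun k => (U k).starProjection.continuous.comp ((hYc n).comp (U k).starProjection.continuous)
  have hPYn : ∀ k x, ‖(U k).starProjection (Y ((U k).starProjection x))‖ ≤ L₀ * ‖x‖ := fun k x =>
    (hPn k _).trans ((hYn _).trans (by have := hPn k x; gcongr))
  have h2 : Tendsto (fun k => ∫ x, ‖Y x - (U k).starProjection (Y ((U k).starProjection x))‖ ∂m)
      atTop (𝓝 (∫ _, (0:ℝ) ∂m)) := by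
    refine tendsto_integral_of_dominated_convergence (fun x => 2 * L₀ * ‖x‖) (fun k => ?_)
      (hi.norm.const_mul _) (fun k => Eventually.of_forall fun x => ?_)
      (Eventually.of_forall fun x => ?_)
    · exact ((hYc n).sub (hPYc k)).norm.aestronglyMeasurable
    · rw [norm_norm]
      linarith [norm_sub_le (Y x) ((U k).starProjection (Y ((U k).starProjection x))), hYn x,
        hPYn k x]
    · have h3 : Tendsto (fun k => (U k).starProjection (Y ((U k).starProjection x))) atTop
          (𝓝 (Y x)) := by
        rw [tendsto_iff_norm_sub_tendsto_zero]
        have h4 := (((hU x).sub_const x).norm.const_mul (L₀ : ℝ)).add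
          ((hU (Y x)).sub_const (Y x)).norm
        simp only [sub_self, norm_zero, mul_zero, add_zero] at h4
        refine squeeze_zero (fun _ => norm_nonneg _) (fun k => ?_) h4
        calc _ = ‖(U k).starProjection (Y ((U k).starProjection x) - Y x) +
              ((U k).starProjection (Y x) - Y x)‖ := by rw [map_sub]; abel_nf
          _ ≤ _ := (norm_add_le _ _).trans (add_le_add ((hPn k _).trans (hlip _ _)) le_rfl)
      simpa using (h3.const_sub (Y x)).norm
  rw [integral_zero] at h2
  obtain ⟨k, hk⟩ := (h2.eventually_lt_const (show 0 < ε / 3 by positivity)).exists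
  have hr : ∃ r : ℝ, 0 < r ∧ L₀ * r ≤ 1 ∧ L₀ * r * m.real univ < ε / 3 := by
    refine ⟨min (1 / (L₀ + 1)) (ε / 6 / ((L₀ + 1) * (m.real univ + 1))), by positivity, ?_, ?_⟩
    · calc (L₀ : ℝ) * _ ≤ (L₀ + 1) * (1 / (L₀ + 1)) := by gcongr; linarith; exact min_le_left _ _
        _ = 1 := by field_simp
    · calc (L₀ : ℝ) * _ * m.real univ ≤
          (L₀ + 1) * (ε / 6 / ((L₀ + 1) * (m.real univ + 1))) * (m.real univ + 1) := by
            gcongr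
            · linarith
            · exact min_le_right _ _
            · linarith
        _ = ε / 6 := by have : 0 ≤ m.real univ := measureReal_nonneg
                        field_simp
        _ < ε / 3 := by linarith
  obtain ⟨r, hr0, hr1, hr2⟩ := hr
  obtain ⟨G, N, hG, hGn⟩ := exists_driftClass_near_starProjection (U k)
    (hΓ.yosida_diss (hα n) (hαK n)) hlip hY0 (by positivity) hL₀0 hr0 hr1
  obtain ⟨N', hN'⟩ := exists_nat_ge N
  have hGc : Continuous G := continuous_of_lip hL₀0 hG.lip
  have hGi : Integrable G m := by
    refine ((integrable_const (L₀ * r)).add (hi.norm.const_mul (L₀ : ℝ))).mono'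
      hGc.aestronglyMeasurable (Eventually.of_forall fun x => ?_)
    have := norm_add_le (G x - (U k).starProjection (Y ((U k).starProjection x)))
      ((U k).starProjection (Y ((U k).starProjection x)))
    rw [sub_add_cancel] at this
    exact this.trans (add_le_add (hGn x) (hPYn k x))
  refine ⟨L₀, N', G, hG.mono le_rfl hN', hGi, ?_⟩
  have hPYi : Integrable (fun x => (U k).starProjection (Y ((U k).starProjection x))) m :=
    (hi.norm.const_mul (L₀ : ℝ)).mono' (hPYc k).aestronglyMeasurable
      (Eventually.of_forall (hPYn k))
  calc ∫ x, ‖F₀ x - G x‖ ∂m ≤ ∫ x, (‖F₀ x - Y x‖ +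
        ‖Y x - (U k).starProjection (Y ((U k).starProjection x))‖ + L₀ * r) ∂m := by
        refine integral_mono (hFi.sub hGi).norm (((hFi.sub hYi).norm.add
          (hYi.sub hPYi).norm).add (integrable_const _)) fun x => ?_
        have h3 := hGn x
        rw [norm_sub_rev] at h3
        refine le_trans ?_ (add_le_add le_rfl h3)
        exact (norm_sub_le_norm_sub_add_norm_sub _ _ _).trans
          (add_le_add (norm_sub_le_norm_sub_add_norm_sub _ _ _) le_rfl)
    _ = ∫ x, ‖F₀ x - Y x‖ ∂m +
        ∫ x, ‖Y x - (U k).starProjection (Y ((U k).starProjection x))‖ ∂m +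
        L₀ * r * m.real univ := by
        have e1 := (hFi.sub hYi).norm
        have e2 := (hYi.sub hPYi).norm
        simp only [Pi.sub_apply] at e1 e2
        have e3 : Integrable (fun a => ‖F₀ a - Y a‖ +
            ‖Y a - (U k).starProjection (Y ((U k).starProjection a))‖) m := e1.add e2
        rw [integral_add e3 (integrable_const _),
          integral_add e1 e2, integral_const, smul_eq_mul, mul_comm (m.real univ)]
    _ < ε := by linarith

end DriftApprox

section DriftSeparable

variable {H : Type} [NormedAddCommGroup H] [InnerProductSpace ℝ H] [CompleteSpace H]
  [SecondCountableTopology H]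

lemma DriftClass.zero_field {κ L N : ℝ} (hκ : 0 ≤ κ) (hL : 0 ≤ L) (hN : 0 ≤ N) :
    DriftClass κ L N (fun _ : H => (0 : H)) where
  diss x y := by simp; positivity
  lip x y := by simp; positivity
  second x a b := by simp; positivity
  zero := by simp

lemma DriftClass.norm_le {κ L N : ℝ} {G : H → H} (hG : DriftClass κ L N G) (x : H) :
    ‖G x‖ ≤ 1 + L * ‖x‖ := by
  have h1 := hG.lip x 0
  have h2 := norm_sub_norm_le (G x) (G 0)
  have h3 := hG.zero
  rw [sub_zero] at h1
  linarith

theorem exists_seq_dense_driftClass {κ L N : ℝ} (hκ : 0 ≤ κ) (hL : 0 ≤ L) (hN : 0 ≤ N) :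
    ∃ G : ℕ → H → H, (∀ j, DriftClass κ L N (G j)) ∧ ∀ g, DriftClass κ L N g →
      ∃ φ : ℕ → ℕ, ∀ x, Tendsto (fun k => G (φ k) x) atTop (𝓝 (g x)) := by
  let d := TopologicalSpace.denseSeq H
  let S : Set (ℕ → H) := {v | ∃ g, DriftClass κ L N g ∧ ∀ n, v n = g (d n)}
  have : Nonempty S := ⟨⟨fun _ => 0, fun _ => 0, DriftClass.zero_field hκ hL hN, fun _ => rfl⟩⟩
  choose! G hG hGd using fun j : ℕ => (TopologicalSpace.denseSeq S j).2
  refine ⟨G, hG, fun g hg => ?_⟩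
  let w : S := ⟨fun n => g (d n), g, hg, fun _ => rfl⟩
  have hw : w ∈ closure (range (TopologicalSpace.denseSeq S)) :=
    TopologicalSpace.denseRange_denseSeq S w
  obtain ⟨y, hy, hyw⟩ := mem_closure_iff_seq_limit.1 hw
  choose φ hφ using hy
  refine ⟨φ, fun x => ?_⟩
  have h1 : ∀ n, Tendsto (fun k => G (φ k) (d n)) atTop (𝓝 (g (d n))) := by
    intro n
    have h2 := (tendsto_pi_nhds.1 ((continuous_subtype_val.tendsto w).comp hyw)) n
    refine h2.congr fun k => ?_
    rw [Function.comp, ← hφ k, hGd]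
  rw [Metric.tendsto_atTop]
  intro ε hε
  have hx : x ∈ closure (range d) := TopologicalSpace.denseRange_denseSeq H x
  obtain ⟨_, ⟨n, rfl⟩, hn⟩ := Metric.mem_closure_iff.1 hx (ε / (3 * (L + 1))) (by positivity)
  obtain ⟨k₀, hk₀⟩ := Metric.tendsto_atTop.1 (h1 n) (ε / 3) (by positivity)
  refine ⟨k₀, fun k hk => ?_⟩
  have h3 := hk₀ k hk
  have h4 := (hG (φ k)).lip x (d n)
  have h5 := hg.lip x (d n)
  have h6 : L * ‖x - d n‖ ≤ ε / 3 := by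
    rw [← dist_eq_norm]
    calc L * dist x (d n) ≤ (L + 1) * (ε / (3 * (L + 1))) := by gcongr; linarith
      _ = ε / 3 := by field_simp
  rw [dist_eq_norm] at h3 ⊢
  have e : G (φ k) x - g x = (G (φ k) x - G (φ k) (d n)) + (G (φ k) (d n) - g (d n)) -
    (g x - g (d n)) := by abel
  rw [e]
  have h7 := norm_sub_le ((G (φ k) x - G (φ k) (d n)) + (G (φ k) (d n) - g (d n)))
    (g x - g (d n))
  have h8 := norm_add_le (G (φ k) x - G (φ k) (d n)) (G (φ k) (d n) - g (d n))
  linarith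

variable [MeasurableSpace H] [BorelSpace H]

/-- A countable family of fields approximating all minimal sections in `L¹`. -/
theorem exists_seq_driftClass_lintegral_lt {K : ℝ} (hK : 0 < K) :
    ∃ G : ℕ → H → H, (G 0 = fun _ => 0) ∧ (∀ j, ∃ L N : ℕ, DriftClass (2 * K) L N (G j)) ∧
      ∀ (Γ : H → Set H) (m : Measure H) (F₀ : H → H), MDissipative K Γ → IsFiniteMeasure m →
        (∀ᵐ x ∂m, F₀ x ∈ Γ x ∧ ∀ w ∈ Γ x, ‖F₀ x‖ ≤ ‖w‖) → Integrable F₀ m →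
        Integrable (fun x : H => x) m → ∀ ε : ℝ, 0 < ε →
        ∃ j, ∫⁻ x, ‖F₀ x - G j x‖ₑ ∂m < ENNReal.ofReal ε := by
  choose g hg hgd using fun q : ℕ × ℕ => exists_seq_dense_driftClass (H := H) (κ := 2 * K)
    (L := q.1) (N := q.2) (by positivity) (Nat.cast_nonneg _) (Nat.cast_nonneg _)
  let e : ℕ → (ℕ × ℕ) × ℕ := Denumerable.ofNat ((ℕ × ℕ) × ℕ)
  let G : ℕ → H → H := fun j => Nat.casesOn j (fun _ => 0) fun i => g (e i).1 (e i).2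
  refine ⟨G, rfl, fun j => ?_, ?_⟩
  · cases j with
    | zero => exact ⟨0, 0, DriftClass.zero_field (by positivity) (by simp) (by simp)⟩
    | succ i => exact ⟨_, _, hg (e i).1 (e i).2⟩
  · intro Γ m F₀ hΓ hm hF hFi hi ε hε
    obtain ⟨L, N, G', hG', hG'i, hlt⟩ := hΓ.exists_driftClass_integral_lt hF hFi hi hε
    obtain ⟨φ, hφ⟩ := hgd (L, N) G' hG'
    have hcont : ∀ k, Continuous (g (L, N) k) := fun k =>
      continuous_of_lip (Nat.cast_nonneg L) (hg (L, N) k).lip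
    have hbd : ∀ k x, ‖g (L, N) k x‖ ≤ 1 + L * ‖x‖ := fun k x => (hg (L, N) k).norm_le x
    have hbi : Integrable (fun x : H => 1 + (L : ℝ) * ‖x‖) m :=
      (integrable_const _).add (hi.norm.const_mul _)
    have hlim : Tendsto (fun k => ∫ x, ‖F₀ x - g (L, N) (φ k) x‖ ∂m) atTop
        (𝓝 (∫ x, ‖F₀ x - G' x‖ ∂m)) := by
      refine tendsto_integral_of_dominated_convergence (fun x => ‖F₀ x‖ + (1 + L * ‖x‖))
        (fun k => (hFi.aestronglyMeasurable.sub (hcont _).aestronglyMeasurable).norm)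
        (hFi.norm.add hbi) (fun k => Eventually.of_forall fun x => ?_)
        (Eventually.of_forall fun x => ((hφ x).const_sub _).norm)
      rw [norm_norm]
      exact (norm_sub_le _ _).trans (add_le_add le_rfl (hbd _ _))
    obtain ⟨k, hk⟩ := (hlim.eventually_lt_const hlt).exists
    refine ⟨Encodable.encode ((L, N), φ k) + 1, ?_⟩
    have hGe : G (Encodable.encode ((L, N), φ k) + 1) = g (L, N) (φ k) := by
      simp only [G, e, Denumerable.ofNat_encode]
    rw [hGe]
    have hint : Integrable (fun x => F₀ x - g (L, N) (φ k) x) m :=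
      hFi.sub (hbi.mono' (hcont _).aestronglyMeasurable (Eventually.of_forall (hbd _)))
    rw [← ofReal_integral_norm_eq_lintegral_enorm hint]
    exact (ENNReal.ofReal_lt_ofReal_iff hε).2 hk

open ProbabilityTheory in
theorem exists_measurable_driftClass {K : ℝ} (hK : 0 < K) {ν : Measure ℝ} [IsFiniteMeasure ν]
    {m : Kernel ℝ H} [IsFiniteKernel m] {F : ℝ × H → H} {Γ : ℝ → H → Set H}
    (hΓ : ∀ᵐ t ∂ν, MDissipative K (Γ t))
    (hF : ∀ᵐ t ∂ν, ∀ᵐ x ∂(m t), F (t, x) ∈ Γ t x ∧ ∀ w ∈ Γ t x, ‖F (t, x)‖ ≤ ‖w‖)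
    (hFm : Measurable F) (hFi : Integrable F (ν ⊗ₘ m))
    (hi : Integrable (fun p : ℝ × H => p.2) (ν ⊗ₘ m)) {ε : ℝ} (hε : 0 < ε) :
    ∃ L N : ℕ, ∃ G : ℝ × H → H, Measurable G ∧ (∀ t, DriftClass (2 * K) L N fun x => G (t, x)) ∧
      ∫ p, ‖F p - G p‖ ∂(ν ⊗ₘ m) < ε := by
  obtain ⟨G, hG0, hG, happ⟩ := exists_seq_driftClass_lintegral_lt (H := H) hK
  choose L N hLN using hG
  have hGc : ∀ j, Continuous (G j) := fun j =>
    continuous_of_lip (Nat.cast_nonneg _) (hLN j).lip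
  have hr : ∃ δ : ℝ, 0 < δ ∧ δ * ν.real univ < ε / 2 := by
    refine ⟨ε / 4 / (ν.real univ + 1), by positivity, ?_⟩
    calc ε / 4 / (ν.real univ + 1) * ν.real univ ≤
        ε / 4 / (ν.real univ + 1) * (ν.real univ + 1) := by gcongr; linarith
      _ = ε / 4 := by have : 0 ≤ ν.real univ := measureReal_nonneg
                      field_simp
      _ < ε / 2 := by linarith
  obtain ⟨δ, hδ, hδν⟩ := hr
  let c : ℕ → ℝ → ℝ≥0∞ := fun j t => ∫⁻ x, ‖F (t, x) - G j x‖ₑ ∂(m t)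
  have hc : ∀ j, Measurable (c j) := fun j => by
    refine Measurable.lintegral_kernel_prod_right (κ := m)
      (f := fun t x => ‖F (t, x) - G j x‖ₑ) ?_
    exact (hFm.sub ((hGc j).measurable.comp measurable_snd)).enorm
  have hex : ∀ᵐ t ∂ν, ∃ j, c j t < ENNReal.ofReal δ := by
    filter_upwards [hΓ, hF, ((Measure.integrable_compProd_iff hFi.aestronglyMeasurable).1 hFi).1,
      ((Measure.integrable_compProd_iff hi.aestronglyMeasurable).1 hi).1] with t h1 h2 h3 h4
    exact happ _ (m t) (fun x => F (t, x)) h1 inferInstance h2 h3 h4 δ hδ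
  have hp : ∀ t, ∃ k, c k t < ENNReal.ofReal δ ∨ ∀ i, ¬ c i t < ENNReal.ofReal δ := fun t => by
    by_cases h : ∃ k, c k t < ENNReal.ofReal δ
    · obtain ⟨k, hk⟩ := h
      exact ⟨k, Or.inl hk⟩
    · exact ⟨0, Or.inr (not_exists.1 h)⟩
  let j : ℝ → ℕ := fun t => Nat.find (hp t)
  have hjm : Measurable j := by
    have hlt : ∀ k, MeasurableSet {t | c k t < ENNReal.ofReal δ} := fun k =>
      measurableSet_lt (hc k) measurable_const
    have hno : MeasurableSet {t | ∀ i, ¬ c i t < ENNReal.ofReal δ} := by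
      rw [ofPred_forall]
      exact MeasurableSet.iInter fun i => (hlt i).compl
    exact measurable_find hp fun k => (hlt k).union hno
  have hj : ∀ᵐ t ∂ν, c (j t) t < ENNReal.ofReal δ := by
    filter_upwards [hex] with t ⟨k, hk⟩
    exact (Nat.find_spec (hp t)).resolve_right fun h => h k hk
  let J : ℕ → ℝ → ℕ := fun n t => if j t ≤ n then j t else 0
  have hJm : ∀ n, Measurable (J n) := fun n =>
    Measurable.ite (hjm measurableSet_Iic) hjm measurable_const
  have hc0 : ∫⁻ t, c 0 t ∂ν < ⊤ := by
    have := hFi.2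
    rw [HasFiniteIntegral, Measure.lintegral_compProd (by fun_prop)] at this
    simpa [c, hG0] using this
  have hlim : Tendsto (fun n => ∫⁻ t, {t | n < j t}.indicator (c 0) t ∂ν) atTop (𝓝 0) := by
    have := tendsto_lintegral_of_dominated_convergence (μ := ν)
      (F := fun n => {t | n < j t}.indicator (c 0)) (f := fun _ => 0) (c 0)
      (fun n => (hc 0).indicator (hjm measurableSet_Ioi))
      (fun n => Eventually.of_forall fun t => indicator_le_self _ _ _) hc0.ne
      (Eventually.of_forall fun t => ?_)
    · simpa using this
    · refine tendsto_const_nhds.congr' ?_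
      filter_upwards [eventually_ge_atTop (j t)] with n hn
      rw [indicator_of_notMem]
      simpa using hn
  obtain ⟨n, hn⟩ := (hlim.eventually_lt_const
    (show (0:ℝ≥0∞) < ENNReal.ofReal (ε / 2) by simpa using hε)).exists
  have hpair : Measurable fun q : ℕ × H => G q.1 q.2 :=
    measurable_from_prod_countable_right fun k => (hGc k).measurable
  have hGm : Measurable fun p : ℝ × H => G (J n p.1) p.2 :=
    hpair.comp (((hJm n).comp measurable_fst).prodMk measurable_snd)
  refine ⟨∑ i ∈ Finset.range (n + 1), L i, ∑ i ∈ Finset.range (n + 1), N i,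
    fun p => G (J n p.1) p.2, hGm, fun t => ?_, ?_⟩
  · have hJn : J n t ∈ Finset.range (n + 1) := by
      rw [Finset.mem_range, Nat.lt_succ_iff]
      simp only [J]; split_ifs with h
      · exact h
      · exact Nat.zero_le _
    exact (hLN (J n t)).mono
      (by exact_mod_cast Finset.single_le_sum (fun i _ => Nat.zero_le (L i)) hJn)
      (by exact_mod_cast Finset.single_le_sum (fun i _ => Nat.zero_le (N i)) hJn)
  · have hD : Measurable fun p : ℝ × H => F p - G (J n p.1) p.2 := hFm.sub hGm
    have hmain : ∫⁻ p, ‖F p - G (J n p.1) p.2‖ₑ ∂(ν ⊗ₘ m) < ENNReal.ofReal ε := by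
      rw [Measure.lintegral_compProd hD.enorm]
      calc ∫⁻ t, c (J n t) t ∂ν ≤
          ∫⁻ t, (ENNReal.ofReal δ + {t | n < j t}.indicator (c 0) t) ∂ν := by
            refine lintegral_mono_ae ?_
            filter_upwards [hj] with t ht
            by_cases h : j t ≤ n
            · simp only [J, if_pos h]
              exact ht.le.trans le_self_add
            · simp only [J, if_neg h]
              rw [indicator_of_mem (by simpa using h)]
              exact le_add_self
        _ = ENNReal.ofReal δ * ν univ + ∫⁻ t, {t | n < j t}.indicator (c 0) t ∂ν := by
            rw [lintegral_add_left measurable_const, lintegral_const]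
        _ < ENNReal.ofReal (ε / 2) + ENNReal.ofReal (ε / 2) := by
            refine ENNReal.add_lt_add ?_ hn
            rw [← ofReal_measureReal, ← ENNReal.ofReal_mul hδ.le]
            exact (ENNReal.ofReal_lt_ofReal_iff (by positivity)).2 hδν
        _ = ENNReal.ofReal ε := by
            rw [← ENNReal.ofReal_add (by positivity) (by positivity), add_halves]
    exact (integral_norm_eq_lintegral_enorm hD.aestronglyMeasurable).trans_lt
      (ENNReal.toReal_lt_of_lt_ofReal hmain)

end DriftSeparable

section EulerStep

variable {H : Type} [NormedAddCommGroup H] [InnerProductSpace ℝ H] {ρ M K' L N δ : ℝ} {w : H → ℝ}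

/-- Composition with the Euler step `x ↦ x + δ G(x)` nearly preserves the class. -/
lemma SecondDiffClass.comp_euler (hw : SecondDiffClass ρ M w) {G : H → H}
    (hG : DriftClass K' L N G) (hM : 0 < M) (hNM : N ≤ M) (hK : 0 ≤ K') (hδ : 0 ≤ δ)
    (h1 : δ * L ^ 2 ≤ 1) (h2 : δ * (K' + 1) ^ 2 ≤ 1) :
    SecondDiffClass ((1 + (2 * K' + 4) * δ) * ρ) M fun x => w (x + δ • G x) := by
  have hρ := hw.nonneg
  refine hw.comp_map (J := fun x => x + δ • G x) (c := 1 + (K' + 1) * δ) (N := δ * N)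
    hM.le (by positivity) (fun x y => ?_) (fun x a b => ?_) ?_ ?_ ?_
  · have e : x + δ • G x - (y + δ • G y) = (x - y) + δ • (G x - G y) := by
      rw [smul_sub]; abel
    rw [e]
    refine abs_le_of_sq_le_sq' ?_ (by positivity) |>.2
    have h3 := hG.diss x y
    have h4 : ‖G x - G y‖ ^ 2 ≤ (L * ‖x - y‖) ^ 2 :=
      pow_le_pow_left₀ (norm_nonneg _) (hG.lip x y) 2
    rw [norm_add_sq_real, inner_smul_right, norm_smul, Real.norm_of_nonneg hδ, real_inner_comm]
    have h5 : δ * ⟪G x - G y, x - y⟫_ℝ ≤ δ * (K' * ‖x - y‖ ^ 2) := by gcongr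
    have h6 : (δ * ‖G x - G y‖) ^ 2 ≤ δ * ‖x - y‖ ^ 2 := by
      calc (δ * ‖G x - G y‖) ^ 2 = δ ^ 2 * ‖G x - G y‖ ^ 2 := by ring
        _ ≤ δ ^ 2 * (L * ‖x - y‖) ^ 2 := by gcongr
        _ = (δ * L ^ 2) * (δ * ‖x - y‖ ^ 2) := by ring
        _ ≤ 1 * (δ * ‖x - y‖ ^ 2) := by gcongr
        _ = _ := one_mul _
    nlinarith [mul_nonneg hδ (sq_nonneg ‖x - y‖), sq_nonneg ((K' + 1) * δ * ‖x - y‖)]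
  · have e : x + a + b + δ • G (x + a + b) - (x + a + δ • G (x + a)) -
        (x + b + δ • G (x + b)) + (x + δ • G x) =
        δ • (G (x + a + b) - G (x + a) - G (x + b) + G x) := by
      simp only [smul_sub, smul_add]; abel
    rw [e, norm_smul, Real.norm_of_nonneg hδ]
    calc _ ≤ δ * (N * ‖a‖ * ‖b‖) := by gcongr; exact hG.second x a b
      _ = _ := by ring
  · nlinarith [mul_nonneg hρ hδ, mul_nonneg (mul_nonneg hρ hδ) hK]
  · nlinarith [mul_nonneg hρ hδ, mul_nonneg (mul_nonneg hρ hδ) hK]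
  · have h3 : M * (1 + (K' + 1) * δ) ^ 2 + δ * N ≤ (1 + (2 * K' + 4) * δ) * M := by
      have h4 : δ * N ≤ δ * M := by gcongr
      have h5 : δ * (δ * (K' + 1) ^ 2) * M ≤ δ * 1 * M := by gcongr
      nlinarith
    nlinarith [mul_le_mul_of_nonneg_left h3 hρ]

lemma SecondDiffClass.abs_deriv_le (hw : SecondDiffClass ρ M w) {x g : H} {d : ℝ}
    (hd : HasDerivAt (fun s : ℝ => w (x + s • g)) d 0) : |d| ≤ ρ * ‖g‖ := by
  have hρ := hw.nonneg
  rw [← Real.norm_eq_abs, ← hd.deriv]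
  refine norm_deriv_le_of_lip' (by positivity) (Eventually.of_forall fun s => ?_)
  rw [Real.norm_eq_abs]
  refine (hw.lip _ _).trans_eq ?_
  rw [add_sub_add_left_eq_sub, ← sub_smul, norm_smul, sub_zero]
  ring

lemma SecondDiffClass.abs_taylor_le (hw : SecondDiffClass ρ M w) (hM : 0 ≤ M) {x g : H}
    {d : ℝ → ℝ} (hd : ∀ s, HasDerivAt (fun s : ℝ => w (x + s • g)) (d s) s) (hδ : 0 ≤ δ) :
    |w (x + δ • g) - w x - δ * d 0| ≤ ρ * M * δ ^ 2 * ‖g‖ ^ 2 := by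
  have hρ := hw.nonneg
  have hdd : ∀ s, 0 ≤ s → |d s - d 0| ≤ ρ * M * s * ‖g‖ ^ 2 := by
    intro s hs
    have h1 : HasDerivAt (fun r : ℝ => w (x + (s + r) • g) - w (x + r • g)) (d s - d 0) 0 := by
      refine HasDerivAt.sub ?_ (hd 0)
      have := hd s
      rw [← add_zero s] at this
      simpa using this.comp_const_add s 0
    rw [← Real.norm_eq_abs, ← h1.deriv]
    refine norm_deriv_le_of_lip' (by positivity) (Eventually.of_forall fun r => ?_)
    rw [Real.norm_eq_abs]
    have h2 := hw.second x (s • g) (r • g)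
    rw [add_assoc, ← add_smul] at h2
    rw [norm_smul, norm_smul, Real.norm_of_nonneg hs] at h2
    have e : w (x + (s + r) • g) - w (x + r • g) - (w (x + (s + 0) • g) - w (x + (0:ℝ) • g)) =
        w (x + (s + r) • g) - w (x + s • g) - w (x + r • g) + w x := by
      simp only [add_zero, zero_smul]; ring
    rw [e, sub_zero]
    calc _ ≤ _ := h2
      _ = _ := by ring
  have h := norm_image_sub_le_of_norm_deriv_le_segment' (a := 0) (b := δ)
    (f := fun s => w (x + s • g) - s * d 0) (f' := fun s => d s - d 0)
    (C := ρ * M * δ * ‖g‖ ^ 2)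
    (fun s _ => by
      have := (hd s).sub ((hasDerivAt_id s).mul_const (d 0))
      simp only [one_mul] at this
      exact this.hasDerivWithinAt)
    (fun s hs => by
      rw [Real.norm_eq_abs]
      refine (hdd s hs.1).trans ?_
      have := hs.2.le
      gcongr) δ ⟨hδ, le_rfl⟩
  simp only [zero_smul, add_zero, zero_mul, sub_zero, Real.norm_eq_abs] at h
  calc _ = |w (x + δ • g) - δ * d 0 - w x| := by congr 1; ring
    _ ≤ _ := h
    _ = _ := by ring

lemma hasDerivAt_sum_cos {n : ℕ} (a : Fin n → ℝ) (h : Fin n → H) (θ : Fin n → ℝ) (x g : H)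
    (s : ℝ) : HasDerivAt (fun s : ℝ => ∑ j, a j * Real.cos (⟪x + s • g, h j⟫_ℝ + θ j))
      (-∑ j, a j * (Real.sin (⟪x + s • g, h j⟫_ℝ + θ j) * ⟪g, h j⟫_ℝ)) s := by
  rw [← Finset.sum_neg_distrib]
  refine HasDerivAt.fun_sum fun j _ => ?_
  have h1 : HasDerivAt (fun s : ℝ => ⟪x + s • g, h j⟫_ℝ + θ j) ⟪g, h j⟫_ℝ s := by
    have : (fun s : ℝ => ⟪x + s • g, h j⟫_ℝ + θ j) =
        fun s : ℝ => s * ⟪g, h j⟫_ℝ + (⟪x, h j⟫_ℝ + θ j) := by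
      ext s; rw [inner_add_left, real_inner_smul_left]; ring
    rw [this]
    simpa using ((hasDerivAt_id s).mul_const ⟪g, h j⟫_ℝ).add_const (⟪x, h j⟫_ℝ + θ j)
  refine (h1.cos.const_mul (a j)).congr_deriv ?_
  ring

lemma secondDiffClass_cos (h : H) (θ : ℝ) {a c : ℝ} (hac : |a| ≤ c) (hM : 1 ≤ M) :
    SecondDiffClass (c * (1 + ‖h‖) ^ 2) M fun x => a * Real.cos (⟪x, h⟫_ℝ + θ) := by
  have hc : 0 ≤ c := (abs_nonneg a).trans hac
  have hh := norm_nonneg h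
  refine ⟨fun x => ?_, fun x y => ?_, fun x u v => ?_⟩
  · rw [abs_mul]
    calc _ ≤ c * 1 := mul_le_mul hac (Real.abs_cos_le_one _) (abs_nonneg _) hc
      _ ≤ _ := by gcongr; nlinarith
  · rw [← mul_sub, abs_mul]
    have h1 := abs_cos_sub_cos_le (⟪x, h⟫_ℝ + θ) (⟪y, h⟫_ℝ + θ)
    rw [add_sub_add_right_eq_sub, ← inner_sub_left] at h1
    calc _ ≤ c * (‖x - y‖ * ‖h‖) :=
          mul_le_mul hac (h1.trans (abs_real_inner_le_norm _ _)) (abs_nonneg _) hc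
      _ = c * ‖h‖ * ‖x - y‖ := by ring
      _ ≤ _ := by gcongr; nlinarith
  · have e : a * Real.cos (⟪x + u + v, h⟫_ℝ + θ) - a * Real.cos (⟪x + u, h⟫_ℝ + θ) -
        a * Real.cos (⟪x + v, h⟫_ℝ + θ) + a * Real.cos (⟪x, h⟫_ℝ + θ) =
        a * (-(4 * (Real.sin (⟪u, h⟫_ℝ / 2) * Real.sin (⟪v, h⟫_ℝ / 2) *
          Real.cos (⟪x, h⟫_ℝ + θ + (⟪u, h⟫_ℝ + ⟪v, h⟫_ℝ) / 2)))) := by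
      simp only [inner_add_left]
      set p := ⟪u, h⟫_ℝ
      set q := ⟪v, h⟫_ℝ
      set z := ⟪x, h⟫_ℝ + θ + (p + q) / 2 with hz
      rw [show ⟪x, h⟫_ℝ + p + q + θ = z + (p / 2 + q / 2) by rw [hz]; ring,
        show ⟪x, h⟫_ℝ + p + θ = z + (p / 2 - q / 2) by rw [hz]; ring,
        show ⟪x, h⟫_ℝ + q + θ = z - (p / 2 - q / 2) by rw [hz]; ring,
        show ⟪x, h⟫_ℝ + θ = z - (p / 2 + q / 2) by rw [hz]; ring]
      simp only [Real.cos_add, Real.cos_sub, Real.sin_add, Real.sin_sub]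
      ring
    rw [e, abs_mul, abs_neg, abs_mul, abs_mul, abs_mul]
    have hs : ∀ y : H, |Real.sin (⟪y, h⟫_ℝ / 2)| ≤ ‖y‖ * ‖h‖ / 2 := fun y => by
      have h1 := Real.abs_sin_le_abs (x := ⟪y, h⟫_ℝ / 2)
      rw [abs_div, abs_two] at h1
      have := abs_real_inner_le_norm y h
      linarith
    calc _ ≤ c * (|4| * (‖u‖ * ‖h‖ / 2 * (‖v‖ * ‖h‖ / 2) * 1)) := by
          gcongr
          · exact hs u
          · exact hs v
          · exact Real.abs_cos_le_one _
      _ = c * ‖h‖ ^ 2 * 1 * ‖u‖ * ‖v‖ := by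
          rw [abs_of_pos (by norm_num : (0:ℝ) < 4)]; ring
      _ ≤ _ := by gcongr; linarith

end EulerStep

section Bracket

variable {H : Type} [NormedAddCommGroup H] [InnerProductSpace ℝ H] [CompleteSpace H]
  [SecondCountableTopology H] [MeasurableSpace H] [BorelSpace H] {V : Submodule ℝ H}
  {ρ M B K' L N δ lam : ℝ}

/-- Replacing the drift term by an Euler step along a regular approximation of the drift. -/
lemma SecondDiffClass.abs_generator_sub_le {n : ℕ} {a : Fin n → ℝ} {h : Fin n → H}
    {θ : Fin n → ℝ} (hw : SecondDiffClass ρ M fun x => ∑ j, a j * Real.cos (⟪x, h j⟫_ℝ + θ j))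
    (hM : 0 ≤ M) (hδ : 0 ≤ δ) (hlam : lam * δ = 1) (hlam0 : 0 ≤ lam) (x f g : H) :
    |∑ j, a j * (lam * Real.cos (⟪x, h j⟫_ℝ + θ j) - Real.sin (⟪x, h j⟫_ℝ + θ j) * ⟪f, h j⟫_ℝ) -
      lam * ∑ j, a j * Real.cos (⟪x + δ • g, h j⟫_ℝ + θ j)| ≤
      ρ * ‖f - g‖ + ρ * M * δ * ‖g‖ ^ 2 := by
  have h1 := hw.abs_taylor_le hM (x := x) (g := g)
    (fun s => hasDerivAt_sum_cos a h θ x g s) hδ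
  have h2 := hw.abs_deriv_le (hasDerivAt_sum_cos a h θ x (f - g) 0)
  simp only [zero_smul, add_zero] at h1 h2
  set v := ∑ j, a j * Real.cos (⟪x, h j⟫_ℝ + θ j) with hv
  set w := ∑ j, a j * Real.cos (⟪x + δ • g, h j⟫_ℝ + θ j)
  set d := ∑ j, a j * (Real.sin (⟪x, h j⟫_ℝ + θ j) * ⟪g, h j⟫_ℝ) with hd
  set d' := ∑ j, a j * (Real.sin (⟪x, h j⟫_ℝ + θ j) * ⟪f - g, h j⟫_ℝ) with hd'
  have e : ∑ j, a j * (lam * Real.cos (⟪x, h j⟫_ℝ + θ j) -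
      Real.sin (⟪x, h j⟫_ℝ + θ j) * ⟪f, h j⟫_ℝ) - lam * w =
      -d' + -lam * (w - v - δ * -d) := by
    have : ∑ j, a j * (lam * Real.cos (⟪x, h j⟫_ℝ + θ j) -
        Real.sin (⟪x, h j⟫_ℝ + θ j) * ⟪f, h j⟫_ℝ) = lam * v - d - d' := by
      rw [hv, hd, hd', Finset.mul_sum, ← Finset.sum_sub_distrib, ← Finset.sum_sub_distrib]
      refine Finset.sum_congr rfl fun j _ => ?_
      rw [inner_sub_left]; ring
    rw [this]
    linear_combination d * hlam
  rw [e]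
  calc _ ≤ |-d'| + |-lam * (w - v - δ * -d)| := abs_add_le _ _
    _ ≤ ρ * ‖f - g‖ + lam * (ρ * M * δ ^ 2 * ‖g‖ ^ 2) := by
        rw [abs_mul, abs_neg lam, abs_of_nonneg hlam0]
        gcongr
    _ = _ := by linear_combination (ρ * M * δ * ‖g‖ ^ 2) * hlam

/-- The difference of the integrals of the resolvent generator applied to a trigonometric sum. -/
lemma TrigBound.abs_integral_generator_le {ν₁ ν₂ : Measure (ℝ × H)} [IsFiniteMeasure ν₁]
    [IsFiniteMeasure ν₂] (hb : TrigBound V ν₁ ν₂ M B) (hV : Dense (V : Set H)) (hM : 0 < M)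
    {F G : ℝ × H → H} (hFm : Measurable F) (hGm : Measurable G)
    (hG : ∀ t, DriftClass K' L N fun x => G (t, x)) (hNM : N ≤ M) (hK : 0 ≤ K') (hδ : 0 ≤ δ)
    (h1 : δ * L ^ 2 ≤ 1) (h2 : δ * (K' + 1) ^ 2 ≤ 1) (hlam : lam * δ = 1) (hlam0 : 0 ≤ lam)
    (hF₁ : Integrable (fun p => ‖F p - G p‖) ν₁) (hF₂ : Integrable (fun p => ‖F p - G p‖) ν₂)
    (hG₁ : Integrable (fun p => ‖G p‖ ^ 2) ν₁) (hG₂ : Integrable (fun p => ‖G p‖ ^ 2) ν₂)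
    {E E' : ℝ} (hE : ∫ p, ‖F p - G p‖ ∂ν₁ + ∫ p, ‖F p - G p‖ ∂ν₂ ≤ E)
    (hE' : ∫ p, ‖G p‖ ^ 2 ∂ν₁ + ∫ p, ‖G p‖ ^ 2 ∂ν₂ ≤ E')
    {n : ℕ} {a : Fin n → ℝ → ℝ} {h : Fin n → H} {θ : Fin n → ℝ} (ha : ∀ j, Measurable (a j))
    (hw : ∀ t, SecondDiffClass ρ M fun x => ∑ j, a j t * Real.cos (⟪x, h j⟫_ℝ + θ j)) :
    |∫ p, ∑ j, a j p.1 * (lam * Real.cos (⟪p.2, h j⟫_ℝ + θ j) -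
        Real.sin (⟪p.2, h j⟫_ℝ + θ j) * ⟪F p, h j⟫_ℝ) ∂ν₁ -
      ∫ p, ∑ j, a j p.1 * (lam * Real.cos (⟪p.2, h j⟫_ℝ + θ j) -
        Real.sin (⟪p.2, h j⟫_ℝ + θ j) * ⟪F p, h j⟫_ℝ) ∂ν₂| ≤
      ρ * ((lam + (2 * K' + 4)) * B + (E + δ * M * E')) := by
  have hρ := (hw 0).nonneg
  set W : ℝ × H → ℝ := fun p => ∑ j, a j p.1 * Real.cos (⟪p.2 + δ • G p, h j⟫_ℝ + θ j) with hWdef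
  set D : ℝ × H → ℝ := fun p => ∑ j, a j p.1 * (lam * Real.cos (⟪p.2, h j⟫_ℝ + θ j) -
        Real.sin (⟪p.2, h j⟫_ℝ + θ j) * ⟪F p, h j⟫_ℝ) with hDdef
  have hin : ∀ {Y : ℝ × H → H} (k : H), Measurable Y → Measurable fun p => ⟪Y p, k⟫_ℝ :=
    fun k hY => (by fun_prop : Continuous fun y : H => ⟪y, k⟫_ℝ).measurable.comp hY
  have hWm : Measurable W := by
    refine Finset.measurable_sum _ fun j _ => ((ha j).comp measurable_fst).mul
      (Real.measurable_cos.comp ((hin _ ?_).add_const _))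
    exact measurable_snd.add (hGm.const_smul δ)
  have hDm : Measurable D := by
    refine Finset.measurable_sum _ fun j _ => ((ha j).comp measurable_fst).mul ?_
    have e := (hin (h j) (measurable_snd : Measurable (Prod.snd : ℝ × H → H))).add_const (θ j)
    exact ((Real.measurable_cos.comp e).const_mul lam).sub
      ((Real.measurable_sin.comp e).mul (hin (h j) hFm))
  have hWc : ∀ t, SecondDiffClass ((1 + (2 * K' + 4) * δ) * ρ) M fun x => W (t, x) :=
    fun t => (hw t).comp_euler (hG t) hM hNM hK hδ h1 h2
  have hWb := hb.bound hV hM hWm hWc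
  have hR : ∀ p, |D p - lam * W p| ≤ ρ * ‖F p - G p‖ + ρ * M * δ * ‖G p‖ ^ 2 := fun p =>
    (hw p.1).abs_generator_sub_le hM.le hδ hlam hlam0 p.2 (F p) (G p)
  have hRm : Measurable fun p => D p - lam * W p := hDm.sub (hWm.const_mul lam)
  have key : ∀ ν : Measure (ℝ × H), IsFiniteMeasure ν → Integrable (fun p => ‖F p - G p‖) ν →
      Integrable (fun p => ‖G p‖ ^ 2) ν → |∫ p, D p ∂ν - lam * ∫ p, W p ∂ν| ≤
        ρ * ∫ p, ‖F p - G p‖ ∂ν + ρ * M * δ * ∫ p, ‖G p‖ ^ 2 ∂ν := by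
    intro ν _ hi hi'
    have hbi : Integrable (fun p => ρ * ‖F p - G p‖ + ρ * M * δ * ‖G p‖ ^ 2) ν :=
      (hi.const_mul _).add (hi'.const_mul _)
    have hRi : Integrable (fun p => D p - lam * W p) ν :=
      hbi.mono' hRm.aestronglyMeasurable
        (Eventually.of_forall fun p => (Real.norm_eq_abs _).trans_le (hR p))
    have hWi : Integrable (fun p => lam * W p) ν :=
      (Integrable.of_bound hWm.aestronglyMeasurable ((1 + (2 * K' + 4) * δ) * ρ)
        (Eventually.of_forall fun p => (Real.norm_eq_abs _).trans_le
          ((hWc p.1).bound p.2))).const_mul lam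
    have hDi : Integrable D ν := by
      have := hRi.add hWi
      exact this.congr (Eventually.of_forall fun p => by simp)
    rw [← integral_const_mul, ← integral_sub hDi hWi]
    calc _ ≤ ∫ p, (ρ * ‖F p - G p‖ + ρ * M * δ * ‖G p‖ ^ 2) ∂ν :=
          (Real.norm_eq_abs _).symm.trans_le (norm_integral_le_of_norm_le hbi
            (Eventually.of_forall fun p => (Real.norm_eq_abs _).trans_le (hR p)))
      _ = _ := by
          rw [integral_add (hi.const_mul _) (hi'.const_mul _), integral_const_mul,
            integral_const_mul]
  have k1 := key ν₁ inferInstance hF₁ hG₁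
  have k2 := key ν₂ inferInstance hF₂ hG₂
  calc |∫ p, D p ∂ν₁ - ∫ p, D p ∂ν₂|
      = |(∫ p, D p ∂ν₁ - lam * ∫ p, W p ∂ν₁) - (∫ p, D p ∂ν₂ - lam * ∫ p, W p ∂ν₂) +
          lam * (∫ p, W p ∂ν₁ - ∫ p, W p ∂ν₂)| := by congr 1; ring
    _ ≤ |∫ p, D p ∂ν₁ - lam * ∫ p, W p ∂ν₁| + |∫ p, D p ∂ν₂ - lam * ∫ p, W p ∂ν₂| +
          lam * |∫ p, W p ∂ν₁ - ∫ p, W p ∂ν₂| := by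
        refine (abs_add_le _ _).trans ?_
        rw [abs_mul, abs_of_nonneg hlam0]
        gcongr
        exact abs_sub _ _
    _ ≤ ρ * (∫ p, ‖F p - G p‖ ∂ν₁ + ∫ p, ‖F p - G p‖ ∂ν₂) +
          ρ * M * δ * (∫ p, ‖G p‖ ^ 2 ∂ν₁ + ∫ p, ‖G p‖ ^ 2 ∂ν₂) +
          lam * ((1 + (2 * K' + 4) * δ) * ρ * B) := by
        have := mul_le_mul_of_nonneg_left hWb hlam0
        linarith
    _ ≤ ρ * E + ρ * M * δ * E' + lam * ((1 + (2 * K' + 4) * δ) * ρ * B) := by gcongr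
    _ = _ := by linear_combination (ρ * (2 * K' + 4) * B) * hlam

end Bracket

namespace FPData

section Contraction

variable {H : Type} [NormedAddCommGroup H] [InnerProductSpace ℝ H] [CompleteSpace H]
  [SecondCountableTopology H] [MeasurableSpace H] [BorelSpace H] {D : FPData H}
  {s : ℝ} {ζ : Measure H} {μ μ₁ μ₂ : Measure (ℝ × H)} {μt μt₁ μt₂ : ℝ → Measure H}

/-- The measure with density `e^{-bt}` with respect to `μ`. -/
noncomputable def damped (b : ℝ) (μ : Measure (ℝ × H)) : Measure (ℝ × H) :=
  μ.withDensity fun p => ENNReal.ofReal (Real.exp (-(b * p.1)))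

lemma integral_damped (b : ℝ) (μ : Measure (ℝ × H)) (f : ℝ × H → ℝ) :
    ∫ p, f p ∂(damped b μ) = ∫ p, Real.exp (-(b * p.1)) * f p ∂μ := by
  rw [damped, integral_withDensity_eq_integral_toReal_smul (by fun_prop)
    (Eventually.of_forall fun _ => ENNReal.ofReal_lt_top)]
  refine integral_congr_ae (Eventually.of_forall fun p => ?_)
  simp only [smul_eq_mul, ENNReal.toReal_ofReal (Real.exp_pos _).le]

lemma IsFPSol.damped_le (sol : D.IsFPSol s ζ μ μt) (hs : 0 ≤ s) {b : ℝ} (hb : 0 ≤ b) :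
    damped b μ ≤ μ := by
  calc damped b μ ≤ μ.withDensity 1 := by
        refine withDensity_mono ?_
        filter_upwards [sol.ae_mem] with p hp
        refine ENNReal.ofReal_le_one.2 (Real.exp_le_one_iff.2 ?_)
        have := mul_nonneg hb (hs.trans hp.1)
        linarith
    _ = μ := withDensity_one

lemma IsFPSol.integrable_mul_duhamel (sol : D.IsFPSol s ζ μ μt) (hyp : D.Hyp31) {lam : ℝ}
    (hlam : 0 ≤ lam) {h : H} (hh : h ∈ D.V) (θ : ℝ) {ψ : ℝ → ℝ} (hψ : Measurable ψ) {c : ℝ}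
    (hc : ∀ t, |ψ t| ≤ c) {τ : ℝ} (hτ : 0 ≤ τ) :
    Integrable (fun p : ℝ × H => ψ (p.1 + τ) * D.duhamel lam h θ τ p) μ := by
  have hfin := sol.isFiniteMeasure
  have hc0 : 0 ≤ c := (abs_nonneg _).trans (hc 0)
  have hb : Integrable (fun p : ℝ × H =>
      c * (lam + ‖D.F p‖ * (Real.exp (max hyp.ω 0 * τ) * ‖h‖))) μ :=
    ((integrable_const _).add (sol.integrable_F.norm.mul_const _)).const_mul _
  refine hb.mono' ?_ (Eventually.of_forall fun p => ?_)
  · have h1 := (hyp.measurable_duhamel lam θ hh).comp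
      (f := fun p : ℝ × H => (τ, p)) (by fun_prop)
    exact ((hψ.comp (measurable_fst.add_const τ)).mul h1).aestronglyMeasurable
  · rw [norm_mul, Real.norm_eq_abs, Real.norm_eq_abs]
    exact mul_le_mul (hc _) (hyp.abs_duhamel_le hlam h θ hτ le_rfl p) (abs_nonneg _) hc0

/-- The Duhamel formula improves a bound on the generator to a bound on trigonometric sums. -/
lemma trigBound_of_generator (hyp : D.Hyp31) (hs : 0 ≤ s) [IsProbabilityMeasure ζ]
    (sol₁ : D.IsFPSol s ζ μ₁ μt₁) (sol₂ : D.IsFPSol s ζ μ₂ μt₂) {M C lam b : ℝ} (hM : 0 ≤ M)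
    (hlam : 0 ≤ lam) (hb : 2 * max hyp.ω 0 ≤ b) (hb' : 2 * max hyp.ω 0 < lam + b)
    (hgen : ∀ (ρ : ℝ) (n : ℕ) (a : Fin n → ℝ → ℝ) (h : Fin n → H) (θ : Fin n → ℝ),
      (∀ j, Measurable (a j)) →
      (∀ t, SecondDiffClass ρ M fun x => ∑ j, a j t * Real.cos (⟪x, h j⟫_ℝ + θ j)) →
      |∫ p, ∑ j, a j p.1 * (lam * Real.cos (⟪p.2, h j⟫_ℝ + θ j) -
          Real.sin (⟪p.2, h j⟫_ℝ + θ j) * ⟪D.F p, h j⟫_ℝ) ∂(damped b μ₁) -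
        ∫ p, ∑ j, a j p.1 * (lam * Real.cos (⟪p.2, h j⟫_ℝ + θ j) -
          Real.sin (⟪p.2, h j⟫_ℝ + θ j) * ⟪D.F p, h j⟫_ℝ) ∂(damped b μ₂)| ≤ ρ * C) :
    TrigBound D.V (damped b μ₁) (damped b μ₂) M (C / (lam + b - 2 * max hyp.ω 0)) := by
  intro ρ f hf hfc
  have hω : 0 ≤ max hyp.ω 0 := le_max_right _ _
  obtain ⟨n, α, h, θ, hα, hαc, hh, hfe⟩ := trigSpan.exists_sum hf
  choose c hc using hαc
  obtain rfl : f = fun p => ∑ j, α j p.1 * Real.cos (⟪p.2, h j⟫_ℝ + θ j) := funext hfe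
  have hρ : 0 ≤ ρ := (hfc 0).nonneg
  set ψ : Fin n → ℝ → ℝ := fun j =>
    (Icc s D.T).indicator fun t => Real.exp (-(b * t)) * α j t with hψdef
  have hψm : ∀ j, Measurable (ψ j) := fun j =>
    (((by fun_prop : Continuous fun t : ℝ => Real.exp (-(b * t))).measurable).mul
      (hα j)).indicator measurableSet_Icc
  have hψc : ∀ j t, |ψ j t| ≤ c j := by
    intro j t
    by_cases ht : t ∈ Icc s D.T
    · rw [hψdef]
      simp only
      rw [indicator_of_mem ht, abs_mul, abs_of_pos (Real.exp_pos _)]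
      have : Real.exp (-(b * t)) ≤ 1 := Real.exp_le_one_iff.2 (by
        have := mul_nonneg ((by positivity : 0 ≤ 2 * max hyp.ω 0).trans hb) (hs.trans ht.1)
        linarith)
      exact (mul_le_of_le_one_left (abs_nonneg _) this).trans (hc j t)
    · rw [hψdef]
      simp only
      rw [indicator_of_notMem ht, abs_zero]
      exact (abs_nonneg _).trans (hc j t)
  have hψs : ∀ j t, t ∉ Icc s D.T → ψ j t = 0 := fun j t ht => indicator_of_notMem ht _
  set I : Measure (ℝ × H) → Fin n → ℝ → ℝ := fun μ j τ => Real.exp (-(lam * τ)) *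
    ∫ p, ψ j (p.1 + τ) * D.duhamel lam (h j) (θ j) τ p ∂μ with hI
  have hrep : ∀ {μ : Measure (ℝ × H)} {μt : ℝ → Measure H}, D.IsFPSol s ζ μ μt →
      (∀ j, IntegrableOn (I μ j) (Ioi 0)) ∧
      ∫ p, ∑ j, α j p.1 * Real.cos (⟪p.2, h j⟫_ℝ + θ j) ∂(damped b μ) =
      ∑ j, D.initialTerm s ζ lam (ψ j) (h j) (θ j) + ∫ τ in Ioi (0:ℝ), ∑ j, I μ j τ := by
    intro μ μt sol
    have hfin := sol.isFiniteMeasure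
    have hd := fun j => sol.duhamel_formula hyp hlam (hh j) (θ j) (hψm j) (hψc j) (hψs j)
    refine ⟨fun j => (hd j).1, ?_⟩
    rw [integral_damped]
    have e1 : ∫ p, Real.exp (-(b * p.1)) *
        ∑ j, α j p.1 * Real.cos (⟪p.2, h j⟫_ℝ + θ j) ∂μ =
        ∫ p, ∑ j, ψ j p.1 * Real.cos (⟪p.2, h j⟫_ℝ + θ j) ∂μ := by
      refine integral_congr_ae ?_
      filter_upwards [sol.ae_mem] with p hp
      rw [Finset.mul_sum]
      refine Finset.sum_congr rfl fun j _ => ?_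
      simp only [hψdef, indicator_of_mem hp]
      ring
    rw [e1, integral_finsetSum, integral_finsetSum, ← Finset.sum_add_distrib]
    · exact Finset.sum_congr rfl fun j _ => (hd j).2
    · exact fun j _ => (hd j).1
    · intro j _
      refine Integrable.of_bound (C := c j) ?_ (Eventually.of_forall fun p => ?_)
      · have h1 : Continuous fun p : ℝ × H => Real.cos (⟪p.2, h j⟫_ℝ + θ j) := by fun_prop
        exact (((hψm j).comp measurable_fst).mul h1.measurable).aestronglyMeasurable
      · rw [norm_mul, Real.norm_eq_abs, Real.norm_eq_abs]
        exact (mul_le_of_le_one_right (abs_nonneg _) (Real.abs_cos_le_one _)).trans (hψc j _)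
  obtain ⟨i1, r1⟩ := hrep sol₁
  obtain ⟨i2, r2⟩ := hrep sol₂
  set β := lam + b - 2 * max hyp.ω 0 with hβ
  have hβ0 : 0 < β := by linarith
  have hpt : ∀ τ ∈ Ioi (0:ℝ), |∑ j, I μ₁ j τ - ∑ j, I μ₂ j τ| ≤
      ρ * C * Real.exp (-β * τ) := by
    intro τ hτ
    have hτ0 : 0 ≤ τ := (mem_Ioi.1 hτ).le
    set a : Fin n → ℝ → ℝ := fun j t =>
      (Icc s D.T).indicator (α j) (t + τ) * D.gaussFactor (h j) τ with ha
    have ham : ∀ j, Measurable (a j) := fun j =>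
      (((hα j).indicator measurableSet_Icc).comp (measurable_add_const τ)).mul_const _
    have hac : ∀ t, SecondDiffClass (ρ * Real.exp (2 * max hyp.ω 0 * τ)) M fun x =>
        ∑ j, a j t * Real.cos (⟪x, D.Sadj τ (h j)⟫_ℝ + θ j) := by
      intro t
      by_cases ht : t + τ ∈ Icc s D.T
      · have := hyp.secondDiffClass_smoothing hτ hh (a := fun j => α j (t + τ)) (θ := θ) hM
          (hfc (t + τ))
        simpa only [ha, indicator_of_mem ht, mul_assoc] using this
      · simp only [ha, indicator_of_notMem ht, zero_mul, Finset.sum_const_zero]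
        exact ⟨fun x => by rw [abs_zero]; positivity, fun x y => by
          rw [sub_self, abs_zero]; positivity, fun x u v => by
          rw [sub_self, sub_self, zero_add, abs_zero]; positivity⟩
    have hg := hgen _ n a (fun j => D.Sadj τ (h j)) θ ham hac
    have hI' : ∀ {μ : Measure (ℝ × H)} {μt : ℝ → Measure H}, D.IsFPSol s ζ μ μt →
        ∑ j, I μ j τ = Real.exp (-((lam + b) * τ)) * ∫ p, ∑ j, a j p.1 *
          (lam * Real.cos (⟪p.2, D.Sadj τ (h j)⟫_ℝ + θ j) -
          Real.sin (⟪p.2, D.Sadj τ (h j)⟫_ℝ + θ j) * ⟪D.F p, D.Sadj τ (h j)⟫_ℝ)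
          ∂(damped b μ) := by
      intro μ μt sol
      simp only [hI]
      rw [← Finset.mul_sum, ← integral_finsetSum _ fun j _ =>
        sol.integrable_mul_duhamel hyp hlam (hh j) (θ j) (hψm j) (hψc j) hτ0, integral_damped]
      rw [show -((lam + b) * τ) = -(lam * τ) + -(b * τ) by ring, Real.exp_add, mul_assoc,
        ← integral_const_mul (Real.exp (-(b * τ)))]
      congr 1
      refine integral_congr_ae (Eventually.of_forall fun p => ?_)
      simp only
      rw [Finset.mul_sum, Finset.mul_sum]
      refine Finset.sum_congr rfl fun j _ => ?_
      simp only [ha, hψdef, duhamel, max_eq_left hτ0]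
      by_cases ht : p.1 + τ ∈ Icc s D.T
      · rw [indicator_of_mem ht, indicator_of_mem ht,
          show -(b * (p.1 + τ)) = -(b * τ) + -(b * p.1) by ring, Real.exp_add]
        ring
      · rw [indicator_of_notMem ht, indicator_of_notMem ht]
        ring
    rw [hI' sol₁, hI' sol₂, ← mul_sub, abs_mul, abs_of_pos (Real.exp_pos _)]
    calc _ ≤ Real.exp (-((lam + b) * τ)) * (ρ * Real.exp (2 * max hyp.ω 0 * τ) * C) := by gcongr
      _ = ρ * C * (Real.exp (-((lam + b) * τ)) * Real.exp (2 * max hyp.ω 0 * τ)) := by ring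
      _ = _ := by rw [← Real.exp_add]; congr 2; rw [hβ]; ring
  have s1 : IntegrableOn (fun τ => ∑ j, I μ₁ j τ) (Ioi 0) :=
    integrable_finsetSum _ fun j _ => i1 j
  have s2 : IntegrableOn (fun τ => ∑ j, I μ₂ j τ) (Ioi 0) :=
    integrable_finsetSum _ fun j _ => i2 j
  rw [r1, r2, add_sub_add_left_eq_sub, ← integral_sub s1 s2]
  have hei : IntegrableOn (fun τ : ℝ => ρ * C * Real.exp (-β * τ)) (Ioi 0) :=
    (integrableOn_exp_mul_Ioi (neg_lt_zero.2 hβ0) 0).const_mul _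
  calc _ ≤ ∫ τ in Ioi (0:ℝ), ρ * C * Real.exp (-β * τ) :=
        (Real.norm_eq_abs _).symm.trans_le (norm_integral_le_of_norm_le hei
          ((ae_restrict_mem measurableSet_Ioi).mono fun τ hτ =>
            (Real.norm_eq_abs _).trans_le (hpt τ hτ)))
    _ = ρ * (C / β) := by
        rw [integral_const_mul, integral_exp_mul_Ioi (neg_lt_zero.2 hβ0)]
        simp only [mul_zero, Real.exp_zero]
        field_simp

end Contraction

end FPData

section Uniqueness

variable {H : Type} [NormedAddCommGroup H] [InnerProductSpace ℝ H] [CompleteSpace H]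
  [SecondCountableTopology H] [MeasurableSpace H] [BorelSpace H]

lemma TrigBound.of_contraction {V : Submodule ℝ H} {ν₁ ν₂ : Measure (ℝ × H)} {M q E B₀ : ℝ}
    (hq : 0 ≤ q) (hq1 : q < 1) (h0 : TrigBound V ν₁ ν₂ M B₀)
    (step : ∀ B, TrigBound V ν₁ ν₂ M B → TrigBound V ν₁ ν₂ M (E + q * (B - E))) :
    TrigBound V ν₁ ν₂ M E := by
  have key : ∀ n : ℕ, TrigBound V ν₁ ν₂ M (E + q ^ n * (B₀ - E)) := by
    intro n
    induction n with
    | zero => simpa using h0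
    | succ n ih =>
      have := step _ ih
      rwa [add_sub_cancel_left, ← mul_assoc, ← pow_succ'] at this
  intro ρ f hf hfc
  refine ge_of_tendsto (f := fun n : ℕ => ρ * (E + q ^ n * (B₀ - E))) (x := atTop) ?_
    (Eventually.of_forall fun n => key n ρ f hf hfc)
  have h1 := ((tendsto_pow_atTop_nhds_zero_of_lt_one hq hq1).mul_const (B₀ - E)).const_add E
  simpa using h1.const_mul ρ

lemma trigBound_univ (V : Submodule ℝ H) (ν₁ ν₂ : Measure (ℝ × H)) [IsFiniteMeasure ν₁]
    [IsFiniteMeasure ν₂] (M : ℝ) : TrigBound V ν₁ ν₂ M (ν₁.real univ + ν₂.real univ) := by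
  intro ρ f _ hfc
  have key : ∀ ν : Measure (ℝ × H), IsFiniteMeasure ν → |∫ p, f p ∂ν| ≤ ρ * ν.real univ :=
    fun ν _ => (Real.norm_eq_abs _).symm.trans_le (norm_integral_le_of_norm_le_const
      (Eventually.of_forall fun p => (Real.norm_eq_abs _).trans_le ((hfc p.1).bound p.2)))
  calc _ ≤ |∫ p, f p ∂ν₁| + |∫ p, f p ∂ν₂| := abs_sub _ _
    _ ≤ _ := by
      rw [mul_add]
      exact add_le_add (key ν₁ inferInstance) (key ν₂ inferInstance)

/-- Two finite measures on `ℝ × H` with the same partial cosine transforms coincide. -/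
lemma measure_eq_of_integral_cos {V : Submodule ℝ H} (hV : Dense (V : Set H))
    {μ₁ μ₂ : Measure (ℝ × H)} [IsFiniteMeasure μ₁] [IsFiniteMeasure μ₂]
    (h : ∀ B : Set ℝ, MeasurableSet B → ∀ k ∈ V, ∀ θ : ℝ,
      ∫ p, B.indicator 1 p.1 * Real.cos (⟪p.2, k⟫_ℝ + θ) ∂μ₁ =
      ∫ p, B.indicator 1 p.1 * Real.cos (⟪p.2, k⟫_ℝ + θ) ∂μ₂) : μ₁ = μ₂ := by
  set m : Measure (ℝ × H) → Set ℝ → Measure H := fun μ B =>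
    (μ.restrict (Prod.fst ⁻¹' B)).map Prod.snd with hm
  have hfin : ∀ (μ : Measure (ℝ × H)) [IsFiniteMeasure μ] B, IsFiniteMeasure (m μ B) := by
    intro μ _ B
    rw [hm]
    infer_instance
  have hint : ∀ (μ : Measure (ℝ × H)) [IsFiniteMeasure μ] (B : Set ℝ), MeasurableSet B →
      ∀ (k : H) (θ : ℝ), ∫ y, Real.cos (⟪y, k⟫_ℝ + θ) ∂(m μ B) =
        ∫ p, B.indicator 1 p.1 * Real.cos (⟪p.2, k⟫_ℝ + θ) ∂μ := by
    intro μ _ B hB k θ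
    rw [hm, integral_map measurable_snd.aemeasurable
      (by fun_prop : Continuous fun y => Real.cos (⟪y, k⟫_ℝ + θ)).aestronglyMeasurable,
      ← integral_indicator (measurable_fst hB)]
    refine integral_congr_ae (Eventually.of_forall fun p => ?_)
    by_cases hp : p.1 ∈ B
    · simp [indicator, hp]
    · simp [indicator, hp]
  have hcont : ∀ (ν : Measure H) [IsFiniteMeasure ν] (θ : ℝ),
      Continuous fun k : H => ∫ y, Real.cos (⟪y, k⟫_ℝ + θ) ∂ν := by
    intro ν _ θ
    refine continuous_of_dominated (bound := fun _ => 1) (fun k => ?_) (fun k => ?_)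
      (integrable_const _) (Eventually.of_forall fun y => by fun_prop)
    · exact (by fun_prop :
        Continuous fun y => Real.cos (⟪y, k⟫_ℝ + θ)).aestronglyMeasurable
    · exact Eventually.of_forall fun y => Real.abs_cos_le_one _
  have heq : ∀ B : Set ℝ, MeasurableSet B → m μ₁ B = m μ₂ B := by
    intro B hB
    have := hfin μ₁ B
    have := hfin μ₂ B
    have hall : ∀ (k : H) (θ : ℝ), ∫ y, Real.cos (⟪y, k⟫_ℝ + θ) ∂(m μ₁ B) =
        ∫ y, Real.cos (⟪y, k⟫_ℝ + θ) ∂(m μ₂ B) := by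
      intro k θ
      refine congrFun (Continuous.ext_on hV (hcont (m μ₁ B) θ) (hcont (m μ₂ B) θ)
        fun k hk => ?_) k
      simp only [hint _ B hB]
      exact h B hB k hk θ
    refine Measure.ext_of_charFun (funext fun k => ?_)
    have hchar : ∀ (ν : Measure H) [IsFiniteMeasure ν], charFun ν k =
        ((∫ y, Real.cos (⟪y, k⟫_ℝ + 0) ∂ν : ℝ) : ℂ) +
          ((∫ y, Real.cos (⟪y, k⟫_ℝ + -(Real.pi / 2)) ∂ν : ℝ) : ℂ) * Complex.I := by
      intro ν _
      have hi : ∀ θ : ℝ, Integrable (fun y => ((Real.cos (⟪y, k⟫_ℝ + θ) : ℝ) : ℂ)) ν := by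
        intro θ
        refine (Integrable.of_bound (C := 1) ?_ (Eventually.of_forall fun y => ?_)).ofReal
        · exact (by fun_prop :
            Continuous fun y => Real.cos (⟪y, k⟫_ℝ + θ)).aestronglyMeasurable
        · exact Real.abs_cos_le_one _
      rw [charFun_apply, ← integral_complex_ofReal, ← integral_complex_ofReal,
        ← integral_mul_const, ← integral_add (hi 0) ((hi _).mul_const _)]
      refine integral_congr_ae (Eventually.of_forall fun y => ?_)
      simp only
      rw [add_zero, ← sub_eq_add_neg, Real.cos_sub_pi_div_two, Complex.exp_mul_I,
        Complex.ofReal_cos, Complex.ofReal_sin]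
    rw [hchar (m μ₁ B), hchar (m μ₂ B), hall, hall]
  refine Measure.ext_prod fun {B C} hB hC => ?_
  have h1 : ∀ μ : Measure (ℝ × H), m μ B C = μ (B ×ˢ C) := by
    intro μ
    rw [hm, Measure.map_apply measurable_snd hC, Measure.restrict_apply (measurable_snd hC),
      Set.prod_eq, inter_comm]
  rw [← h1, ← h1, heq B hB]

end Uniqueness

namespace FPData

section Conclusion

open ProbabilityTheory

variable {H : Type} [NormedAddCommGroup H] [InnerProductSpace ℝ H] [CompleteSpace H]
  [SecondCountableTopology H] [MeasurableSpace H] [BorelSpace H] {D : FPData H}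
  {s : ℝ} {ζ : Measure H} {μ μ₁ μ₂ : Measure (ℝ × H)} {μt μt₁ μt₂ : ℝ → Measure H}

lemma Hyp51.mDissipative (hyp51 : D.Hyp51) {t : ℝ} (ht : t ∈ Icc 0 D.T) :
    MDissipative hyp51.K (hyp51.Fbar t) where
  pos := hyp51.K_pos
  diss := hyp51.diss t ht
  mrange := hyp51.mrange t ht
  zero_mem := by
    obtain ⟨h1, h2⟩ := hyp51.zero_mem t ht
    have := (hyp51.minimal t ht 0 h1).1
    rwa [h2] at this

lemma IsFPSol.integrable_norm_sq (sol : D.IsFPSol s ζ μ μt) (hm : D.moment1 s μt) :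
    Integrable (fun p : ℝ × H => ‖p.2‖ ^ 2) μ := by
  obtain ⟨κ, hfin, hκ, hμ⟩ := sol.exists_kernel
  have hc : Continuous fun p : ℝ × H => ‖p.2‖ ^ 2 := by fun_prop
  refine ⟨hc.aestronglyMeasurable, ?_⟩
  rw [hasFiniteIntegral_iff_ofReal (Eventually.of_forall fun p => by positivity), hμ,
    Measure.lintegral_compProd (by fun_prop)]
  refine lt_of_le_of_lt (setLIntegral_mono' measurableSet_Icc fun t ht => ?_) hm
  rw [hκ t ht]
  refine lintegral_mono fun y => ?_
  rw [add_assoc]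
  exact le_self_add

/-- An approximation of the drift by regular drifts, in `L¹` of both solutions. -/
lemma exists_driftClass_approx (hyp51 : D.Hyp51) (hs : s ∈ Icc 0 D.T)
    (sol₁ : D.IsFPSol s ζ μ₁ μt₁) (sol₂ : D.IsFPSol s ζ μ₂ μt₂) (hm₁ : D.moment1 s μt₁)
    (hm₂ : D.moment1 s μt₂) {ε : ℝ} (hε : 0 < ε) :
    ∃ L N : ℕ, ∃ G : ℝ × H → H, Measurable G ∧
      (∀ t, DriftClass (2 * hyp51.K) L N fun x => G (t, x)) ∧
      (∀ ν, ν = μ₁ ∨ ν = μ₂ → Integrable (fun p => ‖D.F p - G p‖) ν ∧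
        Integrable (fun p => ‖G p‖ ^ 2) ν) ∧
      ∫ p, ‖D.F p - G p‖ ∂μ₁ + ∫ p, ‖D.F p - G p‖ ∂μ₂ < ε := by
  have hf1 := sol₁.isFiniteMeasure
  have hf2 := sol₂.isFiniteMeasure
  have hsq : ∀ ν, ν = μ₁ ∨ ν = μ₂ → Integrable (fun p : ℝ × H => ‖p.2‖ ^ 2) ν := by
    rintro ν (rfl | rfl)
    exacts [sol₁.integrable_norm_sq hm₁, sol₂.integrable_norm_sq hm₂]
  have hfin : ∀ ν, ν = μ₁ ∨ ν = μ₂ → IsFiniteMeasure ν := by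
    rintro ν (rfl | rfl) <;> assumption
  have hFi : ∀ ν, ν = μ₁ ∨ ν = μ₂ → Integrable D.F ν := by
    rintro ν (rfl | rfl)
    exacts [sol₁.integrable_F, sol₂.integrable_F]
  have hid : ∀ ν, ν = μ₁ ∨ ν = μ₂ → Integrable (fun p : ℝ × H => p.2) ν := by
    intro ν hν
    have := hfin ν hν
    have hb : Integrable (fun p : ℝ × H => 1 + ‖p.2‖ ^ 2) ν :=
      (integrable_const _).add (hsq ν hν)
    refine hb.mono' measurable_snd.aestronglyMeasurable (Eventually.of_forall fun p => ?_)
    nlinarith [sq_nonneg (‖p.2‖ - 1)]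
  obtain ⟨κ₁, _, -, e1⟩ := sol₁.exists_kernel
  obtain ⟨κ₂, _, -, e2⟩ := sol₂.exists_kernel
  have hsum : (volume.restrict (Icc s D.T)) ⊗ₘ (κ₁ + κ₂) = μ₁ + μ₂ := by
    rw [e1, e2, Measure.compProd_add_right]
  have hIcc : ∀ᵐ t ∂(volume.restrict (Icc s D.T)), t ∈ Icc 0 D.T :=
    (ae_restrict_mem measurableSet_Icc).mono fun t ht => ⟨hs.1.trans ht.1, ht.2⟩
  have hDF : ∀ᵐ t ∂(volume.restrict (Icc s D.T)), ∀ᵐ x ∂((κ₁ + κ₂) t), (t, x) ∈ D.DF := by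
    have : ∀ᵐ p ∂((volume.restrict (Icc s D.T)) ⊗ₘ (κ₁ + κ₂)), p ∈ D.DF := by
      rw [hsum]
      exact ae_add_measure_iff.2 ⟨sol₁.ae_mem_DF, sol₂.ae_mem_DF⟩
    exact Measure.ae_ae_of_ae_compProd this
  obtain ⟨L, N, G, hGm, hG, hGε⟩ := exists_measurable_driftClass (F := D.F) (Γ := hyp51.Fbar)
    (ν := volume.restrict (Icc s D.T)) (m := κ₁ + κ₂) hyp51.K_pos
    (hIcc.mono fun t ht => hyp51.mDissipative ht)
    (by
      filter_upwards [hIcc, hDF] with t ht hx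
      exact hx.mono fun x hx => hyp51.minimal t ht x hx)
    D.F_meas
    (by rw [hsum]; exact (hFi _ (.inl rfl)).add_measure (hFi _ (.inr rfl)))
    (by rw [hsum]; exact (hid _ (.inl rfl)).add_measure (hid _ (.inr rfl))) hε
  have hGb : ∀ p : ℝ × H, ‖G p‖ ≤ 1 + L * ‖p.2‖ := fun p => (hG p.1).norm_le p.2
  have hi : ∀ ν, ν = μ₁ ∨ ν = μ₂ → Integrable (fun p => ‖D.F p - G p‖) ν ∧
      Integrable (fun p => ‖G p‖ ^ 2) ν := by
    intro ν hν
    have := hfin ν hν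
    constructor
    · refine ((hFi ν hν).sub ?_).norm
      have hb : Integrable (fun p : ℝ × H => 1 + (L : ℝ) * ‖p.2‖) ν :=
        (integrable_const _).add ((hid ν hν).norm.const_mul _)
      exact hb.mono' hGm.aestronglyMeasurable (Eventually.of_forall hGb)
    · have hb : Integrable (fun p : ℝ × H => 2 + 2 * (L : ℝ) ^ 2 * ‖p.2‖ ^ 2) ν :=
        (integrable_const _).add ((hsq ν hν).const_mul _)
      refine hb.mono' (hGm.norm.pow_const 2).aestronglyMeasurable
        (Eventually.of_forall fun p => ?_)
      rw [Real.norm_of_nonneg (by positivity)]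
      calc ‖G p‖ ^ 2 ≤ (1 + L * ‖p.2‖) ^ 2 := by gcongr; exact hGb p
        _ ≤ _ := by nlinarith [sq_nonneg (1 - L * ‖p.2‖)]
  refine ⟨L, N, G, hGm, hG, hi, ?_⟩
  rwa [hsum, integral_add_measure (hi _ (.inl rfl)).1 (hi _ (.inr rfl)).1] at hGε

lemma IsFPSol.integral_damped_eq (sol₁ : D.IsFPSol s ζ μ₁ μt₁) (sol₂ : D.IsFPSol s ζ μ₂ μt₂)
    [IsProbabilityMeasure ζ] (hyp : D.Hyp31) (hyp51 : D.Hyp51) (hs : s ∈ Icc 0 D.T)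
    (hm₁ : D.moment1 s μt₁) (hm₂ : D.moment1 s μt₂) {α : ℝ → ℝ} (hα : Measurable α) {c : ℝ}
    (hc : ∀ t, |α t| ≤ c) {h : H} (hh : h ∈ D.V) (θ : ℝ) {b : ℝ}
    (hb : b = 2 * max hyp.ω 0 + (2 * (2 * hyp51.K) + 4) + 1) :
    ∫ p, α p.1 * Real.cos (⟪p.2, h⟫_ℝ + θ) ∂(damped b μ₁) =
      ∫ p, α p.1 * Real.cos (⟪p.2, h⟫_ℝ + θ) ∂(damped b μ₂) := by
  have hω : 0 ≤ max hyp.ω 0 := le_max_right _ _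
  have hK := hyp51.K_pos
  have hf1 := sol₁.isFiniteMeasure
  have hf2 := sol₂.isFiniteMeasure
  have hb0 : 0 ≤ b := by rw [hb]; positivity
  have le1 := sol₁.damped_le hs.1 hb0
  have le2 := sol₂.damped_le hs.1 hb0
  have hd1 : IsFiniteMeasure (damped b μ₁) := isFiniteMeasure_of_le _ le1
  have hd2 : IsFiniteMeasure (damped b μ₂) := isFiniteMeasure_of_le _ le2
  rw [← sub_eq_zero, ← abs_nonpos_iff]
  set Δ := |∫ p, α p.1 * Real.cos (⟪p.2, h⟫_ℝ + θ) ∂(damped b μ₁) -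
      ∫ p, α p.1 * Real.cos (⟪p.2, h⟫_ℝ + θ) ∂(damped b μ₂)| with hΔ
  have key : ∀ ε > 0, Δ ≤ c * (1 + ‖h‖) ^ 2 * (2 * ε) := by
    intro ε hε
    obtain ⟨L, N, G, hGm, hG, hi, hGε⟩ :=
      exists_driftClass_approx hyp51 hs sol₁ sol₂ hm₁ hm₂ hε
    obtain ⟨i1, j1⟩ := hi μ₁ (.inl rfl)
    obtain ⟨i2, j2⟩ := hi μ₂ (.inr rfl)
    have hE : ∫ p, ‖D.F p - G p‖ ∂(damped b μ₁) + ∫ p, ‖D.F p - G p‖ ∂(damped b μ₂) ≤ ε :=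
      (add_le_add
        (integral_mono_measure le1 (Eventually.of_forall fun p => norm_nonneg _) i1)
        (integral_mono_measure le2 (Eventually.of_forall fun p => norm_nonneg _) i2)).trans
        hGε.le
    set M : ℝ := max 1 N with hM
    have hM1 : 1 ≤ M := le_max_left _ _
    have hM0 : 0 < M := by linarith
    set E' := ∫ p, ‖G p‖ ^ 2 ∂(damped b μ₁) + ∫ p, ‖G p‖ ^ 2 ∂(damped b μ₂) with hE'
    have hE'0 : 0 ≤ E' := add_nonneg (integral_nonneg fun p => by positivity)
      (integral_nonneg fun p => by positivity)
    set lam : ℝ := (L : ℝ) ^ 2 + (2 * hyp51.K + 1) ^ 2 + M * E' / ε + 1 with hlam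
    have q1 : 0 ≤ (L : ℝ) ^ 2 := by positivity
    have q2 : 0 ≤ (2 * hyp51.K + 1) ^ 2 := by positivity
    have q3 : 0 ≤ M * E' / ε := by positivity
    have hlam0 : 0 < lam := by linarith
    have hdiv : ∀ z, z ≤ lam → lam⁻¹ * z ≤ 1 := fun z hz => by
      rw [inv_mul_le_iff₀ hlam0, mul_one]; exact hz
    have hδE : lam⁻¹ * M * E' ≤ ε := by
      have h1 := hdiv (M * E' / ε) (by linarith)
      have h2 : lam⁻¹ * M * E' = lam⁻¹ * (M * E' / ε) * ε := by field_simp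
      rw [h2]
      exact mul_le_of_le_one_left hε.le h1
    have hstep : ∀ B, TrigBound D.V (damped b μ₁) (damped b μ₂) M B →
        TrigBound D.V (damped b μ₁) (damped b μ₂) M
          (((lam + (2 * (2 * hyp51.K) + 4)) * B + (ε + lam⁻¹ * M * E')) /
            (lam + b - 2 * max hyp.ω 0)) := by
      intro B hB
      refine trigBound_of_generator hyp hs.1 sol₁ sol₂ hM0.le hlam0.le (by linarith)
        (by linarith) fun ρ n a k η ha hw => ?_
      exact hB.abs_integral_generator_le hyp.dense_V hM0 D.F_meas hGm hG (le_max_right _ _)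
        (by linarith) (inv_nonneg.2 hlam0.le) (hdiv _ (by linarith)) (hdiv _ (by linarith))
        (mul_inv_cancel₀ hlam0.ne') hlam0.le (i1.mono_measure le1) (i2.mono_measure le2)
        (j1.mono_measure le1) (j2.mono_measure le2) hE hE'.ge ha hw
    have hβ : lam + b - 2 * max hyp.ω 0 = lam + (2 * (2 * hyp51.K) + 4) + 1 := by
      rw [hb]; ring
    rw [hβ] at hstep
    set κ := lam + (2 * (2 * hyp51.K) + 4) with hκ
    have hκ0 : 0 < κ := by linarith
    have hT : TrigBound D.V (damped b μ₁) (damped b μ₂) M (ε + lam⁻¹ * M * E') := by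
      refine TrigBound.of_contraction (q := κ / (κ + 1)) (by positivity)
        ((div_lt_one (by positivity)).2 (by linarith)) (trigBound_univ _ _ _ _) fun B hB => ?_
      convert hstep B hB using 1
      field_simp
      ring
    have hcls : ∀ t, SecondDiffClass (c * (1 + ‖h‖) ^ 2) M fun x =>
        α t * Real.cos (⟪x, h⟫_ℝ + θ) := fun t => secondDiffClass_cos h θ (hc t) hM1
    have := hT _ _ (trigSpan.cos_mem hα hc hh θ) hcls
    have hρ := (hcls 0).nonneg
    refine this.trans ?_
    gcongr
    linarith
  have hlim : Tendsto (fun ε : ℝ => c * (1 + ‖h‖) ^ 2 * (2 * ε)) (𝓝[>] 0) (𝓝 0) := by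
    have : Continuous fun ε : ℝ => c * (1 + ‖h‖) ^ 2 * (2 * ε) := by fun_prop
    have := this.tendsto 0
    simp only [mul_zero] at this
    exact this.mono_left nhdsWithin_le_nhds
  exact ge_of_tendsto hlim (eventually_mem_nhdsWithin.mono fun ε hε => key ε hε)

/-- Two solutions with the moment bound coincide. -/
theorem IsFPSol.eq_of_moment1 (sol₁ : D.IsFPSol s ζ μ₁ μt₁) (sol₂ : D.IsFPSol s ζ μ₂ μt₂)
    [IsProbabilityMeasure ζ] (hyp : D.Hyp31) (hyp51 : D.Hyp51) (hs : s ∈ Icc 0 D.T)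
    (hm₁ : D.moment1 s μt₁) (hm₂ : D.moment1 s μt₂) : μ₁ = μ₂ := by
  have hf1 := sol₁.isFiniteMeasure
  have hf2 := sol₂.isFiniteMeasure
  refine measure_eq_of_integral_cos hyp.dense_V fun B hB k hk θ => ?_
  set b : ℝ := 2 * max hyp.ω 0 + (2 * (2 * hyp51.K) + 4) + 1 with hb
  set α : ℝ → ℝ := fun t => (B ∩ Icc s D.T).indicator (fun t => Real.exp (b * t)) t with hα
  have hαm : Measurable α := Measurable.indicator (by fun_prop) (hB.inter measurableSet_Icc)
  have hαc : ∀ t, |α t| ≤ Real.exp (|b| * D.T) := by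
    intro t
    simp only [hα]
    by_cases ht : t ∈ B ∩ Icc s D.T
    · rw [indicator_of_mem ht, abs_of_pos (Real.exp_pos _), Real.exp_le_exp]
      have h0 : 0 ≤ t := hs.1.trans ht.2.1
      calc b * t ≤ |b| * t := by gcongr; exact le_abs_self b
        _ ≤ _ := by gcongr; exact ht.2.2
    · rw [indicator_of_notMem ht, abs_zero]; positivity
  have key : ∀ {μ : Measure (ℝ × H)} {μt : ℝ → Measure H}, D.IsFPSol s ζ μ μt →
      ∫ p, α p.1 * Real.cos (⟪p.2, k⟫_ℝ + θ) ∂(damped b μ) =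
        ∫ p, B.indicator 1 p.1 * Real.cos (⟪p.2, k⟫_ℝ + θ) ∂μ := by
    intro μ μt sol
    rw [integral_damped]
    refine integral_congr_ae ?_
    filter_upwards [sol.ae_mem] with p hp
    by_cases hpB : p.1 ∈ B
    · simp only [hα, indicator_of_mem hpB, indicator_of_mem (mem_inter hpB hp), Pi.one_apply]
      rw [← mul_assoc, ← Real.exp_add, neg_add_cancel, Real.exp_zero]
    · have : p.1 ∉ B ∩ Icc s D.T := fun h => hpB h.1
      simp only [hα, indicator_of_notMem hpB, indicator_of_notMem this, zero_mul, mul_zero]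
  rw [← key sol₁, ← key sol₂]
  exact sol₁.integral_damped_eq sol₂ hyp hyp51 hs hm₁ hm₂ hαm hαc hk θ hb

end Conclusion

end FPData

section Theorems

open MeasureTheory Set Filter Topology
open scoped InnerProductSpace ENNReal NNReal

variable {H : Type} [NormedAddCommGroup H] [InnerProductSpace ℝ H] [CompleteSpace H]
  [SecondCountableTopology H] [MeasurableSpace H] [BorelSpace H]

/-- Corollary 4.3/5.3: uniqueness in the possibly degenerate case. -/
theorem statement11 (D : FPData H) (hyp : D.Hyp31) (hyp51 : D.Hyp51)
    (s : ℝ) (hs : s ∈ Icc 0 D.T) (ζ : Measure H) [IsProbabilityMeasure ζ] :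
    {μ : Measure (ℝ × H) |
      ∃ μt : ℝ → Measure H, D.IsFPSol s ζ μ μt ∧ D.moment1 s μt}.Subsingleton := by
  rintro μ₁ ⟨μt₁, sol₁, hm₁⟩ μ₂ ⟨μt₂, sol₂, hm₂⟩
  exact sol₁.eq_of_moment1 sol₂ hyp hyp51 hs hm₁ hm₂

end Theorems
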